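/- Let Ω ⊂ ℂⁿ, n ≥ 2, be a bounded pseudoconvex domain with C^∞ boundary, and let p ∈ ∂Ω be a strongly pseudoconvex boundary point. Let F : Ω → Ω be a holomorphic map with F(z) = z + o(‖z−p‖) as z → p within Ω, and suppose F is not the identity map. Then either the iterates F^m converge normally to p (i.e., F^m converges to the constant map p uniformly on compact subsets of Ω), or there exists a nonconstant holomorphic retraction r : Ω → Ω (r ∘ r = r) such that F(w) = w for every w ∈ r(Ω). -/

import Mathlib

open Complex Topology Filter Metric Set Function

noncomputable section

/-- `ℂⁿ` as a normed space. -/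
abbrev En (n : ℕ) : Type := EuclideanSpace ℂ (Fin n)

/-- A domain: a nonempty open connected set. -/
def IsDomain' {n : ℕ} (Ω : Set (En n)) : Prop :=
  IsOpen Ω ∧ IsConnected Ω

/-- The Levi form of `ρ` at `q` in direction `ξ`:
`(1/4)(H_q(ξ,ξ) + H_q(iξ,iξ))` with `H_q` the second real Fréchet derivative. -/
def LeviForm {n : ℕ} (ρ : En n → ℝ) (q ξ : En n) : ℝ :=
  (1 / 4) * (iteratedFDeriv ℝ 2 ρ q ![ξ, ξ] + iteratedFDeriv ℝ 2 ρ q ![I • ξ, I • ξ])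

/-- `ξ` lies in the complex tangent space of `{ρ = 0}` at `q`. -/
def InCplxTangent {n : ℕ} (ρ : En n → ℝ) (q ξ : En n) : Prop :=
  fderiv ℝ ρ q ξ = 0 ∧ fderiv ℝ ρ q (I • ξ) = 0

/-- `ρ` is a `C^m` defining function for `Ω`. -/
def IsDefiningFunction {n : ℕ} (Ω : Set (En n)) (m : ℕ∞) (ρ : En n → ℝ) : Prop :=
  ContDiff ℝ m ρ ∧ Ω = {z | ρ z < 0} ∧ frontier Ω = {z | ρ z = 0} ∧
    ∀ q ∈ frontier Ω, fderiv ℝ ρ q ≠ 0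

/-- `q` is a strongly pseudoconvex point with respect to `ρ`. -/
def StronglyPcxAt {n : ℕ} (ρ : En n → ℝ) (q : En n) : Prop :=
  ∀ ξ : En n, ξ ≠ 0 → InCplxTangent ρ q ξ → 0 < LeviForm ρ q ξ

/-- `Ω` is pseudoconvex with `C^∞` boundary, witnessed by the defining function `ρ`. -/
def IsPcxCinfBoundary {n : ℕ} (Ω : Set (En n)) (ρ : En n → ℝ) : Prop :=
  IsDefiningFunction Ω ⊤ ρ ∧
    ∀ q ∈ frontier Ω, ∀ ξ : En n, InCplxTangent ρ q ξ → 0 ≤ LeviForm ρ q ξ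

/-- `F z = z + o(‖z - p‖^k)` as `z → p` within `Ω`. -/
def LittleOh {n : ℕ} (Ω : Set (En n)) (F : En n → En n) (p : En n) (k : ℕ) : Prop :=
  Tendsto (fun z => ‖F z - z‖ / ‖z - p‖ ^ k) (𝓝[Ω] p) (𝓝 0)

/-- `F` is an automorphism of `Ω`: a holomorphic bijection with holomorphic inverse. -/
def IsAutomorphismOf {n : ℕ} (F : En n → En n) (Ω : Set (En n)) : Prop :=
  DifferentiableOn ℂ F Ω ∧ MapsTo F Ω Ω ∧
    ∃ G : En n → En n, DifferentiableOn ℂ G Ω ∧ MapsTo G Ω Ω ∧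
      (∀ z ∈ Ω, G (F z) = z) ∧ (∀ z ∈ Ω, F (G z) = z)

section HolomorphicEstimates

variable {E F : Type*} [NormedAddCommGroup E] [NormedSpace ℂ E] [NormedAddCommGroup F]
  [NormedSpace ℂ F]

theorem norm_sub_le_of_bounded_holo {f : E → F} {z y : E} {R M : ℝ}
    (hd : DifferentiableOn ℂ f (ball z R)) (hM : ∀ y ∈ ball z R, ‖f y‖ ≤ M) (hy : y ∈ ball z R) :
    ‖f y - f z‖ ≤ 2 * M / R * ‖y - z‖ := by
  have hR : 0 < R := nonempty_ball.mp ⟨_, hy⟩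
  have h := Complex.dist_le_div_mul_dist_of_mapsTo_ball (R₂ := 2 * M) hd (fun w hw => by
    rw [mem_closedBall, dist_eq_norm]
    have := norm_sub_le (f w) (f z)
    linarith [hM w hw, hM z (mem_ball_self hR)]) hy
  simpa [dist_eq_norm] using h

theorem norm_fderiv_le_of_bounded_holo {f : E → F} {z : E} {R M : ℝ} (hR : 0 < R)
    (hd : DifferentiableOn ℂ f (ball z R)) (hM : ∀ y ∈ ball z R, ‖f y‖ ≤ M) :
    ‖fderiv ℂ f z‖ ≤ 2 * M / R := by
  refine Complex.norm_fderiv_le_div_of_mapsTo_ball (R₂ := 2 * M) hd (fun w hw => ?_) hR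
  rw [mem_closedBall, dist_eq_norm]
  have := norm_sub_le (f w) (f z)
  linarith [hM w hw, hM z (mem_ball_self hR)]

theorem norm_taylor_le_of_bounded_holo {f : E → F} {z y : E} {R M : ℝ}
    (hd : DifferentiableOn ℂ f (ball z R)) (hM : ∀ y ∈ ball z R, ‖f y‖ ≤ M) (hy : y ∈ ball z R) :
    ‖f y - f z - fderiv ℂ f z (y - z)‖ ≤ 4 * M / R ^ 2 * ‖y - z‖ ^ 2 := by
  have hR : 0 < R := nonempty_ball.mp ⟨_, hy⟩
  have hM0 : 0 ≤ M := (norm_nonneg _).trans (hM z (mem_ball_self hR))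
  set A := fderiv ℂ f z with hA
  have hAn : ‖A‖ ≤ 2 * M / R := norm_fderiv_le_of_bounded_holo hR hd hM
  have hfz : HasFDerivAt f A z :=
    (hd.differentiableAt (ball_mem_nhds _ hR)).hasFDerivAt
  have h := Complex.dist_le_mul_div_pow_of_mapsTo_ball_of_isLittleO (n := 1) (R₁ := R)
    (R₂ := 4 * M) (c := z) (z := y) (f := fun w => f w - A (w - z))
    (hd.sub ((A.differentiable.comp (differentiable_id.sub_const z)).differentiableOn)) ?_ ?_ hy
  · have e : dist (f y - A (y - z)) (f z - A (z - z)) = ‖f y - f z - A (y - z)‖ := by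
      rw [dist_eq_norm]; simp; congr 1; abel
    rw [e] at h
    refine h.trans (le_of_eq ?_)
    rw [dist_eq_norm, div_pow]; ring
  · intro w hw
    rw [mem_closedBall, dist_eq_norm]
    have hw' : ‖w - z‖ ≤ R := by
      have := mem_ball.mp hw; rw [dist_eq_norm] at this; exact this.le
    have h1 : ‖A (w - z)‖ ≤ 2 * M := by
      calc ‖A (w - z)‖ ≤ ‖A‖ * ‖w - z‖ := A.le_opNorm _
        _ ≤ 2 * M / R * R := by gcongr
        _ = 2 * M := by field_simp
    have h2 := hM w hw
    have h3 := hM z (mem_ball_self hR)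
    have e : f w - A (w - z) - (f z - A (z - z)) = f w - f z - A (w - z) := by simp; abel
    rw [e]
    have := norm_sub_le (f w - f z) (A (w - z))
    have := norm_sub_le (f w) (f z)
    linarith
  · have := hfz.isLittleO.norm_right
    refine this.congr (fun w => ?_) (fun w => ?_)
    · simp; abel
    · simp

end HolomorphicEstimates

section UltrafilterLimits

variable {ι F : Type*} [NormedAddCommGroup F] [ProperSpace F]

theorem tendsto_ultrafilter_limUnder (U : Ultrafilter ι) {f : ι → F} {M : ℝ}
    (h : ∀ᶠ i in (U : Filter ι), ‖f i‖ ≤ M) :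
    Tendsto f U (𝓝 (limUnder (U : Filter ι) f)) := by
  have hK : IsCompact (closedBall (0 : F) M) := isCompact_closedBall _ _
  have : ((U.map f : Ultrafilter F) : Filter F) ≤ 𝓟 (closedBall (0 : F) M) := by
    rw [le_principal_iff]
    exact mem_map.mpr (by filter_upwards [h] with i hi; simpa using hi)
  obtain ⟨x, -, hx⟩ := hK.ultrafilter_le_nhds (U.map f) this
  exact tendsto_nhds_limUnder ⟨x, hx⟩

theorem exists_tendsto_ultrafilter (U : Ultrafilter ι) {f : ι → F} {M : ℝ}
    (h : ∀ᶠ i in (U : Filter ι), ‖f i‖ ≤ M) : ∃ a, Tendsto f U (𝓝 a) :=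
  ⟨_, tendsto_ultrafilter_limUnder U h⟩

end UltrafilterLimits

section NormalFamilies

variable {ι E F : Type*} [NormedAddCommGroup E] [NormedSpace ℂ E] [FiniteDimensional ℂ E]
  [NormedAddCommGroup F] [NormedSpace ℂ F] [FiniteDimensional ℂ F]

theorem hasFDerivAt_ultrafilter_limit (U : Ultrafilter ι) {f : ι → E → F} {g : E → F} {z : E}
    {R M : ℝ} (hR : 0 < R)
    (hd : ∀ᶠ i in (U : Filter ι), DifferentiableOn ℂ (f i) (ball z R))
    (hM : ∀ᶠ i in (U : Filter ι), ∀ y ∈ ball z R, ‖f i y‖ ≤ M)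
    (hlim : ∀ y ∈ ball z R, Tendsto (fun i => f i y) U (𝓝 (g y))) :
    ∃ A : E →L[ℂ] F, Tendsto (fun i => fderiv ℂ (f i) z) U (𝓝 A) ∧ HasFDerivAt g A z := by
  have : ProperSpace (E →L[ℂ] F) := FiniteDimensional.proper ℂ _
  obtain ⟨A, hA⟩ := exists_tendsto_ultrafilter U (f := fun i => fderiv ℂ (f i) z)
    (M := 2 * M / R) (by
      filter_upwards [hd, hM] with i h1 h2
      exact norm_fderiv_le_of_bounded_holo hR h1 h2)
  refine ⟨A, hA, ?_⟩
  have key : ∀ y ∈ ball z R, ‖g y - g z - A (y - z)‖ ≤ 4 * M / R ^ 2 * ‖y - z‖ ^ 2 := by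
    intro y hy
    have h1 : Tendsto (fun i => ‖f i y - f i z - fderiv ℂ (f i) z (y - z)‖) U
        (𝓝 ‖g y - g z - A (y - z)‖) := by
      refine ((hlim y hy).sub (hlim z (mem_ball_self hR))).sub ?_ |>.norm
      exact ((ContinuousLinearMap.apply ℂ F (y - z)).continuous.tendsto A).comp hA
    refine le_of_tendsto h1 ?_
    filter_upwards [hd, hM] with i h1 h2
    exact norm_taylor_le_of_bounded_holo h1 h2 hy
  rw [hasFDerivAt_iff_isLittleO]
  refine Asymptotics.IsBigO.trans_isLittleO (g := fun y => ‖y - z‖ ^ 2)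
    (Asymptotics.IsBigO.of_bound (4 * M / R ^ 2) ?_) ?_
  · filter_upwards [ball_mem_nhds z hR] with y hy
    simpa using key y hy
  · have : Tendsto (fun y => y - z) (𝓝 z) (𝓝 (0 : E)) := by
      simpa using (continuous_id.sub continuous_const).tendsto (x := z) (f := fun y => y - z)
    have h2 := (Asymptotics.isLittleO_norm_pow_id (E' := E) (n := 2) one_lt_two).comp_tendsto this
    exact h2

theorem differentiableAt_ultrafilter_limit (U : Ultrafilter ι) {f : ι → E → F} {g : E → F} {z : E}
    {R M : ℝ} (hR : 0 < R)
    (hd : ∀ᶠ i in (U : Filter ι), DifferentiableOn ℂ (f i) (ball z R))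
    (hM : ∀ᶠ i in (U : Filter ι), ∀ y ∈ ball z R, ‖f i y‖ ≤ M)
    (hlim : ∀ y ∈ ball z R, Tendsto (fun i => f i y) U (𝓝 (g y))) : DifferentiableAt ℂ g z := by
  obtain ⟨A, -, hA⟩ := hasFDerivAt_ultrafilter_limit U hR hd hM hlim
  exact hA.differentiableAt

theorem tendsto_ultrafilter_moving (U : Ultrafilter ι) {f : ι → E → F} {z : E} {b : F}
    {y : ι → E} {R M : ℝ} (hR : 0 < R)
    (hd : ∀ᶠ i in (U : Filter ι), DifferentiableOn ℂ (f i) (ball z R))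
    (hM : ∀ᶠ i in (U : Filter ι), ∀ y ∈ ball z R, ‖f i y‖ ≤ M)
    (hlim : Tendsto (fun i => f i z) U (𝓝 b)) (hy : Tendsto y U (𝓝 z)) :
    Tendsto (fun i => f i (y i)) U (𝓝 b) := by
  have h1 : Tendsto (fun i => f i (y i) - f i z) U (𝓝 0) := by
    refine squeeze_zero_norm' (a := fun i => 2 * M / R * ‖y i - z‖) ?_ ?_
    · filter_upwards [hd, hM, hy (ball_mem_nhds z hR)] with i h1 h2 h3
      exact norm_sub_le_of_bounded_holo h1 h2 h3
    · have : Tendsto (fun i => ‖y i - z‖) U (𝓝 ‖z - z‖) := (hy.sub_const z).norm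
      simpa using this.const_mul (2 * M / R)
  simpa using h1.add hlim

theorem differentiableOn_fderiv_apply {f : E → F} {Ω : Set E} {M : ℝ} (hΩ : IsOpen Ω)
    (hd : DifferentiableOn ℂ f Ω) (hM : ∀ y ∈ Ω, ‖f y‖ ≤ M) (a : E) :
    DifferentiableOn ℂ (fun z => fderiv ℂ f z a) Ω := by
  intro z hz
  obtain ⟨R, hR, hball⟩ := Metric.isOpen_iff.mp hΩ z hz
  obtain ⟨U, hU⟩ := Ultrafilter.exists_le (𝓝[≠] (0 : ℂ))
  have hU0 : Tendsto (fun t : ℂ => t) U (𝓝 0) := hU.trans nhdsWithin_le_nhds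
  have hta : Tendsto (fun t : ℂ => t • a) U (𝓝 0) := by simpa using hU0.smul_const a
  have hball' : ∀ᶠ t : ℂ in (U : Filter ℂ), t ≠ 0 ∧ ‖t • a‖ < R / 4 := by
    have h1 : ∀ᶠ t : ℂ in (U : Filter ℂ), t ≠ 0 := hU self_mem_nhdsWithin
    have h2 := hta.norm.eventually_lt_const (u := R / 4) (by simpa using by linarith)
    exact h1.and h2
  have hin : ∀ y ∈ ball z (R / 2), ∀ v : E, ‖v‖ < R / 4 → ball (y + v) (R / 4) ⊆ Ω := by
    intro y hy v hv w hw
    apply hball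
    rw [mem_ball, dist_eq_norm] at *
    have : w - z = (w - (y + v)) + (y - z) + v := by abel
    rw [this]
    linarith [norm_add_le ((w - (y + v)) + (y - z)) v, norm_add_le (w - (y + v)) (y - z)]
  refine DifferentiableAt.differentiableWithinAt ?_
  refine differentiableAt_ultrafilter_limit U
    (f := fun (t : ℂ) (y : E) => t⁻¹ • (f (y + t • a) - f y))
    (g := fun y => fderiv ℂ f y a) (z := z) (R := R / 2) (M := 8 * M / R * ‖a‖) (by linarith)
    ?_ ?_ ?_
  · filter_upwards [hball'] with t ht
    refine DifferentiableOn.const_smul (DifferentiableOn.sub ?_ ?_) _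
    · refine hd.comp ((differentiable_id.add_const _).differentiableOn) ?_
      intro y hy
      exact hin y hy _ ht.2 (mem_ball_self (by linarith))
    · refine hd.mono (fun y hy => ?_)
      have := hin y hy 0 (by simpa using by linarith)
      simpa using this (mem_ball_self (by linarith))
  · filter_upwards [hball'] with t ht y hy
    have hsub : ball y (R / 4) ⊆ Ω := by
      simpa using hin y hy 0 (by simpa using by linarith)
    have := norm_sub_le_of_bounded_holo (z := y) (y := y + t • a) (hd.mono hsub)
      (fun w hw => hM w (hsub hw)) (by simpa using ht.2)
    rw [norm_smul, norm_inv]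
    have ht0 : 0 < ‖t‖ := norm_pos_iff.mpr ht.1
    rw [inv_mul_le_iff₀ ht0]
    refine this.trans (le_of_eq ?_)
    rw [add_sub_cancel_left, norm_smul]
    field_simp; ring
  · intro y hy
    have hyΩ : y ∈ Ω := by
      simpa using hin y hy 0 (by simpa using by linarith) (mem_ball_self (by linarith))
    have hder := (hd.differentiableAt (hΩ.mem_nhds hyΩ)).hasFDerivAt.hasLineDerivAt a
    have := hder.tendsto_slope_zero
    exact this.mono_left hU

end NormalFamilies

section BallChain

variable {E : Type*} [NormedAddCommGroup E]

theorem forall_mem_of_ball_chain {Ω : Set E} (hΩ : IsOpen Ω) (hc : IsPreconnected Ω)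
    {P : E → Prop} (hP : ∀ z r, ball z r ⊆ Ω → P z → ∀ y ∈ ball z r, P y)
    {z₀ : E} (hz₀ : z₀ ∈ Ω) (h₀ : P z₀) : ∀ z ∈ Ω, P z := by
  by_contra hcon
  push Not at hcon
  obtain ⟨z₁, hz₁, hn⟩ := hcon
  have ho1 : IsOpen {z | z ∈ Ω ∧ P z} := by
    rw [Metric.isOpen_iff]
    rintro z ⟨hz, hPz⟩
    obtain ⟨r, hr, hb⟩ := Metric.isOpen_iff.mp hΩ z hz
    exact ⟨r, hr, fun y hy => ⟨hb hy, hP z r hb hPz y hy⟩⟩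
  have ho2 : IsOpen {z | z ∈ Ω ∧ ¬ P z} := by
    rw [Metric.isOpen_iff]
    rintro z ⟨hz, hPz⟩
    obtain ⟨r, hr, hb⟩ := Metric.isOpen_iff.mp hΩ z hz
    refine ⟨r / 2, by linarith, fun y hy => ?_⟩
    have hsub : ball y (r / 2) ⊆ Ω := by
      refine (ball_subset_ball' ?_).trans hb
      have := mem_ball.mp hy; linarith
    exact ⟨hsub (mem_ball_self (by linarith)), fun hPy => hPz (hP y _ hsub hPy z
      (by rwa [mem_ball_comm]))⟩
  obtain ⟨x, -, hx1, hx2⟩ := hc _ _ ho1 ho2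
    (fun z hz => by by_cases h : P z; exacts [Or.inl ⟨hz, h⟩, Or.inr ⟨hz, h⟩])
    ⟨z₀, hz₀, hz₀, h₀⟩ ⟨z₁, hz₁, hz₁, hn⟩
  exact hx2.2 hx1.2

variable [NormedSpace ℂ E]

/-- Slice lemma: restrict to a complex line through the centre of a ball. -/
theorem exists_line_in_ball {z y : E} {r : ℝ} (hy : y ∈ ball z r) :
    ∃ R : ℝ, 1 < R ∧ ∀ t ∈ ball (0 : ℂ) R, z + t • (y - z) ∈ ball z r := by
  have hr : 0 < r := nonempty_ball.mp ⟨_, hy⟩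
  rw [mem_ball, dist_eq_norm] at hy
  by_cases h : y - z = 0
  · exact ⟨2, by norm_num, fun t _ => by simp [h, hr]⟩
  · have hpos : 0 < ‖y - z‖ := norm_pos_iff.mpr h
    refine ⟨r / ‖y - z‖, by rwa [one_lt_div hpos], fun t ht => ?_⟩
    rw [mem_ball_zero_iff] at ht
    rw [mem_ball, dist_eq_norm, add_sub_cancel_left, norm_smul]
    rwa [lt_div_iff₀ hpos] at ht

variable {F : Type*} [NormedAddCommGroup F] [NormedSpace ℂ F] [CompleteSpace F]

/-- Identity theorem for holomorphic maps on an open connected set of a complex normed space. -/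
theorem eqOn_of_eventuallyEq_holo {Ω : Set E} (hΩ : IsOpen Ω) (hc : IsPreconnected Ω)
    {f g : E → F} (hf : DifferentiableOn ℂ f Ω) (hg : DifferentiableOn ℂ g Ω)
    {z₀ : E} (hz₀ : z₀ ∈ Ω) (h₀ : f =ᶠ[𝓝 z₀] g) : EqOn f g Ω := by
  have := forall_mem_of_ball_chain (P := fun z => f =ᶠ[𝓝 z] g) hΩ hc ?_ hz₀ h₀
  · exact fun z hz => (this z hz).self_of_nhds
  intro z r hb hz y hy
  have hball : ∀ y ∈ ball z r, f y = g y := by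
    intro y hy
    obtain ⟨R, hR, hline⟩ := exists_line_in_ball hy
    have hdf : ∀ {k : E → F}, DifferentiableOn ℂ k Ω →
        AnalyticOnNhd ℂ (fun t : ℂ => k (z + t • (y - z))) (ball 0 R) := by
      intro k hk
      refine DifferentiableOn.analyticOnNhd ?_ isOpen_ball
      refine hk.comp ?_ (fun t ht => hb (hline t ht))
      exact (Differentiable.const_add _ (differentiable_id.smul_const _)).differentiableOn
    have h0 : (fun t : ℂ => f (z + t • (y - z))) =ᶠ[𝓝 0] (fun t : ℂ => g (z + t • (y - z))) := by
      have : Tendsto (fun t : ℂ => z + t • (y - z)) (𝓝 0) (𝓝 z) := by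
        have : Continuous (fun t : ℂ => z + t • (y - z)) := by fun_prop
        simpa using this.tendsto 0
      exact this.eventually hz
    have := (hdf hf).eqOn_of_preconnected_of_eventuallyEq (hdf hg)
      (convex_ball _ _).isPreconnected (mem_ball_self (by linarith)) h0
    have := this (x := 1) (by simpa using hR)
    simpa using this
  filter_upwards [isOpen_ball.mem_nhds hy] with w hw using hball w hw

end BallChain

section HalfPlane

/-- The open right half plane. -/
def rightHP : Set ℂ := {x | 0 < x.re}

theorem isOpen_rightHP : IsOpen rightHP := isOpen_lt continuous_const Complex.continuous_re

theorem isPreconnected_rightHP : IsPreconnected rightHP :=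
  (convex_halfSpace_re_gt 0).isPreconnected

theorem tendsto_ofReal_inv_atTop : Tendsto (fun X : ℝ => (X : ℂ)⁻¹) atTop (𝓝 0) := by
  have := (Complex.continuous_ofReal.tendsto 0).comp (tendsto_inv_atTop_zero (𝕜 := ℝ))
  simpa [Function.comp_def] using this

theorem norm_sub_sq_half (a b : ℂ) :
    ‖a + (starRingEnd ℂ) b‖ ^ 2 - ‖a - b‖ ^ 2 = 4 * a.re * b.re := by
  rw [Complex.sq_norm, Complex.sq_norm, Complex.normSq_apply, Complex.normSq_apply]
  simp; ring

/-- Schwarz lemma on a disc for functions with nonnegative real part. -/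
theorem schwarz_re_nonneg {f : ℂ → ℂ} {c x : ℂ} {R : ℝ} (hd : DifferentiableOn ℂ f (ball c R))
    (hf : ∀ y ∈ ball c R, 0 ≤ (f y).re) (hx : x ∈ ball c R) :
    ‖f x - f c‖ * R ≤ ‖x - c‖ * ‖f x + (starRingEnd ℂ) (f c)‖ := by
  have hR : 0 < R := nonempty_ball.mp ⟨_, hx⟩
  have key : ∀ η > 0, ‖f x - f c‖ * R ≤ ‖x - c‖ * ‖f x + (starRingEnd ℂ) (f c) + 2 * (η : ℝ)‖ := by
    intro η hη
    have hne : ∀ y ∈ ball c R, f y + (starRingEnd ℂ) (f c) + 2 * (η : ℝ) ≠ 0 := by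
      intro y hy h0
      have := congrArg Complex.re h0
      simp at this
      linarith [hf y hy, hf c (mem_ball_self hR)]
    have h := Complex.dist_le_div_mul_dist_of_mapsTo_ball
      (f := fun y => (f y - f c) / (f y + (starRingEnd ℂ) (f c) + 2 * (η : ℝ))) (c := c)
      (R₁ := R) (R₂ := 1) (z := x) ?_ ?_ hx
    · simp only [sub_self, zero_div, dist_eq_norm, sub_zero, norm_div] at h
      have hp : 0 < ‖f x + (starRingEnd ℂ) (f c) + 2 * (η : ℝ)‖ := norm_pos_iff.mpr (hne x hx)
      rw [div_le_iff₀ hp] at h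
      calc ‖f x - f c‖ * R ≤ (1 / R * ‖x - c‖ * ‖f x + (starRingEnd ℂ) (f c) + 2 * (η : ℝ)‖) * R := by
            gcongr
        _ = _ := by field_simp
    · refine DifferentiableOn.div (hd.sub_const _) ((hd.add_const _).add_const _) hne
    · intro y hy
      simp only [sub_self, zero_div, mem_closedBall, dist_zero_right, norm_div]
      rw [div_le_one (norm_pos_iff.mpr (hne y hy))]
      have h1 := norm_sub_sq_half (f y + η) (f c + η)
      have e1 : f y + η + (starRingEnd ℂ) (f c + η) = f y + (starRingEnd ℂ) (f c) + 2 * (η : ℝ) := by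
        simp; ring
      have e2 : f y + η - (f c + η) = f y - f c := by ring
      rw [e1, e2] at h1
      have h2 : 0 ≤ 4 * (f y + η).re * (f c + η).re := by
        have := hf y hy
        have := hf c (mem_ball_self hR)
        simp; positivity
      exact le_of_sq_le_sq (by linarith) (norm_nonneg _)
  have ht : Tendsto (fun η : ℝ => ‖x - c‖ * ‖f x + (starRingEnd ℂ) (f c) + 2 * (η : ℝ)‖) (𝓝[>] 0)
      (𝓝 (‖x - c‖ * ‖f x + (starRingEnd ℂ) (f c)‖)) := by
    refine Tendsto.mono_left ?_ nhdsWithin_le_nhds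
    have : Continuous fun η : ℝ => ‖x - c‖ * ‖f x + (starRingEnd ℂ) (f c) + 2 * (η : ℝ)‖ := by
      fun_prop
    simpa using this.tendsto 0
  exact ge_of_tendsto ht (by filter_upwards [self_mem_nhdsWithin] with η hη using key η hη)

theorem norm_sub_le_re_disc {f : ℂ → ℂ} {c x : ℂ} {R : ℝ} (hd : DifferentiableOn ℂ f (ball c R))
    (hf : ∀ y ∈ ball c R, 0 ≤ (f y).re) (hx : x ∈ ball c R) :
    ‖f x - f c‖ * (R - ‖x - c‖) ≤ 2 * ‖x - c‖ * (f c).re := by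
  have hR : 0 < R := nonempty_ball.mp ⟨_, hx⟩
  have h := schwarz_re_nonneg hd hf hx
  have e : f x + (starRingEnd ℂ) (f c) = (f x - f c) + (2 * (f c).re : ℝ) := by
    apply Complex.ext <;> simp <;> ring
  have h2 : ‖f x + (starRingEnd ℂ) (f c)‖ ≤ ‖f x - f c‖ + 2 * (f c).re := by
    rw [e]
    refine (norm_add_le _ _).trans ?_
    rw [Complex.norm_real, Real.norm_eq_abs, abs_of_nonneg]
    linarith [hf c (mem_ball_self hR)]
  nlinarith [norm_nonneg (x - c)]

theorem mem_ball_cayley {x x₀ : ℂ} (hx : x ∈ rightHP) (hx₀ : x₀ ∈ rightHP) :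
    x + (starRingEnd ℂ) x₀ ≠ 0 ∧ (x - x₀) / (x + (starRingEnd ℂ) x₀) ∈ ball (0 : ℂ) 1 := by
  have hx' : 0 < x.re := hx
  have hx₀' : 0 < x₀.re := hx₀
  have hne : x + (starRingEnd ℂ) x₀ ≠ 0 := by
    intro h
    have := congrArg Complex.re h
    simp at this; linarith
  refine ⟨hne, ?_⟩
  rw [mem_ball_zero_iff, norm_div, div_lt_one (norm_pos_iff.mpr hne)]
  have := norm_sub_sq_half x x₀
  have h4 : 0 < 4 * x.re * x₀.re := by positivity
  exact lt_of_pow_lt_pow_left₀ 2 (norm_nonneg _) (by linarith)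

/-- Schwarz–Pick inequality on the right half plane. -/
theorem schwarzPick_rightHP {f : ℂ → ℂ} (hd : DifferentiableOn ℂ f rightHP)
    (hf : ∀ y ∈ rightHP, 0 ≤ (f y).re) {x x₀ : ℂ} (hx : x ∈ rightHP) (hx₀ : x₀ ∈ rightHP) :
    ‖f x - f x₀‖ * ‖x + (starRingEnd ℂ) x₀‖ ≤ ‖x - x₀‖ * ‖f x + (starRingEnd ℂ) (f x₀)‖ := by
  obtain ⟨hne, hmem⟩ := mem_ball_cayley hx hx₀
  have hx₀' : 0 < x₀.re := hx₀
  have hne1 : ∀ ζ ∈ ball (0 : ℂ) 1, 1 - ζ ≠ 0 := by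
    intro ζ hζ h
    rw [mem_ball_zero_iff] at hζ
    have : ζ = 1 := by linear_combination -h
    simp [this] at hζ
  have hmaps : MapsTo (fun ζ : ℂ => (x₀ + (starRingEnd ℂ) x₀ * ζ) / (1 - ζ)) (ball 0 1) rightHP := by
    intro ζ hζ
    have hζn := hne1 ζ hζ
    rw [mem_ball_zero_iff] at hζ
    change 0 < ((x₀ + (starRingEnd ℂ) x₀ * ζ) / (1 - ζ)).re
    have hns : 0 < Complex.normSq (1 - ζ) := Complex.normSq_pos.mpr hζn
    rw [Complex.div_re, ← add_div]
    apply div_pos _ hns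
    have h1 : Complex.normSq ζ < 1 := by
      rw [Complex.normSq_eq_norm_sq]; nlinarith [norm_nonneg ζ]
    rw [Complex.normSq_apply] at h1
    simp
    nlinarith
  have h := schwarz_re_nonneg (f := fun ζ => f ((x₀ + (starRingEnd ℂ) x₀ * ζ) / (1 - ζ)))
    (c := 0) (R := 1) (hd.comp (by
      intro ζ hζ
      refine DifferentiableAt.differentiableWithinAt ?_
      exact ((differentiableAt_id.const_mul _).const_add _).div (differentiableAt_id.const_sub _)
        (hne1 ζ hζ)) hmaps) (fun y hy => hf _ (hmaps hy)) hmem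
  have e : (x₀ + (starRingEnd ℂ) x₀ * ((x - x₀) / (x + (starRingEnd ℂ) x₀))) /
      (1 - (x - x₀) / (x + (starRingEnd ℂ) x₀)) = x := by
    have h3 : 1 - (x - x₀) / (x + (starRingEnd ℂ) x₀) ≠ 0 := hne1 _ hmem
    rw [div_eq_iff h3]
    field_simp
    ring
  simp only [e, mul_zero, add_zero, sub_zero, div_one, mul_one, norm_div] at h
  rw [div_mul_eq_mul_div, le_div_iff₀ (norm_pos_iff.mpr hne)] at h
  exact h

theorem schwarzPick_re_rightHP {f : ℂ → ℂ} (hd : DifferentiableOn ℂ f rightHP)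
    (hf : ∀ y ∈ rightHP, 0 ≤ (f y).re) {x x₀ : ℂ} (hx : x ∈ rightHP) (hx₀ : x₀ ∈ rightHP) :
    x.re * x₀.re * ‖f x + (starRingEnd ℂ) (f x₀)‖ ^ 2 ≤
      (f x).re * (f x₀).re * ‖x + (starRingEnd ℂ) x₀‖ ^ 2 := by
  have h := schwarzPick_rightHP hd hf hx hx₀
  have h2 := pow_le_pow_left₀ (by positivity) h 2
  rw [mul_pow, mul_pow] at h2
  have e1 := norm_sub_sq_half x x₀
  have e2 := norm_sub_sq_half (f x) (f x₀)
  have e3 : ‖f x - f x₀‖ ^ 2 = ‖f x + (starRingEnd ℂ) (f x₀)‖ ^ 2 - 4 * (f x).re * (f x₀).re := by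
    linarith
  have e4 : ‖x - x₀‖ ^ 2 = ‖x + (starRingEnd ℂ) x₀‖ ^ 2 - 4 * x.re * x₀.re := by linarith
  rw [e3, e4] at h2
  nlinarith

/-- `Re f (x) / x` is nonincreasing on the positive reals. -/
theorem harnack_real_rightHP {f : ℂ → ℂ} (hd : DifferentiableOn ℂ f rightHP)
    (hf : ∀ y ∈ rightHP, 0 ≤ (f y).re) {y x : ℝ} (hy : 0 < y) (hyx : y ≤ x) :
    y * (f x).re ≤ x * (f y).re := by
  have hx : 0 < x := hy.trans_le hyx
  have hym : (y : ℂ) ∈ rightHP := by simpa [rightHP] using hy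
  have hxm : (x : ℂ) ∈ rightHP := by simpa [rightHP] using hx
  have h := schwarzPick_re_rightHP hd hf hym hxm
  have h1 : ((f y).re + (f x).re) ^ 2 ≤ ‖f y + (starRingEnd ℂ) (f x)‖ ^ 2 := by
    have := Complex.abs_re_le_norm (f y + (starRingEnd ℂ) (f x))
    simp only [add_re, conj_re] at this
    have := pow_le_pow_left₀ (abs_nonneg _) this 2
    rwa [sq_abs] at this
  have h2 : ‖(y : ℂ) + (starRingEnd ℂ) (x : ℂ)‖ ^ 2 = (y + x) ^ 2 := by
    rw [Complex.conj_ofReal, ← Complex.ofReal_add, Complex.norm_real, Real.norm_eq_abs, sq_abs]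
  rw [h2] at h
  simp only [ofReal_re] at h
  have hA := hf y hym
  have hB := hf x hxm
  set A := (f y).re
  set B := (f x).re
  have h3 : y * x * (A + B) ^ 2 ≤ A * B * (y + x) ^ 2 :=
    (mul_le_mul_of_nonneg_left h1 (by positivity)).trans h
  by_contra hcon
  push Not at hcon
  have h4 : 0 < x * B - y * A := by
    have : A < B := by
      by_contra hAB; push Not at hAB; nlinarith
    nlinarith
  nlinarith [mul_pos (sub_pos.mpr hcon) h4]

theorem growth_rightHP {f : ℂ → ℂ} (hd : DifferentiableOn ℂ f rightHP)
    (hf : ∀ y ∈ rightHP, 0 ≤ (f y).re) {x x₀ : ℂ} (hx : x ∈ rightHP) (hx₀ : x₀ ∈ rightHP) :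
    ‖f x - f x₀‖ * (x.re * x₀.re) ≤ ‖x + (starRingEnd ℂ) x₀‖ ^ 2 * (f x₀).re := by
  have hx' : 0 < x.re := hx
  have hx₀' : 0 < x₀.re := hx₀
  obtain ⟨hne, hmem⟩ := mem_ball_cayley hx hx₀
  rw [mem_ball_zero_iff, norm_div, div_lt_one (norm_pos_iff.mpr hne)] at hmem
  have h := schwarzPick_rightHP hd hf hx hx₀
  have e : f x + (starRingEnd ℂ) (f x₀) = (f x - f x₀) + (2 * (f x₀).re : ℝ) := by
    apply Complex.ext <;> simp <;> ring
  have hB := hf x₀ hx₀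
  have h2 : ‖f x + (starRingEnd ℂ) (f x₀)‖ ≤ ‖f x - f x₀‖ + 2 * (f x₀).re := by
    rw [e]
    refine (norm_add_le _ _).trans ?_
    rw [Complex.norm_real, Real.norm_eq_abs, abs_of_nonneg]
    linarith
  have e4 := norm_sub_sq_half x x₀
  set N := ‖f x - f x₀‖
  set a := ‖x + (starRingEnd ℂ) x₀‖
  set b := ‖x - x₀‖
  have hb : 0 ≤ b := norm_nonneg _
  have hN : 0 ≤ N := norm_nonneg _
  have h5 : N * (a - b) ≤ 2 * b * (f x₀).re := by nlinarith
  have h6 : N * (a - b) * (a + b) ≤ 2 * b * (f x₀).re * (a + b) := by gcongr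
  have h7 : 2 * b * (f x₀).re * (a + b) ≤ 4 * a ^ 2 * (f x₀).re := by
    have : b * (a + b) ≤ a * (a + a) := by gcongr
    nlinarith
  have h8 : N * (4 * x.re * x₀.re) ≤ 4 * a ^ 2 * (f x₀).re := by
    rw [← e4]
    nlinarith
  nlinarith

/-- Julia's lemma on the right half plane. -/
theorem julia_rightHP {f : ℂ → ℂ} (hd : DifferentiableOn ℂ f rightHP)
    (hf : ∀ y ∈ rightHP, 0 ≤ (f y).re) {κ : ℝ} (hκ : 0 < κ)
    (hlim : Tendsto (fun X : ℝ => f X / X) atTop (𝓝 (κ : ℂ))) {x : ℂ} (hx : x ∈ rightHP) :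
    κ * x.re ≤ (f x).re := by
  have hconst : ∀ a : ℂ, Tendsto (fun X : ℝ => a / (X : ℂ)) atTop (𝓝 0) := by
    intro a
    have := tendsto_ofReal_inv_atTop
    simpa [div_eq_mul_inv] using this.const_mul a
  have hineq : ∀ᶠ X : ℝ in atTop,
      x.re * ‖f x / X + (starRingEnd ℂ) (f X / X)‖ ^ 2 ≤
        (f x).re * (f X / X).re * ‖x / X + 1‖ ^ 2 := by
    filter_upwards [eventually_gt_atTop 0] with X hX
    have hXm : (X : ℂ) ∈ rightHP := by simpa [rightHP] using hX
    have h := schwarzPick_re_rightHP hd hf hx hXm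
    have hXne : (X : ℂ) ≠ 0 := by exact_mod_cast hX.ne'
    have hnX : ‖(X : ℂ)‖ = X := by rw [Complex.norm_real, Real.norm_of_nonneg hX.le]
    have e1 : f x / X + (starRingEnd ℂ) (f X / X) = (f x + (starRingEnd ℂ) (f X)) / X := by
      rw [map_div₀, Complex.conj_ofReal]; ring
    have e2 : x / X + 1 = (x + (starRingEnd ℂ) (X : ℂ)) / X := by
      rw [Complex.conj_ofReal]; field_simp
    have e3 : (f X / X).re = (f X).re / X := by rw [Complex.div_ofReal_re]
    rw [e1, e2, e3, norm_div, norm_div, hnX, div_pow, div_pow]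
    simp only [ofReal_re] at h
    rw [mul_div_assoc', mul_div_assoc', mul_div_assoc', div_mul_eq_mul_div, div_div,
      div_le_div_iff₀ (by positivity) (by positivity)]
    nlinarith [pow_pos hX 2]
  have hL : Tendsto (fun X : ℝ => x.re * ‖f x / X + (starRingEnd ℂ) (f X / X)‖ ^ 2) atTop
      (𝓝 (x.re * ‖0 + (starRingEnd ℂ) (κ : ℂ)‖ ^ 2)) := by
    refine (((hconst _).add ?_).norm.pow 2).const_mul _
    exact (Complex.continuous_conj.tendsto _).comp hlim
  have hRt : Tendsto (fun X : ℝ => (f x).re * (f X / X).re * ‖x / X + 1‖ ^ 2) atTop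
      (𝓝 ((f x).re * (κ : ℂ).re * ‖(0 : ℂ) + 1‖ ^ 2)) := by
    refine Tendsto.mul (((Complex.continuous_re.tendsto _).comp hlim).const_mul _) ?_
    exact ((hconst x).add_const 1).norm.pow 2
  have := le_of_tendsto_of_tendsto hL hRt hineq
  simp only [conj_ofReal, zero_add, norm_real, Real.norm_eq_abs, sq_abs, ofReal_re, norm_one,
    one_pow, mul_one] at this
  nlinarith

/-- A holomorphic function on the half plane growing at most like `√Re` vanishes. -/
theorem eq_zero_of_sq_norm_le_re {σ : ℂ → ℂ} (hd : DifferentiableOn ℂ σ rightHP) {C : ℝ}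
    (hσ : ∀ y ∈ rightHP, ‖σ y‖ ^ 2 ≤ C * y.re) {y : ℂ} (hy : y ∈ rightHP) : σ y = 0 := by
  wlog hC : 0 < C generalizing C
  · refine this (C := 1) (fun z hz => (hσ z hz).trans ?_) one_pos
    have : 0 < z.re := hz
    nlinarith
  have main : ∀ τ : ℂ → ℂ, DifferentiableOn ℂ τ rightHP → (∀ z ∈ rightHP, ‖τ z‖ ^ 2 ≤ C * z.re) →
      (τ y).re ≤ 0 := by
    intro τ hτd hτ
    refine le_of_forall_gt_imp_ge_of_dense fun l hl => ?_
    have h := julia_rightHP (f := fun z => (l : ℂ) + ((C / (4 * l) : ℝ) : ℂ) * z - τ z)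
      (κ := C / (4 * l)) (x := y)
      (((differentiableOn_id.const_mul _).const_add _).sub hτd) ?_ (by positivity) ?_ hy
    · simp only [sub_re, add_re, ofReal_re, Complex.re_ofReal_mul] at h
      linarith
    · intro z hz
      have hz' : 0 < z.re := hz
      have h1 : (τ z).re ≤ ‖τ z‖ := Complex.re_le_norm _
      have h2 := hτ z hz
      simp only [sub_re, add_re, ofReal_re, Complex.re_ofReal_mul]
      have h3 : ‖τ z‖ ≤ l + C / (4 * l) * z.re := by
        have : ‖τ z‖ * (4 * l) ≤ 4 * l ^ 2 + C * z.re := by nlinarith [sq_nonneg (‖τ z‖ - 2 * l)]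
        have e : l + C / (4 * l) * z.re = (4 * l ^ 2 + C * z.re) / (4 * l) := by field_simp
        rw [e, le_div_iff₀ (by positivity)]
        exact this
      linarith
    · have hinv := tendsto_ofReal_inv_atTop
      have h1 : Tendsto (fun X : ℝ => τ X / X) atTop (𝓝 0) := by
        have hg : Tendsto (fun X : ℝ => Real.sqrt (C * X⁻¹)) atTop (𝓝 0) := by
          have : Tendsto (fun X : ℝ => C * X⁻¹) atTop (𝓝 0) := by
            simpa using tendsto_inv_atTop_zero.const_mul C
          simpa [Function.comp_def] using (Real.continuous_sqrt.tendsto _).comp this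
        refine squeeze_zero_norm' ?_ hg
        filter_upwards [eventually_gt_atTop 0] with X hX
        have hXm : (X : ℂ) ∈ rightHP := by simpa [rightHP] using hX
        have := hτ X hXm
        rw [norm_div, Complex.norm_real, Real.norm_of_nonneg hX.le]
        apply Real.le_sqrt_of_sq_le
        rw [div_pow, div_le_iff₀ (by positivity)]
        simp only [ofReal_re] at this
        have e : C * X⁻¹ * X ^ 2 = C * X := by field_simp
        rw [e]; exact this
      have h2 := ((hinv.const_mul (l : ℂ)).add_const (((C / (4 * l) : ℝ) : ℂ))).sub h1
      simp only [mul_zero, zero_add, sub_zero] at h2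
      refine h2.congr' ?_
      filter_upwards [eventually_gt_atTop 0] with X hX
      have hXne : (X : ℂ) ≠ 0 := by exact_mod_cast hX.ne'
      field_simp
  have h1 := main σ hd hσ
  have h2 := main (fun z => -σ z) hd.neg (by simpa using hσ)
  have h3 := main (fun z => I * σ z) (hd.const_mul I) (by simpa using hσ)
  have h4 := main (fun z => -(I * σ z)) (hd.const_mul I).neg (by simpa using hσ)
  simp at h2 h3 h4
  apply Complex.ext <;> simp <;> linarith

/-- Rigidity: a half plane function with nonnegative real part and extremal real part on `(0,1]`
is affine. -/
theorem rigidity_rightHP {q : ℂ → ℂ} (hd : DifferentiableOn ℂ q rightHP)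
    (hq : ∀ y ∈ rightHP, 0 ≤ (q y).re) {b : ℝ}
    (hb : ∀ y : ℝ, 0 < y → y ≤ 1 → (q y).re = b * y) {y : ℂ} (hy : y ∈ rightHP) :
    q y = b * y + I * (q 1).im := by
  have hreal : ∀ y : ℝ, 0 < y → y ≤ 1 → q y = b * y + I * (q 1).im := by
    intro y hy hy1
    have hym : (y : ℂ) ∈ rightHP := by simpa [rightHP] using hy
    have h1m : (1 : ℂ) ∈ rightHP := by simp [rightHP]
    have h := schwarzPick_re_rightHP hd hq hym h1m
    have hb1 := hb 1 one_pos le_rfl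
    have hby := hb y hy hy1
    have h2 : ‖(y : ℂ) + (starRingEnd ℂ) (1 : ℂ)‖ ^ 2 = (y + 1) ^ 2 := by
      rw [map_one, ← Complex.ofReal_one, ← Complex.ofReal_add, Complex.norm_real,
        Real.norm_eq_abs, sq_abs]
    rw [h2, hby] at h
    simp only [ofReal_one, mul_one] at hb1
    rw [hb1] at h
    rw [Complex.sq_norm, Complex.normSq_apply] at h
    simp only [ofReal_re, one_re, add_re, add_im, conj_re, conj_im, hby, hb1] at h
    have h3 : ((q y).im - (q 1).im) * ((q y).im - (q 1).im) ≤ 0 := by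
      have : y * (((q y).im - (q 1).im) * ((q y).im - (q 1).im)) ≤ 0 := by nlinarith
      nlinarith
    have h4 : (q y).im = (q 1).im := by nlinarith
    apply Complex.ext <;> simp [hby, h4]
  have han : AnalyticOnNhd ℂ q rightHP := hd.analyticOnNhd isOpen_rightHP
  have han2 : AnalyticOnNhd ℂ (fun y : ℂ => (b : ℂ) * y + I * (q 1).im) rightHP := by
    refine DifferentiableOn.analyticOnNhd ?_ isOpen_rightHP
    exact ((differentiable_id.const_mul _).add_const _).differentiableOn
  have h12 : ((1 / 2 : ℝ) : ℂ) ∈ rightHP := by simp [rightHP]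
  refine han.eqOn_of_preconnected_of_frequently_eq han2 isPreconnected_rightHP h12 ?_ hy
  have hmap : Tendsto (fun t : ℝ => (t : ℂ)) (𝓝[≠] (1 / 2 : ℝ)) (𝓝[≠] ((1 / 2 : ℝ) : ℂ)) := by
    refine tendsto_nhdsWithin_of_tendsto_nhds_of_eventually_within _ ?_ ?_
    · exact (Complex.continuous_ofReal.tendsto _).mono_left nhdsWithin_le_nhds
    · filter_upwards [self_mem_nhdsWithin] with t ht h
      exact ht (Complex.ofReal_injective h)
  refine hmap.frequently (Eventually.frequently ?_)
  have : Ioo (0 : ℝ) 1 ∈ 𝓝[≠] (1 / 2 : ℝ) :=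
    mem_nhdsWithin_of_mem_nhds (Ioo_mem_nhds (by norm_num) (by norm_num))
  filter_upwards [this] with t ht using hreal t ht.1 ht.2.le

end HalfPlane

section SecondOrder

variable {E : Type*} [NormedAddCommGroup E] [NormedSpace ℝ E]

/-- Second order Taylor expansion with little-o remainder. -/
theorem taylor_two_le {ρ : E → ℝ} (hρ : ContDiff ℝ 2 ρ) (p : E) {η : ℝ} (hη : 0 < η) :
    ∃ δ > 0, ∀ v : E, ‖v‖ < δ →
      |ρ (p + v) - ρ p - fderiv ℝ ρ p v - (1 / 2) * fderiv ℝ (fderiv ℝ ρ) p v v| ≤ η * ‖v‖ ^ 2 := by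
  set H := fderiv ℝ (fderiv ℝ ρ) p with hH
  have hsymm : ∀ u w, H u w = H w u := by
    have : IsSymmSndFDerivAt ℝ ρ p := (hρ.contDiffAt).isSymmSndFDerivAt (by simp)
    exact fun u w => this u w
  have hdiff : Differentiable ℝ ρ := hρ.differentiable (by norm_num)
  have hdiff2 : Differentiable ℝ (fderiv ℝ ρ) :=
    (hρ.fderiv_right (m := 1) (by norm_num)).differentiable (by norm_num)
  have hlo := (hdiff2 p).hasFDerivAt.isLittleO
  rw [← hH] at hlo
  have hlo := hlo.bound hη
  obtain ⟨δ, hδ, hball⟩ := Metric.eventually_nhds_iff_ball.mp hlo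
  refine ⟨δ, hδ, fun v hv => ?_⟩
  set φ : E → ℝ := fun v => ρ (p + v) - fderiv ℝ ρ p v - (1 / 2) * H v v with hφ
  have hφd : ∀ v, HasFDerivAt φ (fderiv ℝ ρ (p + v) - fderiv ℝ ρ p - H v) v := by
    intro v
    have h1 : HasFDerivAt (fun v => ρ (p + v)) (fderiv ℝ ρ (p + v)) v := by
      have := (hdiff (p + v)).hasFDerivAt.comp v ((hasFDerivAt_id v).const_add p)
      rwa [ContinuousLinearMap.comp_id] at this
    have h2 : HasFDerivAt (fun v => fderiv ℝ ρ p v) (fderiv ℝ ρ p) v :=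
      (fderiv ℝ ρ p).hasFDerivAt
    have h3 : HasFDerivAt (fun v => H v v) (H v + H.flip v) v := by
      have := (H.hasFDerivAt (x := v)).clm_apply (hasFDerivAt_id v)
      refine this.congr_fderiv ?_
      ext w; simp
    refine ((h1.sub h2).sub (h3.const_mul (1 / 2))).congr_fderiv ?_
    ext w
    simp [hsymm w v]
    ring
  have hb := (convex_closedBall (0 : E) ‖v‖).norm_image_sub_le_of_norm_hasFDerivWithin_le
    (f := φ) (f' := fun v => fderiv ℝ ρ (p + v) - fderiv ℝ ρ p - H v) (C := η * ‖v‖) (x := 0)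
    (y := v) (fun w _ => (hφd w).hasFDerivWithinAt) ?_ (by simp) (by simp)
  · simp only [hφ] at hb
    simp only [add_zero, map_zero, sub_zero, mul_zero] at hb
    rw [Real.norm_eq_abs] at hb
    calc _ = |ρ (p + v) - fderiv ℝ ρ p v - 1 / 2 * H v v - ρ p| := by congr 1; ring
      _ ≤ _ := hb.trans (le_of_eq (by ring))
  · intro w hw
    rw [mem_closedBall_zero_iff] at hw
    have := hball (p + w) (by simpa using hw.trans_lt hv)
    simp only [add_sub_cancel_left] at this
    exact this.trans (by gcongr)

end SecondOrder

section ComplexParts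

variable {E : Type*} [NormedAddCommGroup E] [NormedSpace ℂ E]

theorem smul_re_im (t : ℂ) (x : E) : t • x = (t.re : ℝ) • x + (t.im : ℝ) • (I • x) := by
  conv_lhs => rw [← Complex.re_add_im t]
  rw [add_smul, mul_smul]
  simp only [Complex.coe_smul]

variable [FiniteDimensional ℂ E]

/-- The complex bilinear part of a real symmetric bilinear form. -/
def complexBilinPart (H : E →L[ℝ] E →L[ℝ] ℝ) : E →L[ℂ] E →L[ℂ] ℂ :=
  LinearMap.toContinuousLinearMap
    ((LinearMap.toContinuousLinearMap (𝕜 := ℂ) (E := E) (F' := ℂ)).toLinearMap ∘ₗ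
      (LinearMap.mk₂ ℂ (fun u v : E => (((H u v - H (I • u) (I • v)) / 4 : ℝ) : ℂ)
        - I * (((H (I • u) v + H u (I • v)) / 4 : ℝ) : ℂ))
      (by intro a b c; simp; ring)
      (by
        intro t a b
        rw [smul_re_im t a, smul_add, smul_comm I, smul_comm I, smul_smul I I]
        simp only [map_add, map_smul, _root_.add_apply, _root_.smul_apply,
          I_mul_I, neg_smul, one_smul, map_neg, _root_.neg_apply, smul_neg]
        apply Complex.ext <;> simp <;> ring)
      (by intro a b c; simp; ring)
      (by
        intro t a b
        rw [smul_re_im t b, smul_add, smul_comm I, smul_comm I, smul_smul I I]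
        simp only [map_add, map_smul,
          I_mul_I, neg_smul, one_smul, map_neg, smul_neg]
        apply Complex.ext <;> simp <;> ring)))

theorem complexBilinPart_re (H : E →L[ℝ] E →L[ℝ] ℝ) (v : E) :
    (complexBilinPart H v v).re = (H v v - H (I • v) (I • v)) / 4 := by
  simp [complexBilinPart]

/-- The complex linear functional with prescribed real part. -/
def complexLinPart (D : E →L[ℝ] ℝ) : E →L[ℂ] ℂ :=
  LinearMap.toContinuousLinearMap
    { toFun := fun v => ((D v : ℝ) : ℂ) - I * (D (I • v) : ℝ)
      map_add' := by intro a b; simp; ring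
      map_smul' := by
        intro t a
        rw [smul_re_im t a, smul_add, smul_comm I, smul_comm I, smul_smul I I]
        simp only [map_add, map_smul, I_mul_I, neg_smul, one_smul, map_neg, smul_neg]
        apply Complex.ext <;> simp <;> ring }

theorem complexLinPart_apply (D : E →L[ℝ] ℝ) (v : E) :
    complexLinPart D v = ((D v : ℝ) : ℂ) - I * (D (I • v) : ℝ) := rfl

end ComplexParts

section LocalModel

/-- Local holomorphic model of a domain near a strongly pseudoconvex boundary point. -/
structure LocalModel {n : ℕ} (Ω : Set (En n)) (p : En n) where
  ℓ : En n →L[ℂ] ℂ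
  B : En n →L[ℂ] En n →L[ℂ] ℂ
  v₀ : En n
  c : ℝ
  C : ℝ
  ε : ℝ
  ℓ_v₀ : ℓ v₀ = 1
  c_pos : 0 < c
  C_pos : 0 < C
  ε_pos : 0 < ε
  lower : ∀ v : En n, p + v ∈ closure Ω → ‖v‖ < ε → c * ‖v‖ ^ 2 ≤ (ℓ v + B v v).re
  upper : ∀ v : En n, ‖v‖ < ε → C * ‖v‖ ^ 2 < (ℓ v + B v v).re → p + v ∈ Ω

variable {n : ℕ}

/-- A quadratic form positive on the kernel of a linear form is positive up to the linear form. -/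
theorem exists_quadratic_lower {E : Type*} [NormedAddCommGroup E] [NormedSpace ℝ E] [ProperSpace E]
    {G : Type*} [NormedAddCommGroup G] [NormedSpace ℝ G]
    {L : E → ℝ} {ℓ : E →L[ℝ] G} (hL : Continuous L) (hhom : ∀ (t : ℝ) v, L (t • v) = t ^ 2 * L v)
    (hpos : ∀ v, v ≠ 0 → ℓ v = 0 → 0 < L v) :
    ∃ c > 0, ∃ C > 0, ∀ v, c * ‖v‖ ^ 2 - C * ‖ℓ v‖ ^ 2 ≤ L v := by
  by_contra hcon
  push Not at hcon
  have h1 : ∀ k : ℕ, ∃ v ∈ sphere (0 : E) 1,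
      L v < 1 / ((k : ℝ) + 1) - ((k : ℝ) + 1) * ‖ℓ v‖ ^ 2 := by
    intro k
    obtain ⟨v, hv⟩ := hcon (1 / ((k : ℝ) + 1)) (by positivity) ((k : ℝ) + 1) (by positivity)
    have hv0 : v ≠ 0 := by
      rintro rfl
      have := hhom 0 0
      simp at this
      simp [this] at hv
    have hvn : 0 < ‖v‖ := norm_pos_iff.mpr hv0
    refine ⟨‖v‖⁻¹ • v, by simp [norm_smul, hvn.ne'], ?_⟩
    rw [hhom, map_smul, norm_smul, norm_inv, norm_norm]
    have : ‖v‖⁻¹ ^ 2 * L v < ‖v‖⁻¹ ^ 2 * (1 / ((k : ℝ) + 1) * ‖v‖ ^ 2 -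
        ((k : ℝ) + 1) * ‖ℓ v‖ ^ 2) := by gcongr
    refine this.trans_eq ?_
    field_simp
  choose v hv hlt using h1
  obtain ⟨w, hw, φ, hφ, hlim⟩ := (isCompact_sphere (0 : E) 1).tendsto_subseq hv
  have hw0 : w ≠ 0 := by rintro rfl; simp at hw
  have hk : Tendsto (fun j => 1 / ((φ j : ℝ) + 1)) atTop (𝓝 0) :=
    tendsto_one_div_add_atTop_nhds_zero_nat.comp hφ.tendsto_atTop
  have hLlim : Tendsto (fun j => L (v (φ j))) atTop (𝓝 (L w)) := (hL.tendsto w).comp hlim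
  have hLle : L w ≤ 0 := by
    refine le_of_tendsto_of_tendsto hLlim hk (Eventually.of_forall fun j => ?_)
    have := hlt (φ j)
    have h2 : 0 ≤ ((φ j : ℝ) + 1) * ‖ℓ (v (φ j))‖ ^ 2 := by positivity
    linarith
  have hℓ : ℓ w = 0 := by
    have h3 : Tendsto (fun j => ‖ℓ (v (φ j))‖ ^ 2) atTop (𝓝 (‖ℓ w‖ ^ 2)) :=
      (((ℓ.continuous.tendsto w).comp hlim).norm).pow 2
    have h4 : Tendsto (fun j => 1 / ((φ j : ℝ) + 1) * (1 / ((φ j : ℝ) + 1) - L (v (φ j)))) atTop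
        (𝓝 (0 * (0 - L w))) := hk.mul (hk.sub hLlim)
    have h5 := le_of_tendsto_of_tendsto h3 h4 (Eventually.of_forall fun j => by
      have h6 := hlt (φ j)
      have : ‖ℓ (v (φ j))‖ ^ 2 * ((φ j : ℝ) + 1) ≤ 1 / ((φ j : ℝ) + 1) - L (v (φ j)) := by linarith
      beta_reduce
      rw [one_div, ← div_eq_inv_mul, le_div_iff₀ (by positivity)]
      simpa using this)
    rw [zero_mul] at h5
    have : ‖ℓ w‖ = 0 := by
      have := le_antisymm h5 (by positivity)
      exact pow_eq_zero_iff (two_ne_zero) |>.mp this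
    exact norm_eq_zero.mp this
  linarith [hpos w hw0 hℓ]

theorem leviForm_eq (ρ : En n → ℝ) (q ξ : En n) :
    LeviForm ρ q ξ = (1 / 4) * (fderiv ℝ (fderiv ℝ ρ) q ξ ξ +
      fderiv ℝ (fderiv ℝ ρ) q (I • ξ) (I • ξ)) := by
  simp [LeviForm, iteratedFDeriv_two_apply]

set_option maxHeartbeats 1000000 in
theorem exists_localModel {Ω : Set (En n)} {ρ : En n → ℝ} (hρ : IsPcxCinfBoundary Ω ρ)
    {p : En n} (hp : p ∈ frontier Ω) (hspc : StronglyPcxAt ρ p) : Nonempty (LocalModel Ω p) := by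
  obtain ⟨⟨hsm, hΩ, hfr, hreg⟩, -⟩ := hρ
  have hρ2 : ContDiff ℝ 2 ρ := mod_cast contDiff_infty.mp hsm 2
  have hρp : ρ p = 0 := by rw [hfr] at hp; exact hp
  have hcl : ∀ z ∈ closure Ω, ρ z ≤ 0 := by
    intro z hz
    refine closure_minimal ?_ (isClosed_le hρ2.continuous continuous_const) hz
    intro w hw
    rw [hΩ] at hw
    exact (show ρ w < 0 from hw).le
  set D := fderiv ℝ ρ p with hD
  set H := fderiv ℝ (fderiv ℝ ρ) p with hH
  set ℓ : En n →L[ℂ] ℂ := -complexLinPart D with hℓ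
  have hℓre : ∀ v, (ℓ v).re = -D v := by
    intro v; simp [hℓ, complexLinPart_apply]
  have hℓim : ∀ v, (ℓ v).im = D (I • v) := by
    intro v; simp [hℓ, complexLinPart_apply]
  set L : En n → ℝ := fun v => (1 / 4) * (H v v + H (I • v) (I • v)) with hLdef
  obtain ⟨c₁, hc₁, K, hK, hlow⟩ := exists_quadratic_lower (L := L)
    (ℓ := ℓ.restrictScalars ℝ) (by fun_prop) (by
      intro t v
      simp only [hLdef]
      rw [smul_comm I t v]
      simp only [map_smul, _root_.smul_apply, smul_eq_mul]
      ring) (by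
      intro v hv hv0
      have hv0 : ℓ v = 0 := hv0
      have := hspc v hv ⟨by
        have := hℓre v; rw [hv0] at this; simp at this; linarith, by
        have := hℓim v; rw [hv0] at this; simp at this; linarith⟩
      rwa [leviForm_eq] at this)
  simp only [ContinuousLinearMap.coe_restrictScalars'] at hlow
  set B : En n →L[ℂ] En n →L[ℂ] ℂ :=
    -complexBilinPart H - (K : ℂ) • ((ContinuousLinearMap.mul ℂ ℂ).bilinearComp ℓ ℓ) with hB
  have hBre : ∀ v, (B v v).re =
      -((H v v - H (I • v) (I • v)) / 4) - K * ((ℓ v).re ^ 2 - (ℓ v).im ^ 2) := by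
    intro v
    rw [← complexBilinPart_re]
    simp [hB, sq]
  have hDH : ∀ v, (ℓ v + B v v).re = -(D v + 1 / 2 * H v v) + L v
      - K * ((ℓ v).re ^ 2 - (ℓ v).im ^ 2) := by
    intro v
    rw [add_re, hBre, hℓre]
    simp only [hLdef]; ring
  -- constants
  set d := ‖D‖ with hd
  have hd0 : 0 ≤ d := norm_nonneg _
  set h := ‖H‖ with hh
  have hh0 : 0 ≤ h := norm_nonneg H
  have hDle : ∀ v, |D v| ≤ d * ‖v‖ := fun v => by
    have := D.le_opNorm v; rwa [Real.norm_eq_abs] at this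
  have hHle : ∀ v, |H v v| ≤ h * ‖v‖ ^ 2 := fun v => by
    have := H.le_opNorm₂ v v
    rw [Real.norm_eq_abs] at this
    linarith [sq ‖v‖, mul_assoc h ‖v‖ ‖v‖]
  obtain ⟨δ, hδ, htay⟩ := taylor_two_le hρ2 p (η := c₁ / 4) (by positivity)
  rw [← hD, ← hH] at htay
  simp only [hρp, sub_zero] at htay
  obtain ⟨v₁, hv₁⟩ : ∃ v, ℓ v ≠ 0 := by
    by_contra hcon
    push Not at hcon
    apply hreg p hp
    ext v
    have := hℓre v
    rw [hcon v] at this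
    simp at this
    simpa using this
  set M := h + c₁ with hM
  have hM0 : 0 < M := by positivity
  set ε := min δ (min 1 (min (1 / (2 * K * d + 1)) (c₁ / (4 * (2 * K * d * M + 1))))) with hε
  have hε0 : 0 < ε := by
    simp only [hε, lt_min_iff]
    refine ⟨hδ, one_pos, by positivity, by positivity⟩
  set CB := ‖B‖ with hCB
  refine ⟨⟨ℓ, B, (ℓ v₁)⁻¹ • v₁, c₁ / 4, M + CB, ε, by simp [hv₁], by positivity, by positivity,
    hε0, ?_, ?_⟩⟩
  · intro v hv hvε
    have hvδ : ‖v‖ < δ := hvε.trans_le (min_le_left _ _)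
    have hv2 : ‖v‖ < 1 / (2 * K * d + 1) :=
      hvε.trans_le ((min_le_right _ _).trans ((min_le_right _ _).trans (min_le_left _ _)))
    have hv3 : ‖v‖ < c₁ / (4 * (2 * K * d * M + 1)) :=
      hvε.trans_le ((min_le_right _ _).trans ((min_le_right _ _).trans (min_le_right _ _)))
    rw [lt_div_iff₀ (by positivity)] at hv2 hv3
    have hr := hcl _ hv
    have ht := abs_le.mp (htay v hvδ)
    have hl := hlow v
    have hℓn : ‖ℓ v‖ ^ 2 = (ℓ v).re ^ 2 + (ℓ v).im ^ 2 := by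
      rw [Complex.sq_norm, Complex.normSq_apply]; ring
    rw [hℓn] at hl
    rw [hDH]
    have hHv := abs_le.mp (hHle v)
    have hDv := hDle v
    have hDabs : |D v| ≤ -ρ (p + v) + M * ‖v‖ ^ 2 := by
      have hMv : M * ‖v‖ ^ 2 = h * ‖v‖ ^ 2 + c₁ * ‖v‖ ^ 2 := by rw [hM]; ring
      have e1 : 0 ≤ h * ‖v‖ ^ 2 := by positivity
      have e2 : 0 ≤ c₁ * ‖v‖ ^ 2 := by positivity
      rw [abs_le]
      constructor <;> linarith
    have hre2 : (ℓ v).re ^ 2 ≤ d * ‖v‖ * (-ρ (p + v) + M * ‖v‖ ^ 2) := by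
      rw [hℓre, neg_sq, ← sq_abs, sq]
      exact mul_le_mul hDv hDabs (abs_nonneg _) (by positivity)
    have hfin : 2 * K * (ℓ v).re ^ 2 ≤ -ρ (p + v) + c₁ / 4 * ‖v‖ ^ 2 := by
      have hn := norm_nonneg v
      have e1 : 2 * K * (ℓ v).re ^ 2 ≤ 2 * K * (d * ‖v‖ * (-ρ (p + v) + M * ‖v‖ ^ 2)) := by gcongr
      have e2 : (2 * K * d * ‖v‖) * (-ρ (p + v)) ≤ 1 * (-ρ (p + v)) :=
        mul_le_mul_of_nonneg_right (by linarith) (by linarith)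
      have e3 : (2 * K * d * M * ‖v‖) * ‖v‖ ^ 2 ≤ c₁ / 4 * ‖v‖ ^ 2 :=
        mul_le_mul_of_nonneg_right (by linarith) (by positivity)
      linarith
    linarith [ht.1, ht.2]
  · intro v hvε hv
    have hvδ : ‖v‖ < δ := hvε.trans_le (min_le_left _ _)
    have ht := abs_le.mp (htay v hvδ)
    have hHv := abs_le.mp (hHle v)
    have hBv : (B v v).re ≤ CB * ‖v‖ ^ 2 := by
      have := (Complex.re_le_norm _).trans (B.le_opNorm₂ v v)
      linarith [sq ‖v‖, mul_assoc CB ‖v‖ ‖v‖]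
    rw [add_re, hℓre] at hv
    have : ρ (p + v) < 0 := by linarith [ht.1, ht.2, sq_nonneg ‖v‖]
    rw [hΩ]
    exact this

end LocalModel

section LeviEstimate

variable {n : ℕ}

theorem mem_frontier_iff_of_defining {Ω : Set (En n)} {ρ : En n → ℝ}
    (hρ : IsPcxCinfBoundary Ω ρ) {z : En n} : z ∈ frontier Ω ↔ ρ z = 0 := by
  rw [hρ.1.2.2.1]; rfl

theorem mem_iff_of_defining {Ω : Set (En n)} {ρ : En n → ℝ}
    (hρ : IsPcxCinfBoundary Ω ρ) {z : En n} : z ∈ Ω ↔ ρ z < 0 := by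
  conv_lhs => rw [hρ.1.2.1]
  rfl

theorem contDiff_of_defining {Ω : Set (En n)} {ρ : En n → ℝ}
    (hρ : IsPcxCinfBoundary Ω ρ) (k : ℕ) : ContDiff ℝ k ρ := contDiff_infty.mp hρ.1.1 k

theorem nonpos_of_mem_closure {Ω : Set (En n)} {ρ : En n → ℝ}
    (hρ : IsPcxCinfBoundary Ω ρ) {z : En n} (hz : z ∈ closure Ω) : ρ z ≤ 0 := by
  refine closure_minimal ?_
    (isClosed_le (contDiff_of_defining hρ 0).continuous continuous_const) hz
  exact fun w hw => ((mem_iff_of_defining hρ).mp hw).le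

/-- A locally Lipschitz and bounded packaging of a `C^1` map. -/
theorem exists_local_lipschitz_bound {E G : Type*} [NormedAddCommGroup E] [NormedSpace ℝ E]
    [NormedAddCommGroup G] [NormedSpace ℝ G] {f : E → G} (hf : ContDiff ℝ 1 f) (q : E) :
    ∃ Λ > 0, ∃ r > 0, ∀ z ∈ ball q r, ‖f z‖ ≤ Λ ∧ ∀ w ∈ ball q r, ‖f z - f w‖ ≤ Λ * ‖z - w‖ := by
  obtain ⟨K, t, ht, hK⟩ := (hf.contDiffAt (x := q)).exists_lipschitzOnWith
  obtain ⟨r₁, hr₁, hb₁⟩ := Metric.mem_nhds_iff.mp ht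
  have hc : ∀ᶠ z in 𝓝 q, ‖f z‖ < ‖f q‖ + 1 :=
    (hf.continuous.tendsto q).norm.eventually_lt_const (by linarith)
  obtain ⟨r₂, hr₂, hb₂⟩ := Metric.eventually_nhds_iff_ball.mp hc
  have hΛ1 : ‖f q‖ + 1 ≤ ‖f q‖ + 1 + K := by linarith [K.2]
  refine ⟨‖f q‖ + 1 + K, by positivity, min r₁ r₂, lt_min hr₁ hr₂, fun z hz => ⟨?_, fun w hw => ?_⟩⟩
  · exact (hb₂ z (ball_subset_ball (min_le_right _ _) hz)).le.trans hΛ1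
  · have := hK.norm_sub_le (hb₁ (ball_subset_ball (min_le_left _ _) hz))
      (hb₁ (ball_subset_ball (min_le_left _ _) hw))
    refine this.trans ?_
    gcongr
    linarith [norm_nonneg (f q)]

/-- Near a boundary point every point of the closure is close to the boundary, at a distance
controlled by the defining function. -/
theorem exists_boundary_near {Ω : Set (En n)} {ρ : En n → ℝ} (hρ : IsPcxCinfBoundary Ω ρ)
    {q₀ ν : En n} {r Λ : ℝ} (hΛ : 0 < Λ)
    (hν : ∀ z ∈ ball q₀ r, 1 / 2 ≤ fderiv ℝ ρ z ν)
    (hL : ∀ z ∈ ball q₀ r, |ρ z| ≤ Λ * ‖z - q₀‖) {z : En n} (hz : z ∈ closure Ω)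
    (hzr : ‖z - q₀‖ * (1 + 2 * Λ * ‖ν‖) < r) :
    ∃ q ∈ frontier Ω, q ∈ ball q₀ r ∧ ‖q - z‖ ≤ 2 * ‖ν‖ * |ρ z| := by
  have hz0 := nonpos_of_mem_closure hρ hz
  have hn := norm_nonneg (z - q₀)
  have hnν := norm_nonneg ν
  have hzb : z ∈ ball q₀ r := by
    rw [mem_ball, dist_eq_norm]
    have : 0 ≤ ‖z - q₀‖ * (2 * Λ * ‖ν‖) := by positivity
    linarith
  have hρz := hL z hzb
  set T := 2 * |ρ z| with hT
  have hT0 : 0 ≤ T := by positivity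
  have hin : ∀ t ∈ Icc (0 : ℝ) T, z + t • ν ∈ ball q₀ r := by
    intro t ht
    rw [mem_ball, dist_eq_norm]
    have e : z + t • ν - q₀ = (z - q₀) + t • ν := by abel
    rw [e]
    refine (norm_add_le _ _).trans_lt ?_
    rw [norm_smul, Real.norm_of_nonneg ht.1]
    have h1 : t * ‖ν‖ ≤ T * ‖ν‖ := by gcongr; exact ht.2
    have h2 : T * ‖ν‖ ≤ 2 * (Λ * ‖z - q₀‖) * ‖ν‖ := by rw [hT]; gcongr
    nlinarith
  have hdiff : Differentiable ℝ ρ := (contDiff_of_defining hρ 1).differentiable (by norm_num)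
  have hder : ∀ t : ℝ, HasDerivAt (fun t : ℝ => ρ (z + t • ν)) (fderiv ℝ ρ (z + t • ν) ν) t := by
    intro t
    have h1 : HasDerivAt (fun t : ℝ => z + t • ν) ν t := by
      simpa using ((hasDerivAt_id t).smul_const ν).const_add z
    exact (hdiff _).hasFDerivAt.comp_hasDerivAt t h1
  have hcont : Continuous (fun t : ℝ => ρ (z + t • ν)) :=
    continuous_iff_continuousAt.mpr fun t => (hder t).continuousAt
  have hmono := (convex_Icc (0 : ℝ) T).mul_sub_le_image_sub_of_le_deriv hcont.continuousOn
    (fun t _ => (hder t).differentiableAt.differentiableWithinAt) (C := 1 / 2)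
    (fun t ht => by rw [(hder t).deriv]; exact hν _ (hin t (interior_subset ht)))
    0 ⟨le_rfl, hT0⟩ T ⟨hT0, le_rfl⟩ hT0
  have hend : 0 ≤ ρ (z + T • ν) := by
    simp only [zero_smul, add_zero, sub_zero] at hmono
    have : T = -2 * ρ z := by rw [hT, abs_of_nonpos hz0]; ring
    linarith
  obtain ⟨t, ht, ht0⟩ := intermediate_value_Icc hT0 hcont.continuousOn
    (show (0 : ℝ) ∈ Icc (ρ (z + (0 : ℝ) • ν)) (ρ (z + T • ν)) from ⟨by simpa using hz0, hend⟩)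
  refine ⟨z + t • ν, (mem_frontier_iff_of_defining hρ).mpr ht0, hin t ht, ?_⟩
  rw [add_sub_cancel_left, norm_smul, Real.norm_of_nonneg ht.1]
  have h1 : t * ‖ν‖ ≤ T * ‖ν‖ := by gcongr; exact ht.2
  linarith

/-- Lower bound for the Levi form at a boundary point in an arbitrary direction. -/
theorem levi_lower_boundary {Ω : Set (En n)} {ρ : En n → ℝ} (hρ : IsPcxCinfBoundary Ω ρ)
    {q ν : En n} {Λ : ℝ} (hq : q ∈ frontier Ω) (hν : 1 / 2 ≤ fderiv ℝ ρ q ν)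
    (hD : ‖fderiv ℝ ρ q‖ ≤ Λ) (hH : ‖fderiv ℝ (fderiv ℝ ρ) q‖ ≤ Λ) (ξ : En n) :
    -(4 * Λ * ‖ν‖ * (1 + 6 * Λ * ‖ν‖) * ‖ξ‖ * (2 * (|fderiv ℝ ρ q ξ| + |fderiv ℝ ρ q (I • ξ)|))) ≤
      fderiv ℝ (fderiv ℝ ρ) q ξ ξ + fderiv ℝ (fderiv ℝ ρ) q (I • ξ) (I • ξ) := by
  set D := fderiv ℝ ρ q
  set H := fderiv ℝ (fderiv ℝ ρ) q with hHdef
  set d := |D ξ| + |D (I • ξ)| with hd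
  have hΛ0 : 0 ≤ Λ := (norm_nonneg _).trans hD
  have hsymm : ∀ u w, H u w = H w u := by
    have : IsSymmSndFDerivAt ℝ ρ q :=
      ((contDiff_of_defining hρ 2).contDiffAt).isSymmSndFDerivAt (by simp)
    exact fun u w => this u w
  set e := complexLinPart D with he
  have hre : ∀ v, (e v).re = D v := fun v => by simp [he, complexLinPart_apply]
  have him : ∀ v, (e v).im = -D (I • v) := fun v => by simp [he, complexLinPart_apply]
  have heν : 1 / 2 ≤ ‖e ν‖ := hν.trans ((hre ν).symm.le.trans (Complex.re_le_norm _))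
  have heν0 : e ν ≠ 0 := by intro h; rw [h] at heν; norm_num at heν
  set β := e ξ / e ν with hβ
  set τ := ξ - β • ν with hτ
  have heτ : e τ = 0 := by
    rw [hτ, map_sub, map_smul, smul_eq_mul, hβ, div_mul_cancel₀ _ heν0, sub_self]
  have htan : InCplxTangent ρ q τ := by
    refine ⟨?_, ?_⟩
    · have := hre τ; rw [heτ] at this; simpa using this.symm
    · have := him τ; rw [heτ] at this; simpa using this
  have hlev := hρ.2 q hq τ htan
  rw [leviForm_eq, ← hHdef] at hlev
  have heξ : ‖e ξ‖ ≤ d := by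
    refine (Complex.norm_le_abs_re_add_abs_im _).trans ?_
    rw [hre, him, abs_neg]
  have hβd : ‖β‖ ≤ 2 * d := by
    rw [hβ, norm_div, div_le_iff₀ (by linarith)]
    nlinarith [norm_nonneg (e ξ)]
  have hd0 : 0 ≤ d := by positivity
  have hdξ : d ≤ 2 * Λ * ‖ξ‖ := by
    have h1 := D.le_opNorm ξ
    have h2 := D.le_opNorm (I • ξ)
    rw [norm_smul, Complex.norm_I, one_mul] at h2
    rw [Real.norm_eq_abs] at h1 h2
    have : ‖D‖ * ‖ξ‖ ≤ Λ * ‖ξ‖ := by gcongr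
    linarith
  have hdec : ξ = τ + β • ν := by rw [hτ]; abel
  have hbil : ∀ u w : En n, |H u w| ≤ Λ * ‖u‖ * ‖w‖ := by
    intro u w
    have := H.le_opNorm₂ u w
    rw [Real.norm_eq_abs] at this
    exact this.trans (by gcongr)
  have hquad : ∀ a b : En n, H a a - Λ * (2 * ‖a‖ + ‖b‖) * ‖b‖ ≤ H (a + b) (a + b) := by
    intro a b
    have e1 : H (a + b) (a + b) = H a a + 2 * H a b + H b b := by
      simp only [map_add, _root_.add_apply, hsymm b a]; ring
    rw [e1]
    have := (abs_le.mp (hbil a b)).1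
    have := (abs_le.mp (hbil b b)).1
    nlinarith
  have hτn : ‖τ‖ ≤ ‖ξ‖ + ‖β‖ * ‖ν‖ := by
    rw [hτ, ← norm_smul]; exact norm_sub_le _ _
  have hβξ : ‖β‖ ≤ 4 * Λ * ‖ξ‖ := by linarith
  have hq1 := hquad τ (β • ν)
  have hq2 := hquad (I • τ) (I • (β • ν))
  rw [← smul_add, ← hdec] at hq2
  rw [← hdec] at hq1
  simp only [norm_smul, Complex.norm_I, one_mul] at hq1 hq2
  have hb : Λ * (2 * ‖τ‖ + ‖β‖ * ‖ν‖) * (‖β‖ * ‖ν‖) ≤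
      2 * Λ * ‖ν‖ * (1 + 6 * Λ * ‖ν‖) * ‖ξ‖ * (2 * d) := by
    have e1 : 2 * ‖τ‖ + ‖β‖ * ‖ν‖ ≤ 2 * ((1 + 6 * Λ * ‖ν‖) * ‖ξ‖) := by
      have : ‖β‖ * ‖ν‖ ≤ 4 * Λ * ‖ξ‖ * ‖ν‖ := by gcongr
      nlinarith
    calc Λ * (2 * ‖τ‖ + ‖β‖ * ‖ν‖) * (‖β‖ * ‖ν‖)
        ≤ Λ * (2 * ((1 + 6 * Λ * ‖ν‖) * ‖ξ‖)) * (2 * d * ‖ν‖) := by gcongr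
      _ = _ := by ring
  linarith

/-- Lower bound for the Levi form near a boundary point. -/
theorem levi_lower {Ω : Set (En n)} {ρ : En n → ℝ} (hρ : IsPcxCinfBoundary Ω ρ)
    {q₀ : En n} (hq₀ : q₀ ∈ frontier Ω) :
    ∃ C > 0, ∃ r > 0, ∀ z ∈ closure Ω, z ∈ ball q₀ r → ∀ ξ : En n,
      -(C * (|ρ z| * ‖ξ‖ ^ 2 + ‖ξ‖ * (|fderiv ℝ ρ z ξ| + |fderiv ℝ ρ z (I • ξ)|))) ≤
      fderiv ℝ (fderiv ℝ ρ) z ξ ξ + fderiv ℝ (fderiv ℝ ρ) z (I • ξ) (I • ξ) := by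
  have h3 : ContDiff ℝ 3 ρ := contDiff_of_defining hρ 3
  have h2 : ContDiff ℝ 2 (fderiv ℝ ρ) := h3.fderiv_right (by norm_num)
  have h1 : ContDiff ℝ 1 (fderiv ℝ (fderiv ℝ ρ)) := h2.fderiv_right (by norm_num)
  obtain ⟨Λ₁, hΛ₁, r₁, hr₁, hb₁⟩ := exists_local_lipschitz_bound h1 q₀
  obtain ⟨Λ₂, hΛ₂, r₂, hr₂, hb₂⟩ := exists_local_lipschitz_bound (h2.of_le (by norm_num)) q₀
  obtain ⟨Λ₃, hΛ₃, r₃, hr₃, hb₃⟩ := exists_local_lipschitz_bound (h3.of_le (by norm_num)) q₀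
  have hρq : ρ q₀ = 0 := (mem_frontier_iff_of_defining hρ).mp hq₀
  obtain ⟨ν₁, hν₁⟩ : ∃ v, fderiv ℝ ρ q₀ v ≠ 0 := by
    by_contra hcon
    push Not at hcon
    exact hρ.1.2.2.2 q₀ hq₀ (by ext v; simpa using hcon v)
  set ν := (fderiv ℝ ρ q₀ ν₁)⁻¹ • ν₁ with hν
  have hνq : fderiv ℝ ρ q₀ ν = 1 := by rw [hν, map_smul, smul_eq_mul, inv_mul_cancel₀ hν₁]
  have hνc : ∀ᶠ z in 𝓝 q₀, 1 / 2 < fderiv ℝ ρ z ν := by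
    have : Continuous fun z => fderiv ℝ ρ z ν := h2.continuous.clm_apply continuous_const
    refine (this.tendsto q₀).eventually_const_lt ?_
    rw [hνq]; norm_num
  obtain ⟨r₄, hr₄, hb₄⟩ := Metric.eventually_nhds_iff_ball.mp hνc
  set r := min (min r₁ r₂) (min r₃ r₄) with hr
  have hr0 : 0 < r := by simp only [hr, lt_min_iff]; exact ⟨⟨hr₁, hr₂⟩, hr₃, hr₄⟩
  have s₁ : ball q₀ r ⊆ ball q₀ r₁ := ball_subset_ball ((min_le_left _ _).trans (min_le_left _ _))
  have s₂ : ball q₀ r ⊆ ball q₀ r₂ := ball_subset_ball ((min_le_left _ _).trans (min_le_right _ _))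
  have s₃ : ball q₀ r ⊆ ball q₀ r₃ := ball_subset_ball ((min_le_right _ _).trans (min_le_left _ _))
  have s₄ : ball q₀ r ⊆ ball q₀ r₄ := ball_subset_ball ((min_le_right _ _).trans (min_le_right _ _))
  set Λ := max Λ₁ Λ₂ with hΛ
  have hΛ0 : 0 < Λ := lt_max_of_lt_left hΛ₁
  set K := 4 * Λ * ‖ν‖ * (1 + 6 * Λ * ‖ν‖) * 2 with hK
  have hK0 : 0 ≤ K := by positivity
  set P := 2 * ‖ν‖ with hP
  have hP0 : 0 ≤ P := by positivity
  refine ⟨K + K * (2 * Λ * P) + 2 * Λ * P + 1, by positivity, r / (1 + 2 * Λ₃ * ‖ν‖),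
    by positivity, ?_⟩
  intro z hz hzr ξ
  rw [mem_ball, dist_eq_norm, lt_div_iff₀ (by positivity)] at hzr
  obtain ⟨q, hq, hqr, hqz⟩ := exists_boundary_near hρ hΛ₃
    (fun z hz => (hb₄ z (s₄ hz)).le)
    (fun z hz => by
      have := (hb₃ z (s₃ hz)).2 q₀ (mem_ball_self hr₃)
      rwa [hρq, sub_zero] at this) hz hzr
  have hzb : z ∈ ball q₀ r := by
    rw [mem_ball, dist_eq_norm]
    have : 0 ≤ ‖z - q₀‖ * (2 * Λ₃ * ‖ν‖) := by positivity
    linarith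
  have hlow := levi_lower_boundary (Λ := Λ) hρ hq (hb₄ q (s₄ hqr)).le
    ((hb₂ q (s₂ hqr)).1.trans (le_max_right _ _)) ((hb₁ q (s₁ hqr)).1.trans (le_max_left _ _)) ξ
  have hqz' : ‖q - z‖ ≤ P * |ρ z| := hqz
  have hHd : ‖fderiv ℝ (fderiv ℝ ρ) q - fderiv ℝ (fderiv ℝ ρ) z‖ ≤ Λ * (P * |ρ z|) :=
    ((hb₁ q (s₁ hqr)).2 z (s₁ hzb)).trans (by gcongr; exact le_max_left _ _)
  have hDd : ‖fderiv ℝ ρ q - fderiv ℝ ρ z‖ ≤ Λ * (P * |ρ z|) :=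
    ((hb₂ q (s₂ hqr)).2 z (s₂ hzb)).trans (by gcongr; exact le_max_right _ _)
  have hHc : ∀ v : En n, ‖v‖ = ‖ξ‖ → fderiv ℝ (fderiv ℝ ρ) q v v - Λ * (P * |ρ z|) * ‖ξ‖ ^ 2 ≤
      fderiv ℝ (fderiv ℝ ρ) z v v := by
    intro v hv
    have h5 := (fderiv ℝ (fderiv ℝ ρ) q - fderiv ℝ (fderiv ℝ ρ) z).le_opNorm₂ v v
    rw [Real.norm_eq_abs, hv] at h5
    have h6 := (abs_le.mp h5).2
    simp only [_root_.sub_apply] at h6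
    have h7 : ‖fderiv ℝ (fderiv ℝ ρ) q - fderiv ℝ (fderiv ℝ ρ) z‖ * ‖ξ‖ * ‖ξ‖ ≤
        Λ * (P * |ρ z|) * ‖ξ‖ * ‖ξ‖ := by gcongr
    linarith [sq ‖ξ‖, mul_assoc (Λ * (P * |ρ z|)) ‖ξ‖ ‖ξ‖]
  have hDc : ∀ v : En n, ‖v‖ = ‖ξ‖ → |fderiv ℝ ρ q v| ≤ |fderiv ℝ ρ z v| + Λ * (P * |ρ z|) * ‖ξ‖ := by
    intro v hv
    have h5 := (fderiv ℝ ρ q - fderiv ℝ ρ z).le_opNorm v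
    rw [Real.norm_eq_abs, hv] at h5
    simp only [_root_.sub_apply] at h5
    have h6 := abs_sub_abs_le_abs_sub (fderiv ℝ ρ q v) (fderiv ℝ ρ z v)
    have h7 : ‖fderiv ℝ ρ q - fderiv ℝ ρ z‖ * ‖ξ‖ ≤ Λ * (P * |ρ z|) * ‖ξ‖ := by gcongr
    linarith
  have hIξ : ‖I • ξ‖ = ‖ξ‖ := by rw [norm_smul, Complex.norm_I, one_mul]
  have a1 := hHc ξ rfl
  have a2 := hHc (I • ξ) hIξ
  have a3 := hDc ξ rfl
  have a4 := hDc (I • ξ) hIξ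
  have hξ := norm_nonneg ξ
  have a5 : K * ‖ξ‖ * (|fderiv ℝ ρ q ξ| + |fderiv ℝ ρ q (I • ξ)|) ≤ K * ‖ξ‖ *
      ((|fderiv ℝ ρ z ξ| + Λ * (P * |ρ z|) * ‖ξ‖) +
        (|fderiv ℝ ρ z (I • ξ)| + Λ * (P * |ρ z|) * ‖ξ‖)) := by gcongr
  set X := |fderiv ℝ ρ z ξ| + |fderiv ℝ ρ z (I • ξ)| with hX
  have hX0 : 0 ≤ X := by positivity
  have a6 : 0 ≤ |ρ z| * ‖ξ‖ ^ 2 * (K + 1) := by positivity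
  have a7 : 0 ≤ ‖ξ‖ * X * (K * (2 * Λ * P) + 2 * Λ * P + 1) := by positivity
  rw [hK] at a5 a6 a7 ⊢
  linarith
end LeviEstimate

/-- The second derivative is nonnegative at a local minimum. -/
theorem second_deriv_nonneg_of_isLocalMin {f f' : ℝ → ℝ} {f'' x : ℝ}
    (h : ∀ᶠ t in 𝓝 x, HasDerivAt f (f' t) t) (h2 : HasDerivAt f' f'' x) (hmin : IsLocalMin f x) :
    0 ≤ f'' := by
  by_contra hneg
  push Not at hneg
  have hd : deriv f =ᶠ[𝓝 x] f' := h.mono fun t ht => ht.deriv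
  have hdd : deriv (deriv f) x = f'' := by rw [hd.deriv_eq, h2.deriv]
  have h0 : deriv f x = 0 := hmin.deriv_eq_zero
  have hmax : IsLocalMax f x :=
    isLocalMax_of_deriv_deriv_neg (by rw [hdd]; exact hneg) h0 h.self_of_nhds.continuousAt
  have hconst : f =ᶠ[𝓝 x] fun _ => f x := by
    filter_upwards [hmin, hmax] with t h1 h2 using le_antisymm h2 h1
  have : deriv (deriv f) x = 0 := by
    rw [hconst.deriv.deriv_eq]; simp
  linarith

theorem hasDerivAt_gaussian_line (α : ℝ) (X e : ℂ) (t : ℝ) (he : normSq e = 1) :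
    HasDerivAt (fun t : ℝ => Real.exp (-α * normSq (X + t * e)))
      (Real.exp (-α * normSq (X + t * e)) * (-α * (2 * (X.re * e.re + X.im * e.im) + 2 * t))) t := by
  have h1 : ∀ t : ℝ, normSq (X + t * e) = normSq X + 2 * (X.re * e.re + X.im * e.im) * t + t ^ 2 := by
    intro t
    have : normSq e = e.re * e.re + e.im * e.im := normSq_apply e
    simp only [normSq_apply, add_re, add_im, mul_re, mul_im, ofReal_re, ofReal_im] at *
    linear_combination t ^ 2 * he
  have h2 : HasDerivAt (fun t : ℝ => -α * normSq (X + t * e))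
      (-α * (2 * (X.re * e.re + X.im * e.im) + 2 * t)) t := by
    simp only [h1]
    have := (((hasDerivAt_id t).const_mul (2 * (X.re * e.re + X.im * e.im))).const_add
      (normSq X)).add (hasDerivAt_pow 2 t)
    have := this.const_mul (-α)
    exact this.congr_deriv (by simp)
  exact h2.exp

theorem hasDerivAt_gaussian_line_two (α : ℝ) (X e : ℂ) (he : normSq e = 1) :
    HasDerivAt (fun t : ℝ => Real.exp (-α * normSq (X + t * e)) *
        (-α * (2 * (X.re * e.re + X.im * e.im) + 2 * t)))
      (Real.exp (-α * normSq X) *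
        (4 * α ^ 2 * (X.re * e.re + X.im * e.im) ^ 2 - 2 * α)) 0 := by
  have h1 := hasDerivAt_gaussian_line α X e 0 he
  have h2 : HasDerivAt (fun t : ℝ => -α * (2 * (X.re * e.re + X.im * e.im) + 2 * t)) (-α * (2 * 1)) 0 :=
    (((hasDerivAt_id (0 : ℝ)).const_mul 2).const_add _).const_mul (-α)
  exact (h1.mul h2).congr_deriv (by simp; ring)

set_option maxHeartbeats 1000000 in
/-- Hopf's boundary lemma in the plane for `Δu ≤ C (u + |∇u|)`: a nonnegative function cannot
have a critical zero on the boundary of a disc on which it is positive. -/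
theorem hopf_plane {u D₁ D₂ L₁ L₂ : ℂ → ℝ} {x₁ y : ℂ} {R C : ℝ} (hR : 0 < R) (hC : 0 ≤ C)
    (hD₁ : ∀ x ∈ ball x₁ R, HasDerivAt (fun t : ℝ => u (x + t * 1)) (D₁ x) 0)
    (hD₂ : ∀ x ∈ ball x₁ R, HasDerivAt (fun t : ℝ => u (x + t * I)) (D₂ x) 0)
    (hL₁ : ∀ x ∈ ball x₁ R, HasDerivAt (fun t : ℝ => D₁ (x + t * 1)) (L₁ x) 0)
    (hL₂ : ∀ x ∈ ball x₁ R, HasDerivAt (fun t : ℝ => D₂ (x + t * I)) (L₂ x) 0)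
    (hL : ∀ x ∈ ball x₁ R, L₁ x + L₂ x ≤ C * (u x + |D₁ x| + |D₂ x|))
    (hcont : ContinuousOn u (ball x₁ R)) (hu : ∀ x ∈ ball x₁ R, 0 ≤ u x)
    (hcrit : HasFDerivAt u (0 : ℂ →L[ℝ] ℝ) x₁) (hux₁ : u x₁ = 0) (hy : y ≠ x₁)
    (hpos : ∀ x ∈ ball x₁ R, ‖x - y‖ < ‖y - x₁‖ → 0 < u x) : False := by
  set d := ‖y - x₁‖ with hd
  have hd0 : 0 < d := norm_pos_iff.mpr (sub_ne_zero.mpr hy)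
  obtain ⟨s, hs0, hsd, hsR⟩ : ∃ s > 0, s ≤ d / 2 ∧ 2 * s < R :=
    ⟨min (d / 2) (R / 3), by positivity, min_le_left _ _, by
      have := min_le_right (d / 2) (R / 3); linarith⟩
  set c := x₁ + ((s / d : ℝ) : ℂ) * (y - x₁) with hc
  have hcx : ‖c - x₁‖ = s := by
    rw [hc, add_sub_cancel_left, norm_mul, norm_real, ← hd, Real.norm_of_nonneg (by positivity)]
    field_simp
  have hcy : ‖c - y‖ = d - s := by
    have : c - y = (((s / d : ℝ) : ℂ) - 1) * (y - x₁) := by rw [hc]; ring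
    rw [this, norm_mul, ← hd, ← ofReal_one, ← ofReal_sub, norm_real, Real.norm_of_nonpos]
    · field_simp; ring
    · rw [sub_nonpos, div_le_one hd0]; linarith
  clear_value c
  have hsub : ∀ x, ‖x - c‖ ≤ s → x ∈ ball x₁ R := by
    intro x hx
    rw [mem_ball, dist_eq_norm]
    calc ‖x - x₁‖ ≤ ‖x - c‖ + ‖c - x₁‖ := norm_sub_le_norm_sub_add_norm_sub _ _ _
      _ < R := by linarith
  have hin : ∀ x, ‖x - c‖ < s → 0 < u x := by
    intro x hx
    refine hpos x (hsub x hx.le) ?_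
    calc ‖x - y‖ ≤ ‖x - c‖ + ‖c - y‖ := norm_sub_le_norm_sub_add_norm_sub _ _ _
      _ < d := by linarith
  obtain ⟨η, hη, hηu⟩ : ∃ η > 0, ∀ x, ‖x - c‖ = s / 2 → η ≤ u x := by
    have hK : IsCompact (sphere c (s / 2)) := isCompact_sphere _ _
    have hne : (sphere c (s / 2)).Nonempty := NormedSpace.sphere_nonempty.mpr (by positivity)
    have hsph : ∀ x ∈ sphere c (s / 2), ‖x - c‖ = s / 2 := fun x hx => by
      rwa [mem_sphere, dist_eq_norm] at hx
    obtain ⟨x0, hx0, hmin⟩ := hK.exists_isMinOn hne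
      (hcont.mono fun x hx => hsub x (by rw [hsph x hx]; linarith))
    refine ⟨u x0, hin x0 (by rw [hsph x0 hx0]; linarith), fun x hx => ?_⟩
    exact hmin (by rw [mem_sphere, dist_eq_norm, hx])
  set α := (4 + 4 * C * s + C) / s ^ 2 + 1 with hα
  have hα1 : 1 ≤ α := by rw [hα]; have : 0 ≤ (4 + 4 * C * s + C) / s ^ 2 := by positivity
                         linarith
  have hαs : α * s ^ 2 = 4 + 4 * C * s + C + s ^ 2 := by rw [hα]; field_simp
  set b : ℂ → ℝ := fun x => Real.exp (-α * normSq (x - c)) - Real.exp (-α * s ^ 2) with hb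
  have hbcont : Continuous b := by
    rw [hb]
    have : Continuous fun x : ℂ => normSq (x - c) := continuous_normSq.comp (by fun_prop)
    fun_prop
  have hwnn : ∀ x, s / 2 ≤ ‖x - c‖ → ‖x - c‖ ≤ s → η * b x ≤ u x := by
    set A := {x : ℂ | s / 2 ≤ ‖x - c‖ ∧ ‖x - c‖ ≤ s} with hA
    have hAc : IsCompact A := by
      refine (isCompact_closedBall c s).of_isClosed_subset ?_ fun x hx => ?_
      · have hn : Continuous fun x : ℂ => ‖x - c‖ := by fun_prop
        exact (isClosed_le continuous_const hn).inter (isClosed_le hn continuous_const)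
      · rw [mem_closedBall, dist_eq_norm]; exact hx.2
    intro x hx1 hx2
    obtain ⟨z, hz, hmin⟩ := hAc.exists_isMinOn (f := fun x => u x - η * b x) ⟨x, hx1, hx2⟩
      ((hcont.mono fun x hx => hsub x hx.2).sub (hbcont.continuousOn.const_mul η))
    by_contra hlt
    push Not at hlt
    have hzneg : u z - η * b z < 0 := by
      have : u z - η * b z ≤ u x - η * b x := hmin ⟨hx1, hx2⟩
      linarith
    have hbz : b z < 1 := by
      have h1 : Real.exp (-α * normSq (z - c)) ≤ 1 := Real.exp_le_one_iff.mpr (by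
        nlinarith [normSq_nonneg (z - c)])
      have h2 := Real.exp_pos (-α * s ^ 2)
      simp only [hb]; linarith
    have hz1 : s / 2 < ‖z - c‖ := by
      refine lt_of_le_of_ne hz.1 fun h => ?_
      have := hηu z h.symm
      linarith [mul_lt_mul_of_pos_left hbz hη]
    have hz2 : ‖z - c‖ < s := by
      refine lt_of_le_of_ne hz.2 fun h => ?_
      have h3 := hu z (hsub z hz.2)
      have : b z = 0 := by simp only [hb, normSq_eq_norm_sq, h, sub_self]
      rw [this] at hzneg; linarith
    have hlocmin : IsLocalMin (fun x => u x - η * b x) z := by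
      refine hmin.isLocalMin ?_
      have h1 : ∀ᶠ x in 𝓝 z, s / 2 < ‖x - c‖ :=
        (continuous_const.continuousAt.eventually_lt
          (by fun_prop : ContinuousAt (fun x => ‖x - c‖) z) hz1)
      have h2 : ∀ᶠ x in 𝓝 z, ‖x - c‖ < s :=
        ((by fun_prop : ContinuousAt (fun x => ‖x - c‖) z).eventually_lt
          continuous_const.continuousAt hz2)
      filter_upwards [h1, h2] with x h1 h2 using ⟨h1.le, h2.le⟩
    set X := z - c with hX
    set E := Real.exp (-α * normSq X) with hE
    have hE0 : 0 < E := Real.exp_pos _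
    have key : ∀ (e : ℂ) (D L : ℂ → ℝ), normSq e = 1 →
        (∀ x ∈ ball x₁ R, HasDerivAt (fun t : ℝ => u (x + t * e)) (D x) 0) →
        (∀ x ∈ ball x₁ R, HasDerivAt (fun t : ℝ => D (x + t * e)) (L x) 0) →
        D z = η * (E * (-α * (2 * (X.re * e.re + X.im * e.im)))) ∧
        η * (E * (4 * α ^ 2 * (X.re * e.re + X.im * e.im) ^ 2 - 2 * α)) ≤ L z := by
      intro e D L he hDe hLe
      have hb' : ∀ t : ℝ, b (z + t * e) =
          Real.exp (-α * normSq (X + t * e)) - Real.exp (-α * s ^ 2) := by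
        intro t; simp only [hb, hX]; congr 4; ring
      have hline : ContinuousAt (fun t : ℝ => z + t * e) 0 := by fun_prop
      have hnear : ∀ᶠ t : ℝ in 𝓝 0, z + t * e ∈ ball x₁ R :=
        hline.eventually (isOpen_ball.mem_nhds (by simpa using hsub z hz.2))
      have hder : ∀ᶠ t : ℝ in 𝓝 0, HasDerivAt (fun t : ℝ => u (z + t * e) - η * b (z + t * e))
          (D (z + t * e) - η * (Real.exp (-α * normSq (X + t * e)) *
            (-α * (2 * (X.re * e.re + X.im * e.im) + 2 * t)))) t := by
        filter_upwards [hnear] with t ht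
        have h1 : HasDerivAt (fun τ : ℝ => u (z + τ * e)) (D (z + t * e)) t := by
          have h0 := hDe _ ht
          have h3 : HasDerivAt (fun τ : ℝ => τ - t) 1 t := (hasDerivAt_id t).sub_const t
          have h4 := HasDerivAt.comp (h₂ := fun τ : ℝ => u (z + t * e + τ * e)) (h := fun τ : ℝ => τ - t)
            t (by simpa using h0) h3
          refine (h4.congr_deriv (by simp)).congr_of_eventuallyEq (Eventually.of_forall fun τ => ?_)
          simp only [comp]; congr 1; push_cast; ring
        have h2 := ((hasDerivAt_gaussian_line α X e t he).sub_const (Real.exp (-α * s ^ 2))).const_mul η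
        simp only [hb']
        exact h1.sub h2
      have hd2 := (hLe z (hsub z hz.2)).sub ((hasDerivAt_gaussian_line_two α X e he).const_mul η)
      have hmin' : IsLocalMin (fun t : ℝ => u (z + t * e) - η * b (z + t * e)) 0 := by
        have hz' : z + ((0 : ℝ) : ℂ) * e = z := by simp
        exact IsLocalMin.comp_continuous (g := fun t : ℝ => z + t * e)
          (f := fun x => u x - η * b x) (b := 0) (by rw [hz']; exact hlocmin) hline
      constructor
      · have := hmin'.hasDerivAt_eq_zero hder.self_of_nhds
        simp only [ofReal_zero, zero_mul, add_zero, mul_zero] at this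
        rw [sub_eq_zero] at this
        rw [this, hE]
      · have := second_deriv_nonneg_of_isLocalMin hder hd2 hmin'
        rw [← hE] at this
        linarith
    obtain ⟨k1, k1'⟩ := key 1 D₁ L₁ (by simp) hD₁ hL₁
    obtain ⟨k2, k2'⟩ := key I D₂ L₂ (by simp) hD₂ hL₂
    simp at k1 k1' k2 k2'
    have hLz := hL z (hsub z hz.2)
    have hXre : |X.re| ≤ s := (abs_re_le_norm X).trans hz.2
    have hXim : |X.im| ≤ s := (abs_im_le_norm X).trans hz.2
    have hD1 : |D₁ z| ≤ η * E * (2 * α * s) := by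
      rw [k1, show -(η * (E * (α * (2 * X.re)))) = -((η * E) * (2 * α) * X.re) by ring, abs_neg, abs_mul,
        abs_of_pos (by positivity : 0 < η * E * (2 * α))]
      have h1 : 0 ≤ η * E * (2 * α) := by positivity
      linarith [mul_le_mul_of_nonneg_left hXre h1]
    have hD2 : |D₂ z| ≤ η * E * (2 * α * s) := by
      rw [k2, show -(η * (E * (α * (2 * X.im)))) = -((η * E) * (2 * α) * X.im) by ring, abs_neg, abs_mul,
        abs_of_pos (by positivity : 0 < η * E * (2 * α))]
      have h1 : 0 ≤ η * E * (2 * α) := by positivity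
      linarith [mul_le_mul_of_nonneg_left hXim h1]
    have huz : u z ≤ η * E := by
      have : b z ≤ E := by
        have := Real.exp_pos (-α * s ^ 2)
        simp only [hb]; linarith
      linarith [mul_le_mul_of_nonneg_left this hη.le]
    have hnX : s ^ 2 / 4 ≤ X.re ^ 2 + X.im ^ 2 := by
      have h1 : X.re ^ 2 + X.im ^ 2 = ‖X‖ ^ 2 := by
        rw [← normSq_eq_norm_sq, normSq_apply]; ring
      rw [h1]
      linarith [mul_self_le_mul_self (by positivity) hz1.le]
    have hfin : η * E * (4 * α ^ 2 * (X.re ^ 2 + X.im ^ 2) - 4 * α) ≤ η * E * (C * (1 + 4 * α * s)) := by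
      have : C * (u z + |D₁ z| + |D₂ z|) ≤ C * (η * E + η * E * (2 * α * s) + η * E * (2 * α * s)) := by
        gcongr
      have h9 : η * E * (4 * α ^ 2 * (X.re ^ 2 + X.im ^ 2) - 4 * α) ≤ L₁ z + L₂ z := by linarith
      linarith
    have hηE : 0 < η * E := by positivity
    have h5 := le_of_mul_le_mul_left hfin hηE
    have h6 : α ^ 2 * s ^ 2 ≤ 4 * α ^ 2 * (X.re ^ 2 + X.im ^ 2) := by
      linarith [mul_le_mul_of_nonneg_left hnX (by positivity : 0 ≤ 4 * α ^ 2)]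
    have h7 : α ^ 2 * s ^ 2 = α * (4 + 4 * C * s + C + s ^ 2) := by rw [← hαs]; ring
    have h8 : 0 < α * s ^ 2 := by positivity
    linarith [mul_nonneg hC (by linarith : 0 ≤ α - 1)]
  -- radial derivative at `x₁`
  set κ := η * Real.exp (-α * s ^ 2) * (α * s ^ 2) with hκ
  have hκ0 : 0 < κ := by positivity
  have hlo := (hcrit.isLittleO).bound (show 0 < κ / (2 * s) by positivity)
  have hline : ContinuousAt (fun t : ℝ => x₁ + t * (c - x₁)) 0 := by fun_prop
  have hev : ∀ᶠ t : ℝ in 𝓝 0, ‖u (x₁ + t * (c - x₁)) - u x₁ -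
      (0 : ℂ →L[ℝ] ℝ) (x₁ + t * (c - x₁) - x₁)‖ ≤ κ / (2 * s) * ‖x₁ + t * (c - x₁) - x₁‖ :=
    hline.eventually (p := fun x => ‖u x - u x₁ - (0 : ℂ →L[ℝ] ℝ) (x - x₁)‖ ≤
      κ / (2 * s) * ‖x - x₁‖) (by simpa using hlo)
  obtain ⟨δ, hδ, hδb⟩ := Metric.eventually_nhds_iff_ball.mp hev
  obtain ⟨t, ht0, htδ, ht2⟩ : ∃ t > 0, t < δ ∧ t ≤ 1 / 2 :=
    ⟨min (δ / 2) (1 / 2), by positivity, by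
      have := min_le_left (δ / 2) (1 / 2); linarith, min_le_right _ _⟩
  have h1 := hδb t (by rw [mem_ball, dist_zero_right, Real.norm_of_nonneg ht0.le]; exact htδ)
  rw [hux₁, add_sub_cancel_left, norm_mul, norm_real, hcx, Real.norm_of_nonneg ht0.le] at h1
  simp at h1
  have hnx : ‖x₁ + t * (c - x₁) - c‖ = (1 - t) * s := by
    have : x₁ + t * (c - x₁) - c = ((t - 1 : ℝ) : ℂ) * (c - x₁) := by push_cast; ring
    rw [this, norm_mul, hcx, norm_real, Real.norm_of_nonpos (by linarith)]; ring
  have h2 := hwnn (x₁ + t * (c - x₁)) (by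
    rw [hnx]; linarith [mul_le_mul_of_nonneg_right ht2 hs0.le]) (by
    rw [hnx]; linarith [mul_nonneg ht0.le hs0.le])
  simp only [hb, normSq_eq_norm_sq, hnx] at h2
  have h3 : Real.exp (-α * s ^ 2) * (1 + α * s ^ 2 * (2 * t - t ^ 2)) ≤
      Real.exp (-α * ((1 - t) * s) ^ 2) := by
    have : -α * ((1 - t) * s) ^ 2 = -α * s ^ 2 + α * s ^ 2 * (2 * t - t ^ 2) := by ring
    rw [this, Real.exp_add]
    gcongr
    have := Real.add_one_le_exp (α * s ^ 2 * (2 * t - t ^ 2))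
    linarith
  have h4 : κ * t ≤ u (x₁ + t * (c - x₁)) := by
    refine le_trans ?_ h2
    have h5 : Real.exp (-α * s ^ 2) * (α * s ^ 2 * t) ≤
        Real.exp (-α * s ^ 2) * (α * s ^ 2 * (2 * t - t ^ 2)) := by
      gcongr
      linarith [mul_le_mul_of_nonneg_left ht2 ht0.le]
    rw [hκ]
    have h6 := mul_le_mul_of_nonneg_left (h5.trans (by linarith : _ ≤
      Real.exp (-α * ((1 - t) * s) ^ 2) - Real.exp (-α * s ^ 2))) hη.le
    linarith
  have h6 := le_abs_self (u (x₁ + t * (c - x₁)))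
  have h7 : κ / (2 * s) * (t * s) = κ * t / 2 := by field_simp
  rw [h7] at h1
  linarith [mul_pos hκ0 ht0]

section

variable {n : ℕ}

theorem hasDerivAt_line {g : ℂ → En n} {x e : ℂ} {A : En n} (h : HasDerivAt g A x) :
    HasDerivAt (fun t : ℝ => g (x + t * e)) (e • A) 0 := by
  have h1 : HasDerivAt (fun t : ℝ => x + (t : ℂ) * e) e 0 := by
    have := ((ofRealCLM.hasDerivAt (x := (0 : ℝ))).mul_const e).const_add x
    exact this.congr_deriv (by simp)
  exact HasDerivAt.scomp (g₁ := g) (h := fun t : ℝ => x + (t : ℂ) * e) 0 (by simpa using h) h1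

/-- A zero of `ρ ∘ g` is never on the boundary of a disc on which `ρ ∘ g` is negative. -/
theorem false_of_touching_disc {Ω : Set (En n)} {ρ : En n → ℝ} (hρ : IsPcxCinfBoundary Ω ρ)
    {W : Set ℂ} (hW : IsOpen W) {g : ℂ → En n} (hg : DifferentiableOn ℂ g W)
    (hm : MapsTo g W (closure Ω)) {x₁ y : ℂ} (hx₁ : x₁ ∈ W) (hgx₁ : ρ (g x₁) = 0) (hy : y ≠ x₁)
    (hpos : ∀ x ∈ W, ‖x - y‖ < ‖y - x₁‖ → ρ (g x) < 0) : False := by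
  have hfr : g x₁ ∈ frontier Ω := (mem_frontier_iff_of_defining hρ).mpr hgx₁
  obtain ⟨C₀, hC₀, r, hr, hlev⟩ := levi_lower hρ hfr
  have h2 : ContDiff ℝ 2 ρ := contDiff_of_defining hρ 2
  have hρd : Differentiable ℝ ρ := h2.differentiable (by norm_num)
  have hρd2 : Differentiable ℝ (fderiv ℝ ρ) :=
    (h2.fderiv_right (m := 1) (by norm_num)).differentiable (by norm_num)
  have hg' : DifferentiableOn ℂ (deriv g) W := hg.deriv hW
  have hgc : ContinuousAt g x₁ := (hg.differentiableAt (hW.mem_nhds hx₁)).continuousAt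
  have hgc' : ContinuousAt (deriv g) x₁ := (hg'.differentiableAt (hW.mem_nhds hx₁)).continuousAt
  set M := ‖deriv g x₁‖ + 1 with hM
  have hev : ∀ᶠ x in 𝓝 x₁, x ∈ W ∧ g x ∈ ball (g x₁) r ∧ ‖deriv g x‖ < M := by
    refine Filter.Eventually.and (hW.mem_nhds hx₁) ((hgc.eventually (ball_mem_nhds _ hr)).and ?_)
    exact hgc'.norm.eventually_lt continuousAt_const (by rw [hM]; linarith)
  obtain ⟨R, hR, hRb⟩ := Metric.eventually_nhds_iff_ball.mp hev
  have hG : ∀ x ∈ ball x₁ R, HasDerivAt g (deriv g x) x := fun x hx =>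
    (hg.differentiableAt (hW.mem_nhds (hRb x hx).1)).hasDerivAt
  have hG' : ∀ x ∈ ball x₁ R, HasDerivAt (deriv g) (deriv (deriv g) x) x := fun x hx =>
    (hg'.differentiableAt (hW.mem_nhds (hRb x hx).1)).hasDerivAt
  set D : ℂ → ℂ → ℝ := fun e x => -fderiv ℝ ρ (g x) (e • deriv g x) with hD
  set L : ℂ → ℂ → ℝ := fun e x => -(fderiv ℝ (fderiv ℝ ρ) (g x) (e • deriv g x) (e • deriv g x) +
    fderiv ℝ ρ (g x) (e • e • deriv (deriv g) x)) with hL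
  have hu1 : ∀ e : ℂ, ∀ x ∈ ball x₁ R, HasDerivAt (fun t : ℝ => -ρ (g (x + t * e))) (D e x) 0 := by
    intro e x hx
    have h := hasDerivAt_line (e := e) (hG x hx)
    exact (HasFDerivAt.comp_hasDerivAt (f := fun t : ℝ => g (x + t * e)) 0
      (by simpa using (hρd (g x)).hasFDerivAt) h).neg
  have hu2 : ∀ e : ℂ, ∀ x ∈ ball x₁ R, HasDerivAt (fun t : ℝ => D e (x + t * e)) (L e x) 0 := by
    intro e x hx
    have h := hasDerivAt_line (e := e) (hG x hx)
    have h' := (hasDerivAt_line (e := e) (hG' x hx)).const_smul e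
    have h3 : HasDerivAt (fun t : ℝ => fderiv ℝ ρ (g (x + t * e)))
        (fderiv ℝ (fderiv ℝ ρ) (g x) (e • deriv g x)) 0 :=
      HasFDerivAt.comp_hasDerivAt (f := fun t : ℝ => g (x + t * e)) 0
        (by simpa using (hρd2 (g x)).hasFDerivAt) h
    have h4 := (h3.clm_apply h').neg
    exact h4.congr_deriv (by simp [hL])
  have hcont : ContinuousOn (fun x => -ρ (g x)) (ball x₁ R) := by
    refine (hρd.continuous.comp_continuousOn fun x hx => ?_).neg
    exact (hG x hx).continuousAt.continuousWithinAt
  have hnn : ∀ x ∈ ball x₁ R, 0 ≤ -ρ (g x) := fun x hx => by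
    have := nonpos_of_mem_closure hρ (hm (hRb x hx).1); linarith
  have hcrit : HasFDerivAt (fun x => -ρ (g x)) (0 : ℂ →L[ℝ] ℝ) x₁ := by
    have hd : DifferentiableAt ℝ (fun x => -ρ (g x)) x₁ :=
      ((hρd (g x₁)).comp x₁ ((hg.differentiableAt (hW.mem_nhds hx₁)).restrictScalars ℝ)).neg
    have hmin : IsLocalMin (fun x => -ρ (g x)) x₁ := by
      filter_upwards [ball_mem_nhds x₁ hR] with x hx
      have := hnn x hx
      simp only [hgx₁]; linarith
    have := hd.hasFDerivAt
    rwa [hmin.fderiv_eq_zero] at this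
  refine hopf_plane (u := fun x => -ρ (g x)) (D₁ := D 1) (D₂ := D I) (L₁ := L 1) (L₂ := L I)
    (C := C₀ * (M ^ 2 + M)) hR (by positivity) (hu1 1) (hu1 I) (hu2 1) (hu2 I) ?_ hcont hnn hcrit
    (by simp [hgx₁]) hy (fun x hx h => by have := hpos x (hRb x hx).1 h; linarith)
  intro x hx
  have hl := hlev (g x) (hm (hRb x hx).1) (hRb x hx).2.1 (deriv g x)
  have hn := (hRb x hx).2.2.le
  have hsum : L 1 x + L I x = -(fderiv ℝ (fderiv ℝ ρ) (g x) (deriv g x) (deriv g x) +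
      fderiv ℝ (fderiv ℝ ρ) (g x) (I • deriv g x) (I • deriv g x)) := by
    simp only [hL, smul_smul, I_mul_I, one_smul, neg_smul, map_neg, one_mul]
    ring
  have habs : |ρ (g x)| = -ρ (g x) := abs_of_nonpos (by have := hnn x hx; linarith)
  have hD1 : |fderiv ℝ ρ (g x) (deriv g x)| = |D 1 x| := by simp [hD]
  have hD2 : |fderiv ℝ ρ (g x) (I • deriv g x)| = |D I x| := by simp [hD]
  rw [habs, hD1, hD2] at hl
  rw [hsum]
  have hu0 := hnn x hx
  have hM0 : 0 ≤ M := by positivity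
  have e1 : -ρ (g x) * ‖deriv g x‖ ^ 2 ≤ -ρ (g x) * (M ^ 2 + M) := by
    have : ‖deriv g x‖ ^ 2 ≤ M ^ 2 := by gcongr
    gcongr; linarith
  have e2 : ‖deriv g x‖ * (|D 1 x| + |D I x|) ≤ (M ^ 2 + M) * (|D 1 x| + |D I x|) := by
    gcongr; nlinarith [sq_nonneg M]
  have e3 : C₀ * (-ρ (g x) * ‖deriv g x‖ ^ 2 + ‖deriv g x‖ * (|D 1 x| + |D I x|)) ≤
      C₀ * (-ρ (g x) * (M ^ 2 + M) + (M ^ 2 + M) * (|D 1 x| + |D I x|)) := by gcongr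
  linarith

/-- Ball version of the tautness statement in dimension one. -/
theorem frontier_of_touching_ball {Ω : Set (En n)} {ρ : En n → ℝ} (hρ : IsPcxCinfBoundary Ω ρ)
    {z : ℂ} {r : ℝ} {g : ℂ → En n} (hg : DifferentiableOn ℂ g (ball z r))
    (hm : MapsTo g (ball z r) (closure Ω)) (h0 : ρ (g z) = 0) {y : ℂ} (hy : y ∈ ball z (r / 2)) :
    ρ (g y) = 0 := by
  by_contra hne
  have hr : 0 < r := by
    have := dist_nonneg.trans_lt (mem_ball.mp hy); linarith
  have hyr : dist y z < r / 2 := mem_ball.mp hy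
  have hlt : ρ (g y) < 0 := lt_of_le_of_ne
    (nonpos_of_mem_closure hρ (hm (ball_subset_ball (by linarith) hy))) hne
  have hsub : closedBall y (dist y z) ⊆ ball z r := fun x hx => by
    rw [mem_ball]
    calc dist x z ≤ dist x y + dist y z := dist_triangle _ _ _
      _ < r := by have := mem_closedBall.mp hx; linarith
  have hρc : Continuous ρ := (contDiff_of_defining hρ 2).continuous
  have hK : IsCompact (closedBall y (dist y z) ∩ (fun x => ρ (g x)) ⁻¹' {0}) := by
    refine (isCompact_closedBall _ _).of_isClosed_subset ?_ inter_subset_left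
    exact ((hρc.comp_continuousOn hg.continuousOn).mono hsub).preimage_isClosed_of_isClosed
      isClosed_closedBall isClosed_singleton
  obtain ⟨x₁, hx₁, hmin⟩ := hK.exists_isMinOn (f := fun x => dist x y)
    ⟨z, by rw [mem_closedBall, dist_comm], h0⟩ (by fun_prop)
  have hx₁y : y ≠ x₁ := fun h => hne (by rw [h]; exact hx₁.2)
  refine false_of_touching_disc hρ isOpen_ball hg hm (hsub hx₁.1) hx₁.2 hx₁y fun x hx hxy => ?_
  refine lt_of_le_of_ne (nonpos_of_mem_closure hρ (hm hx)) fun h => ?_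
  rw [← dist_eq_norm, ← dist_eq_norm, dist_comm y x₁] at hxy
  have : dist x₁ y ≤ dist x y := hmin ⟨mem_closedBall.mpr
    (hxy.le.trans (mem_closedBall.mp hx₁.1)), h⟩
  linarith

/-- Halved-ball variant of `forall_mem_of_ball_chain`. -/
theorem forall_mem_of_half_ball_chain {E : Type*} [NormedAddCommGroup E] [NormedSpace ℝ E]
    {Ω : Set E} (hΩ : IsOpen Ω) (hc : IsPreconnected Ω) {P : E → Prop}
    (hP : ∀ z r, ball z r ⊆ Ω → P z → ∀ y ∈ ball z (r / 2), P y)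
    {z₀ : E} (hz₀ : z₀ ∈ Ω) (h₀ : P z₀) : ∀ z ∈ Ω, P z := by
  have hsub : Ω ⊆ {z | z ∈ Ω ∧ P z} := by
    refine hc.subset_of_closure_inter_subset ?_ ⟨z₀, hz₀, hz₀, h₀⟩ ?_
    · rw [Metric.isOpen_iff]
      rintro z ⟨hz, hPz⟩
      obtain ⟨r, hr, hrb⟩ := Metric.isOpen_iff.mp hΩ z hz
      refine ⟨r / 2, by positivity, fun y hy => ⟨hrb (ball_subset_ball (by linarith) hy), ?_⟩⟩
      exact hP z r hrb hPz y hy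
    · rintro z ⟨hzc, hz⟩
      obtain ⟨r, hr, hrb⟩ := Metric.isOpen_iff.mp hΩ z hz
      obtain ⟨w, ⟨hw, hPw⟩, hzw⟩ := Metric.mem_closure_iff.mp hzc (r / 4) (by positivity)
      refine ⟨hz, hP w (r / 2) (fun y hy => hrb ?_) hPw z ?_⟩
      · rw [mem_ball] at *
        calc dist y z ≤ dist y w + dist w z := dist_triangle _ _ _
          _ < r := by rw [dist_comm w z]; linarith
      · rw [mem_ball]; linarith
  exact fun z hz => (hsub hz).2

/-- Weak tautness: a holomorphic map into the closure of `Ω` which meets the boundary stays in the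
boundary. -/
theorem mapsTo_frontier_of_touching {E : Type*} [NormedAddCommGroup E] [NormedSpace ℂ E]
    {Ω : Set (En n)} {ρ : En n → ℝ} (hρ : IsPcxCinfBoundary Ω ρ)
    {W : Set E} (hW : IsOpen W) (hWc : IsPreconnected W) {g : E → En n}
    (hg : DifferentiableOn ℂ g W) (hm : MapsTo g W (closure Ω)) {x₀ : E} (hx₀ : x₀ ∈ W)
    (h₀ : g x₀ ∈ frontier Ω) : ∀ x ∈ W, g x ∈ frontier Ω := by
  let _ : NormedSpace ℝ E := NormedSpace.restrictScalars ℝ ℂ E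
  simp only [mem_frontier_iff_of_defining hρ] at h₀ ⊢
  refine forall_mem_of_half_ball_chain (P := fun x => ρ (g x) = 0) hW hWc (fun z r hzr hz y hy => ?_)
    hx₀ h₀
  obtain ⟨R, hR, hRl⟩ : ∃ R > 2, ∀ t ∈ ball (0 : ℂ) R, z + t • (y - z) ∈ ball z r := by
    obtain ⟨r', hr', hr'r⟩ := exists_between (mem_ball.mp hy)
    have hr0 : 0 < r' := dist_nonneg.trans_lt hr'
    refine ⟨r / r', by rw [gt_iff_lt, lt_div_iff₀ hr0]; linarith, fun t ht => ?_⟩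
    rw [mem_ball, dist_eq_norm] at *
    rw [add_sub_cancel_left, norm_smul]
    rw [sub_zero, lt_div_iff₀ hr0] at ht
    exact (mul_le_mul_of_nonneg_left hr'.le (norm_nonneg t)).trans_lt ht
  have hline : DifferentiableOn ℂ (fun t : ℂ => z + t • (y - z)) (ball 0 R) := by fun_prop
  have := frontier_of_touching_ball hρ (z := 0) (r := R) (g := fun t : ℂ => g (z + t • (y - z)))
    (hg.comp hline fun t ht => hzr (hRl t ht)) (fun t ht => hm (hzr (hRl t ht))) (by simpa using hz)
    (y := 1) (by rw [mem_ball, dist_eq_norm]; simp; linarith)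
  simpa using this

end

section UltrafilterMaps

variable {ι E F : Type*} [NormedAddCommGroup F] [NormedSpace ℂ F] [FiniteDimensional ℂ F]

/-- The pointwise limit of a family of maps along an ultrafilter. -/
def ulim (U : Ultrafilter ι) (f : ι → E → F) : E → F := fun x =>
  limUnder (U : Filter ι) fun i => f i x

variable {U : Ultrafilter ι} {f : ι → E → F} {W : Set E} {M : ℝ}

theorem tendsto_ulim {x : E} (hM : ∀ᶠ i in (U : Filter ι), ‖f i x‖ ≤ M) :
    Tendsto (fun i => f i x) U (𝓝 (ulim U f x)) := by
  have : ProperSpace F := FiniteDimensional.proper ℂ F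
  exact tendsto_ultrafilter_limUnder U hM

theorem ulim_mem_closure {S : Set F} {x : E} (hM : ∀ i, ‖f i x‖ ≤ M) (hS : ∀ i, f i x ∈ S) :
    ulim U f x ∈ closure S :=
  mem_closure_of_tendsto (tendsto_ulim (U := U) (Eventually.of_forall hM)) (Eventually.of_forall hS)

variable [NormedAddCommGroup E] [NormedSpace ℂ E] [FiniteDimensional ℂ E]

theorem differentiableOn_ulim (hW : IsOpen W) (hd : ∀ i, DifferentiableOn ℂ (f i) W)
    (hM : ∀ i, ∀ x ∈ W, ‖f i x‖ ≤ M) : DifferentiableOn ℂ (ulim U f) W := by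
  intro z hz
  obtain ⟨R, hR, hRW⟩ := Metric.isOpen_iff.mp hW z hz
  exact (differentiableAt_ultrafilter_limit U hR (Eventually.of_forall fun i => (hd i).mono hRW)
    (Eventually.of_forall fun i y hy => hM i y (hRW hy))
    fun y hy => tendsto_ulim (Eventually.of_forall fun i => hM i y (hRW hy))).differentiableWithinAt

theorem tendsto_ulim_moving (hW : IsOpen W) (hd : ∀ i, DifferentiableOn ℂ (f i) W)
    (hM : ∀ i, ∀ x ∈ W, ‖f i x‖ ≤ M) {z : E} (hz : z ∈ W) {y : ι → E} (hy : Tendsto y U (𝓝 z)) :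
    Tendsto (fun i => f i (y i)) U (𝓝 (ulim U f z)) := by
  obtain ⟨R, hR, hRW⟩ := Metric.isOpen_iff.mp hW z hz
  exact tendsto_ultrafilter_moving U hR (Eventually.of_forall fun i => (hd i).mono hRW)
    (Eventually.of_forall fun i y hy => hM i y (hRW hy))
    (tendsto_ulim (Eventually.of_forall fun i => hM i z hz)) hy

theorem tendsto_fderiv_ulim (hW : IsOpen W) (hd : ∀ i, DifferentiableOn ℂ (f i) W)
    (hM : ∀ i, ∀ x ∈ W, ‖f i x‖ ≤ M) {z : E} (hz : z ∈ W) :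
    Tendsto (fun i => fderiv ℂ (f i) z) U (𝓝 (fderiv ℂ (ulim U f) z)) := by
  obtain ⟨R, hR, hRW⟩ := Metric.isOpen_iff.mp hW z hz
  obtain ⟨A, hA, hA'⟩ := hasFDerivAt_ultrafilter_limit U hR
    (Eventually.of_forall fun i => (hd i).mono hRW)
    (Eventually.of_forall fun i y hy => hM i y (hRW hy))
    fun y hy => tendsto_ulim (Eventually.of_forall fun i => hM i y (hRW hy))
  rwa [hA'.fderiv]

end UltrafilterMaps

variable {n : ℕ} {Ω : Set (En n)} {p : En n}

namespace LocalModel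

/-- The quadratic peak function of a local model. -/
def h (M : LocalModel Ω p) (v : En n) : ℂ := M.ℓ v + M.B v v

theorem differentiable_h (M : LocalModel Ω p) : Differentiable ℂ M.h := by
  unfold LocalModel.h
  fun_prop

theorem h_zero (M : LocalModel Ω p) : M.h 0 = 0 := by simp [h]

theorem lower' (M : LocalModel Ω p) {z : En n} (hz : z ∈ closure Ω) (hε : ‖z - p‖ < M.ε) :
    M.c * ‖z - p‖ ^ 2 ≤ (M.h (z - p)).re :=
  M.lower (z - p) (by simpa using hz) hε

/-- A holomorphic map into the closure of `Ω` which attains `p` is constant. -/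
theorem eqOn_of_attains (M : LocalModel Ω p) {E : Type*} [NormedAddCommGroup E] [NormedSpace ℂ E]
    {W : Set E} (hW : IsOpen W) (hWc : IsPreconnected W) {g : E → En n}
    (hg : DifferentiableOn ℂ g W) (hm : MapsTo g W (closure Ω)) {x₀ : E} (hx₀ : x₀ ∈ W)
    (h₀ : g x₀ = p) : ∀ x ∈ W, g x = p := by
  have hcont : ContinuousAt g x₀ := (hg.differentiableAt (hW.mem_nhds hx₀)).continuousAt
  have hnear : ∀ᶠ x in 𝓝 x₀, x ∈ W ∧ ‖g x - p‖ < M.ε := by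
    refine Filter.Eventually.and (hW.mem_nhds hx₀) ?_
    have : ContinuousAt (fun x => ‖g x - p‖) x₀ := (hcont.sub continuousAt_const).norm
    exact this.eventually_lt continuousAt_const (by simp [h₀, M.ε_pos])
  have hlow : ∀ᶠ x in 𝓝 x₀, M.c * ‖g x - p‖ ^ 2 ≤ (M.h (g x - p)).re :=
    hnear.mono fun x hx => M.lower' (hm hx.1) hx.2
  have hmax : IsLocalMax (norm ∘ fun x => cexp (-M.h (g x - p))) x₀ := by
    filter_upwards [hlow] with x hx
    simp only [comp, norm_exp, h₀, sub_self, M.h_zero, neg_re, neg_zero, zero_re, Real.exp_zero]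
    rw [Real.exp_le_one_iff]
    have := M.c_pos
    have : 0 ≤ M.c * ‖g x - p‖ ^ 2 := by positivity
    linarith
  have hdiff : ∀ᶠ x in 𝓝 x₀, DifferentiableAt ℂ (fun x => cexp (-M.h (g x - p))) x := by
    filter_upwards [hW.mem_nhds hx₀] with x hx
    have h1 : DifferentiableAt ℂ g x := hg.differentiableAt (hW.mem_nhds hx)
    exact (((M.differentiable_h _).comp x (h1.sub_const p)).neg).cexp
  have heq := Complex.eventually_eq_of_isLocalMax_norm hdiff hmax
  refine eqOn_of_eventuallyEq_holo (g := fun _ => p) hW hWc hg (differentiableOn_const p) hx₀ ?_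
  filter_upwards [heq, hlow] with x hx hl
  simp only [h₀, sub_self, M.h_zero, neg_zero, Complex.exp_zero] at hx
  have h1 : ‖cexp (-M.h (g x - p))‖ = 1 := by rw [hx]; simp
  rw [norm_exp, Real.exp_eq_one_iff, neg_re, neg_eq_zero] at h1
  rw [h1] at hl
  have h2 : ‖g x - p‖ ^ 2 ≤ 0 := by
    by_contra hcon
    push Not at hcon
    have := mul_pos M.c_pos hcon
    linarith
  have h3 : ‖g x - p‖ = 0 := by
    have := sq_nonneg ‖g x - p‖
    exact pow_eq_zero_iff (two_ne_zero) |>.mp (le_antisymm h2 this)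
  exact sub_eq_zero.mp (norm_eq_zero.mp h3)

/-- Discs in `Ω` with centre near `p` remain near `p`. -/
theorem exists_localization (M : LocalModel Ω p) (hbd : Bornology.IsBounded Ω) :
    ∃ ε₁ > 0, ε₁ ≤ M.ε ∧ ∀ g : ℂ → En n, DifferentiableOn ℂ g (ball 0 1) →
      MapsTo g (ball 0 1) Ω → ‖g 0 - p‖ < ε₁ → ∀ ζ : ℂ, ‖ζ‖ ≤ 1 / 2 → ‖g ζ - p‖ < M.ε := by
  by_contra hcon
  push Not at hcon
  obtain ⟨K, hK⟩ := hbd.exists_norm_le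
  have hpos : ∀ j : ℕ, 0 < min (1 / ((j : ℝ) + 1)) M.ε := fun j =>
    lt_min (by positivity) M.ε_pos
  choose g hgd hgm hg0 ζ hζ hgζ using fun j : ℕ => hcon _ (hpos j) (min_le_right _ _)
  set U : Ultrafilter ℕ := hyperfilter ℕ
  have hU : (U : Filter ℕ) ≤ atTop := by
    rw [← Nat.cofinite_eq_atTop]; exact hyperfilter_le_cofinite
  have hb : ∀ j, ∀ x ∈ ball (0 : ℂ) 1, ‖g j x‖ ≤ K := fun j x hx => hK _ (hgm j hx)
  have hd := differentiableOn_ulim (U := U) isOpen_ball hgd hb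
  have h0 : (0 : ℂ) ∈ ball (0 : ℂ) 1 := by simp
  have hlim0 : ulim U g 0 = p := by
    have h1 := tendsto_ulim (U := U) (Eventually.of_forall fun j => hb j 0 h0)
    refine tendsto_nhds_unique h1 ?_
    rw [tendsto_iff_norm_sub_tendsto_zero]
    refine squeeze_zero (fun _ => norm_nonneg _) (fun j => ((hg0 j).trans_le (min_le_left _ _)).le) ?_
    exact tendsto_one_div_add_atTop_nhds_zero_nat.mono_left hU
  have hall := M.eqOn_of_attains isOpen_ball (convex_ball (0 : ℂ) 1).isPreconnected hd
    (fun x hx => ulim_mem_closure (fun j => hb j x hx) fun j => hgm j hx) h0 hlim0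
  obtain ⟨z, hz⟩ := exists_tendsto_ultrafilter U (Eventually.of_forall hζ)
  have hzb : ‖z‖ ≤ 1 / 2 := le_of_tendsto hz.norm (Eventually.of_forall hζ)
  have hz1 : z ∈ ball (0 : ℂ) 1 := by rw [mem_ball_zero_iff]; linarith
  have hmov := tendsto_ulim_moving (U := U) isOpen_ball hgd hb hz1 hz
  rw [hall z hz1] at hmov
  have h2 : Tendsto (fun j => ‖g j (ζ j) - p‖) U (𝓝 0) := by
    simpa using (hmov.sub_const p).norm
  have := ge_of_tendsto h2 (Eventually.of_forall hgζ)
  linarith [M.ε_pos]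

end LocalModel

section

variable {n : ℕ} {Ω : Set (En n)} {p : En n}

/-- Holomorphic self-maps of `Ω` tangent to the identity at `p`. -/
structure TangentMap (Ω : Set (En n)) (p : En n) (G : En n → En n) : Prop where
  diff : DifferentiableOn ℂ G Ω
  maps : MapsTo G Ω Ω
  tangent : ∀ η > 0, ∃ δ > 0, ∀ z ∈ Ω, ‖z - p‖ < δ → ‖G z - z‖ ≤ η * ‖z - p‖

namespace TangentMap

theorem of_littleOh {F : En n → En n} (hF : DifferentiableOn ℂ F Ω) (hm : MapsTo F Ω Ω)
    (hp : p ∉ Ω) (ho : LittleOh Ω F p 1) : TangentMap Ω p F := by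
  refine ⟨hF, hm, fun η hη => ?_⟩
  obtain ⟨δ, hδ, hb⟩ := Metric.tendsto_nhdsWithin_nhds.mp ho η hη
  refine ⟨δ, hδ, fun z hz hzδ => ?_⟩
  have h1 := hb hz (by rwa [dist_eq_norm])
  have hne : 0 < ‖z - p‖ := norm_pos_iff.mpr (sub_ne_zero.mpr fun h => hp (h ▸ hz))
  rw [dist_zero_right, pow_one, Real.norm_of_nonneg (by positivity), div_lt_iff₀ hne] at h1
  exact h1.le

theorem id : TangentMap Ω p id :=
  ⟨differentiableOn_id, mapsTo_id Ω, fun η hη => ⟨1, one_pos, fun z _ _ => by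
    simp only [id_eq, sub_self, norm_zero]; positivity⟩⟩

theorem comp {G₁ G₂ : En n → En n} (h₁ : TangentMap Ω p G₁) (h₂ : TangentMap Ω p G₂) :
    TangentMap Ω p (G₁ ∘ G₂) := by
  refine ⟨h₁.diff.comp h₂.diff h₂.maps, h₁.maps.comp h₂.maps, fun η hη => ?_⟩
  set η' := min (η / 3) 1 with hη'
  have h0 : 0 < η' := lt_min (by positivity) one_pos
  have h1 : η' ≤ 1 := min_le_right _ _
  have h3 : η' ≤ η / 3 := min_le_left _ _
  obtain ⟨δ₁, hδ₁, hb₁⟩ := h₁.tangent η' h0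
  obtain ⟨δ₂, hδ₂, hb₂⟩ := h₂.tangent η' h0
  refine ⟨min (δ₁ / 2) δ₂, by positivity, fun z hz hzδ => ?_⟩
  have e2 := hb₂ z hz (hzδ.trans_le (min_le_right _ _))
  have e3 : ‖G₂ z - p‖ ≤ 2 * ‖z - p‖ := by
    calc ‖G₂ z - p‖ ≤ ‖G₂ z - z‖ + ‖z - p‖ := norm_sub_le_norm_sub_add_norm_sub _ _ _
      _ ≤ 2 * ‖z - p‖ := by nlinarith [norm_nonneg (z - p)]
  have e1 := hb₁ (G₂ z) (h₂.maps hz) (by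
    have := hzδ.trans_le (min_le_left _ _); linarith)
  calc ‖(G₁ ∘ G₂) z - z‖ ≤ ‖G₁ (G₂ z) - G₂ z‖ + ‖G₂ z - z‖ := norm_sub_le_norm_sub_add_norm_sub _ _ _
    _ ≤ η * ‖z - p‖ := by nlinarith [norm_nonneg (z - p)]

theorem iterate {F : En n → En n} (h : TangentMap Ω p F) (m : ℕ) : TangentMap Ω p F^[m] := by
  induction m with
  | zero => exact TangentMap.id
  | succ k ih => rw [iterate_succ]; exact ih.comp h

end TangentMap

/-- The linear disc `x ↦ p + v / x`. -/
def disc (p v : En n) (x : ℂ) : En n := p + x⁻¹ • v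

theorem disc_sub (p v : En n) (x : ℂ) : disc p v x - p = x⁻¹ • v := by simp [disc]

theorem differentiableAt_disc (p v : En n) {x : ℂ} (hx : x ≠ 0) :
    DifferentiableAt ℂ (disc p v) x :=
  ((differentiableAt_inv hx).smul_const v).const_add p

namespace LocalModel

theorem re_h_pos (M : LocalModel Ω p) (hp : p ∉ Ω) {z : En n} (hz : z ∈ Ω) (hε : ‖z - p‖ < M.ε) :
    0 < (M.h (z - p)).re := by
  have hne : 0 < ‖z - p‖ := norm_pos_iff.mpr (sub_ne_zero.mpr fun h => hp (h ▸ hz))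
  have := M.lower' (subset_closure hz) hε
  have h2 : 0 < M.c * ‖z - p‖ ^ 2 := mul_pos M.c_pos (by positivity)
  linarith

theorem one_le_norm (M : LocalModel Ω p) {v : En n} (hv : M.ℓ v = 1) : 1 ≤ ‖M.ℓ‖ * ‖v‖ := by
  have := M.ℓ.le_opNorm v
  rwa [hv, norm_one] at this

/-- The discs `x ↦ p + v / x` with `ℓ v = 1` lie in `Ω` for large real part. -/
theorem disc_mem (M : LocalModel Ω p) {v : En n} (hv : M.ℓ v = 1) {x : ℂ}
    (hx : (M.C + ‖M.B‖ + ‖M.ℓ‖ / M.ε) * ‖v‖ ^ 2 < x.re) : disc p v x ∈ Ω := by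
  have h1 := M.one_le_norm hv
  have hv0 : 0 < ‖v‖ := by
    rcases (norm_nonneg v).eq_or_lt with h | h
    · rw [← h] at h1; norm_num at h1
    · exact h
  have hC := M.C_pos
  have hε := M.ε_pos
  have hx0 : 0 < x.re := lt_of_le_of_lt (by positivity) hx
  have hxn : 0 < ‖x‖ := hx0.trans_le (re_le_norm x)
  have hne : x ≠ 0 := norm_pos_iff.mp hxn
  have hu : ‖x⁻¹ • v‖ = ‖v‖ / ‖x‖ := by rw [norm_smul, norm_inv]; field_simp
  refine M.upper _ ?_ ?_
  · rw [hu, div_lt_iff₀ hxn]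
    have h2 : ‖v‖ ≤ M.ε * (‖M.ℓ‖ / M.ε * ‖v‖ ^ 2) := by
      have : M.ε * (‖M.ℓ‖ / M.ε * ‖v‖ ^ 2) = (‖M.ℓ‖ * ‖v‖) * ‖v‖ := by field_simp
      rw [this]; nlinarith
    have h3 : ‖M.ℓ‖ / M.ε * ‖v‖ ^ 2 < ‖x‖ := by
      have := re_le_norm x
      have h5 : 0 ≤ (M.C + ‖M.B‖) * ‖v‖ ^ 2 := by positivity
      linarith [hx, add_mul (M.C + ‖M.B‖) (‖M.ℓ‖ / M.ε) (‖v‖ ^ 2)]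
    nlinarith
  · rw [hu, map_smul, hv]
    simp only [map_smul, _root_.smul_apply, smul_eq_mul, mul_one]
    have hB : ‖M.B v v‖ ≤ ‖M.B‖ * ‖v‖ ^ 2 := by
      have := M.B.le_opNorm₂ v v
      rw [sq, ← mul_assoc]; exact this
    have e1 : (x⁻¹).re = x.re / ‖x‖ ^ 2 := by rw [inv_re, normSq_eq_norm_sq]
    have e2 : -(‖M.B‖ * ‖v‖ ^ 2 / ‖x‖ ^ 2) ≤ (x⁻¹ * (x⁻¹ * M.B v v)).re := by
      have h6 : ‖x⁻¹ * (x⁻¹ * M.B v v)‖ ≤ ‖M.B‖ * ‖v‖ ^ 2 / ‖x‖ ^ 2 := by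
        rw [norm_mul, norm_mul, norm_inv, div_eq_inv_mul, ← mul_assoc, ← sq, inv_pow]
        gcongr
      have := (abs_le.mp (abs_re_le_norm (x⁻¹ * (x⁻¹ * M.B v v)))).1
      linarith
    rw [add_re, e1]
    have h7 : 0 ≤ ‖M.ℓ‖ / M.ε * ‖v‖ ^ 2 := by positivity
    have h8 : (M.C + ‖M.B‖) * ‖v‖ ^ 2 < x.re := by
      linarith [hx, add_mul (M.C + ‖M.B‖) (‖M.ℓ‖ / M.ε) (‖v‖ ^ 2)]
    have h9 : (M.C + ‖M.B‖) * ‖v‖ ^ 2 / ‖x‖ ^ 2 < x.re / ‖x‖ ^ 2 := by gcongr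
    have h10 : M.C * (‖v‖ / ‖x‖) ^ 2 + ‖M.B‖ * ‖v‖ ^ 2 / ‖x‖ ^ 2 =
      (M.C + ‖M.B‖) * ‖v‖ ^ 2 / ‖x‖ ^ 2 := by field_simp
    linarith

theorem tendsto_smul_tangent {G : En n → En n} (hG : TangentMap Ω p G) {v : En n} {X : ℝ}
    (hmem : ∀ x : ℂ, X < x.re → disc p v x ∈ Ω) :
    Tendsto (fun Y : ℝ => ((X + Y : ℝ) : ℂ) • (G (disc p v ((X + Y : ℝ) : ℂ)) - p)) atTop (𝓝 v) := by
  have hlin : Tendsto (fun Y : ℝ => X + Y) atTop atTop := tendsto_atTop_add_const_left _ _ tendsto_id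
  rw [Metric.tendsto_nhds]
  intro η hη
  obtain ⟨δ, hδ, hb⟩ := hG.tangent (η / (‖v‖ + 1)) (by positivity)
  filter_upwards [hlin.eventually_gt_atTop X, hlin.eventually_gt_atTop 0,
    hlin.eventually_gt_atTop (‖v‖ / δ)] with Y h1 h2 h3
  set x : ℂ := ((X + Y : ℝ) : ℂ) with hx
  have hxre : x.re = X + Y := by simp [hx]
  have hxn : ‖x‖ = X + Y := by rw [hx, norm_real, Real.norm_of_nonneg h2.le]
  have hx0 : x ≠ 0 := by rw [hx]; exact_mod_cast h2.ne'
  have hD := hmem x (by rw [hxre]; exact h1)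
  have hn : ‖disc p v x - p‖ = ‖v‖ / (X + Y) := by
    rw [disc_sub, norm_smul, norm_inv, hxn]; field_simp
  have h4 := hb _ hD (by rw [hn, div_lt_iff₀ h2]; rw [div_lt_iff₀ hδ] at h3; linarith)
  have e : x • (G (disc p v x) - p) - v = x • (G (disc p v x) - disc p v x) := by
    have : G (disc p v x) - p = (G (disc p v x) - disc p v x) + (disc p v x - p) := by abel
    rw [this, smul_add, disc_sub, smul_smul, mul_inv_cancel₀ hx0, one_smul, add_sub_cancel_right]
  rw [dist_eq_norm, e, norm_smul, hxn]
  calc (X + Y) * ‖G (disc p v x) - disc p v x‖ ≤ (X + Y) * (η / (‖v‖ + 1) * (‖v‖ / (X + Y))) := by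
        rw [← hn]; gcongr
    _ = η * (‖v‖ / (‖v‖ + 1)) := by field_simp
    _ < η * 1 := by
        gcongr
        rw [div_lt_one (by positivity)]; linarith
    _ = η := mul_one _

theorem mul_h (M : LocalModel Ω p) (t : ℂ) (u : En n) :
    t * M.h u = M.ℓ (t • u) + M.B (t • u) u := by
  simp only [h, map_smul, _root_.smul_apply, smul_eq_mul]
  ring

theorem tendsto_mul_h (M : LocalModel Ω p) {ι : Type*} {l : Filter ι} {t : ι → ℂ} {u : ι → En n}
    {v : En n} (hT : Tendsto (fun i => t i • u i) l (𝓝 v)) (hu : Tendsto u l (𝓝 0)) :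
    Tendsto (fun i => t i * M.h (u i)) l (𝓝 (M.ℓ v)) := by
  have h2 : Tendsto (fun i => M.B (t i • u i) (u i)) l (𝓝 (M.B v 0)) :=
    (isBoundedBilinearMap_apply.continuous.tendsto (M.B v, (0 : En n))).comp
      (((M.B.continuous.tendsto v).comp hT).prodMk_nhds hu)
  have h1 := ((M.ℓ.continuous.tendsto v).comp hT).add h2
  rw [map_zero, add_zero] at h1
  exact h1.congr fun i => (M.mul_h _ _).symm

set_option maxHeartbeats 1000000 in
/-- Julia's inequality on a half-plane whose image is localised near `p`. -/
theorem julia_of_localized (M : LocalModel Ω p) (hp : p ∉ Ω) {G : En n → En n}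
    (hG : TangentMap Ω p G) {v : En n} (hv : M.ℓ v = 1) {X : ℝ} (hX0 : 0 ≤ X)
    (hmem : ∀ x : ℂ, X < x.re → disc p v x ∈ Ω)
    (hloc : ∀ x : ℂ, X < x.re → ‖G (disc p v x) - p‖ < M.ε) {x : ℂ} (hx : X < x.re) :
    (x.re - X) * ‖M.h (G (disc p v x) - p)‖ ^ 2 ≤
      (M.h (G (disc p v x) - p)).re - M.c * ‖G (disc p v x) - p‖ ^ 2 := by
  set u : ℂ → En n := fun y => G (disc p v (X + y)) - p with hu
  have hre : ∀ y ∈ rightHP, X < ((X : ℂ) + y).re := fun y hy => by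
    have : 0 < y.re := hy
    simp; exact this
  have hud : DifferentiableOn ℂ u rightHP := by
    intro y hy
    have hne : (X : ℂ) + y ≠ 0 := fun h0 => by
      have h1 := hre y hy
      rw [h0, zero_re] at h1; linarith
    have h1 : DifferentiableWithinAt ℂ (fun y : ℂ => disc p v (X + y)) rightHP y :=
      ((differentiableAt_disc p v hne).comp y
        ((differentiableAt_id).const_add (X : ℂ))).differentiableWithinAt
    have h2 : DifferentiableWithinAt ℂ (fun y : ℂ => G (disc p v (X + y))) rightHP y :=
      DifferentiableWithinAt.comp y (t := Ω) (hG.diff _ (hmem _ (hre y hy))) h1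
        (fun y' hy' => hmem _ (hre y' hy'))
    exact h2.sub_const p
  have hup : ∀ y ∈ rightHP, 0 < (M.h (u y)).re := fun y hy =>
    M.re_h_pos hp (hG.maps (hmem _ (hre y hy))) (hloc _ (hre y hy))
  have hune : ∀ y ∈ rightHP, M.h (u y) ≠ 0 := fun y hy h0 => by
    have := hup y hy
    rw [h0] at this; simp at this
  have hulow : ∀ y ∈ rightHP, M.c * ‖u y‖ ^ 2 ≤ (M.h (u y)).re := fun y hy =>
    M.lower' (subset_closure (hG.maps (hmem _ (hre y hy)))) (hloc _ (hre y hy))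
  set w : ℂ → ℂ := fun y => (M.h (u y))⁻¹ with hw
  have hwd : DifferentiableOn ℂ w rightHP :=
    (M.differentiable_h.comp_differentiableOn hud).inv hune
  set y₀ : ℂ := x - X with hy₀
  have hy₀m : y₀ ∈ rightHP := by show 0 < y₀.re; simp [hy₀]; linarith
  set a : En n := w y₀ • u y₀ with ha
  set f : ℂ → ℂ := fun y => w y - 2 * M.c * inner ℂ a (w y • u y) + M.c * ‖a‖ ^ 2 with hf
  have hwre : ∀ y, (w y).re = (M.h (u y)).re / ‖M.h (u y)‖ ^ 2 := fun y => by
    simp only [hw, inv_re, normSq_eq_norm_sq]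
  have hsn : ∀ y, ‖w y • u y‖ ^ 2 = ‖u y‖ ^ 2 / ‖M.h (u y)‖ ^ 2 := fun y => by
    simp only [hw, norm_smul, norm_inv]
    rw [mul_pow, inv_pow, div_eq_inv_mul]
  have hfre : ∀ y, (f y).re = (w y).re - M.c * ‖w y • u y‖ ^ 2 + M.c * ‖w y • u y - a‖ ^ 2 := by
    intro y
    have h1 : ‖w y • u y - a‖ ^ 2 =
        ‖w y • u y‖ ^ 2 - 2 * (inner ℂ a (w y • u y)).re + ‖a‖ ^ 2 := by
      rw [norm_sub_rev, norm_sub_sq (𝕜 := ℂ)]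
      simp only [RCLike.re_to_complex]
      ring
    rw [h1]
    have h2 : (f y).re = (w y).re - 2 * M.c * (inner ℂ a (w y • u y)).re + M.c * ‖a‖ ^ 2 := by
      simp only [hf, add_re, sub_re]
      rw [show (2 : ℂ) * M.c = ((2 * M.c : ℝ) : ℂ) by push_cast; ring, re_ofReal_mul]
      rw [show (M.c : ℂ) * (‖a‖ : ℂ) ^ 2 = ((M.c * ‖a‖ ^ 2 : ℝ) : ℂ) by push_cast; ring, ofReal_re]
    rw [h2]; ring
  have hfnn : ∀ y ∈ rightHP, 0 ≤ (f y).re := by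
    intro y hy
    rw [hfre, hwre, hsn]
    have h1 := hulow y hy
    have h2 : M.c * (‖u y‖ ^ 2 / ‖M.h (u y)‖ ^ 2) ≤ (M.h (u y)).re / ‖M.h (u y)‖ ^ 2 := by
      rw [← mul_div_assoc]; gcongr
    have h3 : 0 ≤ M.c * ‖w y • u y - a‖ ^ 2 := mul_nonneg M.c_pos.le (by positivity)
    linarith
  have hfd : DifferentiableOn ℂ f rightHP := by
    have h1 : DifferentiableOn ℂ (fun y => inner ℂ a (w y • u y)) rightHP :=
      (innerSL ℂ a).differentiable.comp_differentiableOn (hwd.smul hud)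
    exact (hwd.sub (h1.const_mul (2 * (M.c : ℂ)))).add_const (M.c * (‖a‖ : ℂ) ^ 2)
  have hlin : Tendsto (fun Y : ℝ => X + Y) atTop atTop := tendsto_atTop_add_const_left _ _ tendsto_id
  have hT := tendsto_smul_tangent hG hmem
  have hinvT : Tendsto (fun Y : ℝ => (((X + Y : ℝ) : ℂ))⁻¹) atTop (𝓝 0) :=
    tendsto_ofReal_inv_atTop.comp hlin
  have hcast : ∀ Y : ℝ, G (disc p v ((X + Y : ℝ) : ℂ)) - p = u Y := fun Y => by
    simp only [hu, ofReal_add]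
  simp only [hcast] at hT
  have hu0 : Tendsto (fun Y : ℝ => u Y) atTop (𝓝 0) := by
    have := hinvT.smul hT
    rw [zero_smul] at this
    refine this.congr' ?_
    filter_upwards [hlin.eventually_gt_atTop 0] with Y hY
    rw [smul_smul, inv_mul_cancel₀ (by exact_mod_cast hY.ne'), one_smul]
  have hhT : Tendsto (fun Y : ℝ => ((X + Y : ℝ) : ℂ) * M.h (u Y)) atTop (𝓝 1) := by
    rw [← hv]
    exact M.tendsto_mul_h hT hu0
  have hwT : Tendsto (fun Y : ℝ => w Y / ((X + Y : ℝ) : ℂ)) atTop (𝓝 1) := by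
    have := hhT.inv₀ one_ne_zero
    rw [inv_one] at this
    refine this.congr fun Y => ?_
    simp only [hw, mul_inv]
    rw [div_eq_inv_mul]
  have hratio : Tendsto (fun Y : ℝ => ((X + Y : ℝ) : ℂ) / (Y : ℂ)) atTop (𝓝 1) := by
    have h1 : Tendsto (fun Y : ℝ => (X : ℂ) * ((Y : ℂ))⁻¹ + 1) atTop (𝓝 ((X : ℂ) * 0 + 1)) :=
      (tendsto_ofReal_inv_atTop.const_mul (X : ℂ)).add_const 1
    rw [mul_zero, zero_add] at h1
    refine h1.congr' ?_
    filter_upwards [eventually_gt_atTop 0] with Y hY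
    have : (Y : ℂ) ≠ 0 := by exact_mod_cast hY.ne'
    push_cast; field_simp
  have hwY : Tendsto (fun Y : ℝ => w Y / (Y : ℂ)) atTop (𝓝 1) := by
    have := hwT.mul hratio
    rw [one_mul] at this
    refine this.congr' ?_
    filter_upwards [hlin.eventually_gt_atTop 0] with Y hY
    have : ((X + Y : ℝ) : ℂ) ≠ 0 := by exact_mod_cast hY.ne'
    field_simp
  have hsT : Tendsto (fun Y : ℝ => w Y • u Y) atTop (𝓝 v) := by
    have := hwT.smul hT
    rw [one_smul] at this
    refine this.congr' ?_
    filter_upwards [hlin.eventually_gt_atTop 0] with Y hY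
    have : ((X + Y : ℝ) : ℂ) ≠ 0 := by exact_mod_cast hY.ne'
    rw [smul_smul, div_mul_cancel₀ _ this]
  have hflim : Tendsto (fun Y : ℝ => f Y / (Y : ℂ)) atTop (𝓝 ((1 : ℝ) : ℂ)) := by
    have h1 : Tendsto (fun Y : ℝ => inner ℂ a (w Y • u Y)) atTop (𝓝 (inner ℂ a v)) :=
      ((innerSL ℂ a).continuous.tendsto v).comp hsT
    have h2 := (hwY.sub ((h1.const_mul (2 * (M.c : ℂ))).mul tendsto_ofReal_inv_atTop)).add
      (tendsto_ofReal_inv_atTop.const_mul ((M.c : ℂ) * (‖a‖ : ℂ) ^ 2))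
    simp only [mul_zero, sub_zero, add_zero] at h2
    rw [ofReal_one]
    refine h2.congr fun Y => ?_
    simp only [hf, div_eq_mul_inv]
    ring
  have hJ := julia_rightHP hfd hfnn one_pos hflim hy₀m
  rw [hfre, ← ha, sub_self, norm_zero, hwre, ha, hsn] at hJ
  have huy : u y₀ = G (disc p v x) - p := by simp [hu, hy₀]
  have hpos : 0 < ‖M.h (u y₀)‖ ^ 2 := by
    have := norm_pos_iff.mpr (hune y₀ hy₀m); positivity
  have hy₀re : y₀.re = x.re - X := by simp [hy₀]
  rw [← huy]
  rw [hy₀re] at hJ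
  have e : (M.h (u y₀)).re / ‖M.h (u y₀)‖ ^ 2 - M.c * (‖u y₀‖ ^ 2 / ‖M.h (u y₀)‖ ^ 2) + M.c * 0 ^ 2 =
    ((M.h (u y₀)).re - M.c * ‖u y₀‖ ^ 2) / ‖M.h (u y₀)‖ ^ 2 := by ring
  rw [e, one_mul, le_div_iff₀ hpos] at hJ
  exact hJ

end LocalModel

end

section

variable {n : ℕ} {Ω : Set (En n)} {p : En n}

namespace LocalModel

theorem exists_halfplane_localized (M : LocalModel Ω p) {G : En n → En n}
    (hG : TangentMap Ω p G) {v : En n} {X₀ : ℝ} (hX₀ : 0 ≤ X₀)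
    (hmem : ∀ x : ℂ, X₀ < x.re → disc p v x ∈ Ω) :
    ∃ X, X₀ ≤ X ∧ ∀ x : ℂ, X < x.re → ‖G (disc p v x) - p‖ < M.ε := by
  obtain ⟨δ, hδ, hb⟩ := hG.tangent 1 one_pos
  have hε := M.ε_pos
  set d := min δ (M.ε / 2) with hd
  have hd0 : 0 < d := lt_min hδ (by positivity)
  refine ⟨max X₀ (‖v‖ / d), le_max_left _ _, fun x hx => ?_⟩
  have h1 : X₀ < x.re := (le_max_left _ _).trans_lt hx
  have h2 : ‖v‖ / d < x.re := (le_max_right _ _).trans_lt hx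
  have hxn : 0 < ‖x‖ := (hX₀.trans_lt h1).trans_le (re_le_norm x)
  have hn : ‖disc p v x - p‖ < d := by
    rw [disc_sub, norm_smul, norm_inv, inv_mul_eq_div, div_lt_iff₀ hxn]
    rw [div_lt_iff₀ hd0] at h2
    nlinarith [re_le_norm x]
  have h3 := hb _ (hmem x h1) (hn.trans_le (min_le_left _ _))
  have h4 : ‖disc p v x - p‖ < M.ε / 2 := hn.trans_le (min_le_right _ _)
  calc ‖G (disc p v x) - p‖ ≤ ‖G (disc p v x) - disc p v x‖ + ‖disc p v x - p‖ :=
        norm_sub_le_norm_sub_add_norm_sub _ _ _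
    _ < M.ε := by linarith

/-- Uniform Julia inequality along linear discs, for all maps tangent to the identity. -/
theorem exists_julia (M : LocalModel Ω p) (hbd : Bornology.IsBounded Ω) (hp : p ∉ Ω) :
    ∃ K > 0, ∀ G, TangentMap Ω p G → ∀ v : En n, M.ℓ v = 1 → ∀ x : ℂ, K * ‖v‖ ^ 2 < x.re →
      disc p v x ∈ Ω ∧ ‖G (disc p v x) - p‖ < M.ε ∧
      (x.re - K * ‖v‖ ^ 2) * ‖M.h (G (disc p v x) - p)‖ ^ 2 ≤
        (M.h (G (disc p v x) - p)).re - M.c * ‖G (disc p v x) - p‖ ^ 2 := by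
  obtain ⟨ε₁, hε₁, -, hloc⟩ := M.exists_localization hbd
  have hc := M.c_pos
  have hC := M.C_pos
  have hε := M.ε_pos
  set K₁ := M.C + ‖M.B‖ + ‖M.ℓ‖ / M.ε with hK₁
  have hK₁0 : 0 < K₁ := by positivity
  set K₂ := 1 / (M.c * ε₁ ^ 2) with hK₂
  have hK₂0 : 0 < K₂ := by positivity
  refine ⟨K₁ + 2 * K₂ * ‖M.ℓ‖ ^ 2, by positivity, fun G hG v hv x hx => ?_⟩
  set X₀ := K₁ * ‖v‖ ^ 2 with hX₀
  have hX₀0 : 0 ≤ X₀ := by positivity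
  have hmem : ∀ y : ℂ, X₀ < y.re → disc p v y ∈ Ω := fun y hy => M.disc_mem hv hy
  set 𝒳 : Set ℝ := {X | X₀ ≤ X ∧ ∀ y : ℂ, X < y.re → ‖G (disc p v y) - p‖ < M.ε} with h𝒳
  obtain ⟨X', hX'⟩ := M.exists_halfplane_localized hG hX₀0 hmem
  have hne : 𝒳.Nonempty := ⟨X', hX'⟩
  have hbb : BddBelow 𝒳 := ⟨X₀, fun X hX => hX.1⟩
  have hjul : ∀ X ∈ 𝒳, ∀ y : ℂ, X < y.re →
      (y.re - X) * ‖M.h (G (disc p v y) - p)‖ ^ 2 ≤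
        (M.h (G (disc p v y) - p)).re - M.c * ‖G (disc p v y) - p‖ ^ 2 := fun X hX y hy =>
    M.julia_of_localized hp hG hv (hX₀0.trans hX.1) (fun y hy => hmem y (hX.1.trans_lt hy)) hX.2 hy
  have hclose : ∀ X ∈ 𝒳, ∀ y : ℂ, X + K₂ ≤ y.re → ‖G (disc p v y) - p‖ < ε₁ := by
    intro X hX y hy
    by_contra hcon
    push Not at hcon
    have h1 := hjul X hX y (by linarith)
    set H := M.h (G (disc p v y) - p) with hH
    have h2 : M.c * ε₁ ^ 2 ≤ M.c * ‖G (disc p v y) - p‖ ^ 2 := by gcongr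
    have h3 := re_le_norm H
    have h4 : K₂ * ‖H‖ ^ 2 ≤ (y.re - X) * ‖H‖ ^ 2 := by gcongr; linarith
    have h5 : K₂ * (M.c * ε₁ ^ 2) = 1 := by rw [hK₂]; field_simp
    have h6 : 0 < M.c * ε₁ ^ 2 := by positivity
    have h7 : M.c * ε₁ ^ 2 + K₂ * ‖H‖ ^ 2 ≤ ‖H‖ := by linarith
    have h8 : M.c * ε₁ ^ 2 ≤ ‖H‖ := by nlinarith [sq_nonneg ‖H‖]
    nlinarith [mul_le_mul_of_nonneg_left h8 (mul_nonneg hK₂0.le (norm_nonneg H))]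
  have hstep : ∀ X ∈ 𝒳, (X + K₂ + X₀) / 2 ∈ 𝒳 := by
    intro X hX
    refine ⟨by linarith [hX.1], fun y hy => ?_⟩
    rcases lt_or_ge X y.re with h | h
    · exact hX.2 y h
    set R : ℝ := X + K₂ - X₀ with hR
    have hR0 : 0 < R := by linarith [hX.1]
    set xc : ℂ := ((X + K₂ : ℝ) : ℂ) + y.im * I with hxc
    have hxcre : xc.re = X + K₂ := by simp [hxc]
    have hre : ∀ ζ : ℂ, ‖ζ‖ < 1 → X₀ < (xc + R * ζ).re := by
      intro ζ hζ
      rw [add_re, hxcre, re_ofReal_mul]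
      have := (abs_le.mp (abs_re_le_norm ζ)).1
      nlinarith
    have hd : DifferentiableOn ℂ (fun ζ : ℂ => G (disc p v (xc + R * ζ))) (ball 0 1) := by
      intro ζ hζ
      rw [mem_ball_zero_iff] at hζ
      have hne : xc + R * ζ ≠ 0 := fun h0 => by
        have h1 := hre ζ hζ
        rw [h0, zero_re] at h1; linarith
      have h1 : DifferentiableWithinAt ℂ (fun ζ : ℂ => disc p v (xc + R * ζ)) (ball 0 1) ζ :=
        ((differentiableAt_disc p v hne).comp ζ
          ((differentiableAt_id.const_mul (R : ℂ)).const_add xc)).differentiableWithinAt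
      exact DifferentiableWithinAt.comp ζ (t := Ω) (hG.diff _ (hmem _ (hre ζ hζ))) h1
        (fun ζ' hζ' => hmem _ (hre ζ' (by rwa [mem_ball_zero_iff] at hζ')))
    have h0 := hloc (fun ζ : ℂ => G (disc p v (xc + R * ζ))) hd
      (fun ζ hζ => hG.maps (hmem _ (hre ζ (by rwa [mem_ball_zero_iff] at hζ))))
      (by simpa using hclose X hX xc hxcre.ge)
      (((y.re - (X + K₂)) / R : ℝ) : ℂ) (by
        rw [norm_real, Real.norm_eq_abs, abs_le]
        constructor
        · rw [le_div_iff₀ hR0]; linarith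
        · rw [div_le_iff₀ hR0]; linarith)
    have e : xc + R * (((y.re - (X + K₂)) / R : ℝ) : ℂ) = y := by
      rw [← ofReal_mul, mul_div_cancel₀ _ hR0.ne', hxc]
      apply Complex.ext <;> simp
    simpa only [e] using h0
  have hinf : sInf 𝒳 ≤ X₀ + K₂ := by
    have h1 : ∀ X ∈ 𝒳, 2 * sInf 𝒳 - K₂ - X₀ ≤ X := fun X hX => by
      have := csInf_le hbb (hstep X hX); linarith
    have := le_csInf hne h1
    linarith
  obtain ⟨X, hX, hXlt⟩ := exists_lt_of_csInf_lt hne (show sInf 𝒳 < X₀ + 2 * K₂ by linarith)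
  have h1 : 1 ≤ ‖M.ℓ‖ ^ 2 * ‖v‖ ^ 2 := by
    rw [← mul_pow]; exact one_le_pow₀ (M.one_le_norm hv)
  have h2 : X ≤ (K₁ + 2 * K₂ * ‖M.ℓ‖ ^ 2) * ‖v‖ ^ 2 := by
    have : (K₁ + 2 * K₂ * ‖M.ℓ‖ ^ 2) * ‖v‖ ^ 2 = X₀ + 2 * K₂ * (‖M.ℓ‖ ^ 2 * ‖v‖ ^ 2) := by
      rw [hX₀]; ring
    rw [this]; nlinarith
  have h3 : X < x.re := h2.trans_lt hx
  refine ⟨hmem x (hX.1.trans_lt h3), hX.2 x h3, le_trans ?_ (hjul X hX x h3)⟩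
  gcongr

end LocalModel

end

section

variable {n : ℕ}

/-- Pairs of holomorphic functions on the right half-plane satisfying a Julia inequality with a
quadratic remainder. -/
structure JuliaPair (c : ℝ) (q : ℂ → ℂ) (σ : ℂ → En n) : Prop where
  diff_q : DifferentiableOn ℂ q rightHP
  diff_σ : DifferentiableOn ℂ σ rightHP
  le : ∀ y ∈ rightHP, c * ‖σ y‖ ^ 2 + y.re ≤ (q y).re

theorem one_mem_rightHP : (1 : ℂ) ∈ rightHP := by show 0 < (1 : ℂ).re; simp

theorem ofReal_mul_mem_rightHP {x : ℝ} (hx : 0 < x) {y : ℂ} (hy : y ∈ rightHP) :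
    (x : ℂ) * y ∈ rightHP := by
  show 0 < ((x : ℂ) * y).re
  rw [re_ofReal_mul]; exact mul_pos hx hy

theorem ofReal_mem_rightHP {x : ℝ} (hx : 0 < x) : (x : ℂ) ∈ rightHP := by
  show 0 < (x : ℂ).re
  simpa using hx

namespace JuliaPair

variable {c : ℝ} {q : ℂ → ℂ} {σ : ℂ → En n}

theorem re_le (h : JuliaPair c q σ) (hc : 0 ≤ c) {y : ℂ} (hy : y ∈ rightHP) : y.re ≤ (q y).re := by
  have := h.le y hy
  have : 0 ≤ c * ‖σ y‖ ^ 2 := by positivity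
  linarith

theorem re_nonneg (h : JuliaPair c q σ) (hc : 0 ≤ c) {y : ℂ} (hy : y ∈ rightHP) : 0 ≤ (q y).re :=
  le_trans (le_of_lt hy) (h.re_le hc hy)

theorem rescale (h : JuliaPair c q σ) {x : ℝ} (hx : 0 < x) :
    JuliaPair c (fun y => q (x * y) / x) (fun y => (((√x)⁻¹ : ℝ) : ℂ) • σ (x * y)) := by
  have hm : MapsTo (fun y : ℂ => (x : ℂ) * y) rightHP rightHP :=
    fun y hy => ofReal_mul_mem_rightHP hx hy
  have hl : DifferentiableOn ℂ (fun y : ℂ => (x : ℂ) * y) rightHP :=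
    (differentiable_id.const_mul (x : ℂ)).differentiableOn
  refine ⟨(h.diff_q.comp hl hm).div_const _, (h.diff_σ.comp hl hm).fun_const_smul _, fun y hy => ?_⟩
  have h1 := h.le _ (hm hy)
  have h2 : (q (x * y) / x).re = (q (x * y)).re / x := div_ofReal_re _ _
  rw [h2, norm_smul, norm_real, mul_pow, norm_inv, inv_pow, Real.norm_of_nonneg (Real.sqrt_nonneg x),
    Real.sq_sqrt hx.le, le_div_iff₀ hx]
  simp only [re_ofReal_mul] at h1
  calc (c * (x⁻¹ * ‖σ (x * y)‖ ^ 2) + y.re) * x = c * ‖σ (x * y)‖ ^ 2 + x * y.re := by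
        field_simp
    _ ≤ _ := h1

/-- The a priori bound for a Julia pair. -/
def bound (M : ℝ) (y : ℂ) : ℝ := M + ‖y + 1‖ ^ 2 * M / y.re

theorem norm_q_le (h : JuliaPair c q σ) (hc : 0 ≤ c) {M : ℝ} (hM : ‖q 1‖ ≤ M) {y : ℂ}
    (hy : y ∈ rightHP) : ‖q y‖ ≤ bound M y := by
  have hy0 : 0 < y.re := hy
  have h1 := growth_rightHP h.diff_q (fun _ hy => h.re_nonneg hc hy) hy one_mem_rightHP
  rw [map_one, one_re, mul_one] at h1
  have h2 : ‖q y - q 1‖ ≤ ‖y + 1‖ ^ 2 * M / y.re := by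
    rw [le_div_iff₀ hy0]
    refine h1.trans ?_
    gcongr
    exact (re_le_norm _).trans hM
  have := norm_le_norm_add_norm_sub' (q y) (q 1)
  unfold bound
  linarith

theorem norm_rescale_one_le (h : JuliaPair c q σ) (hc : 0 ≤ c) {M : ℝ} (hM : ‖q 1‖ ≤ M) {x : ℝ}
    (hx : 1 ≤ x) : ‖q (x * 1) / x‖ ≤ 5 * M := by
  have hx0 : 0 < x := by linarith
  have hM0 : 0 ≤ M := (norm_nonneg _).trans hM
  have h1 := h.norm_q_le hc hM (ofReal_mem_rightHP hx0)
  rw [mul_one, norm_div, norm_real, Real.norm_of_nonneg hx0.le, div_le_iff₀ hx0]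
  refine h1.trans ?_
  unfold bound
  rw [ofReal_re]
  have h2 : ‖(x : ℂ) + 1‖ ≤ 2 * x := by
    refine (norm_add_le _ _).trans ?_
    rw [norm_real, norm_one, Real.norm_of_nonneg hx0.le]; linarith
  have h3 : ‖(x : ℂ) + 1‖ ^ 2 * M / x ≤ (2 * x) ^ 2 * M / x := by gcongr
  have h4 : (2 * x) ^ 2 * M / x = 4 * M * x := by field_simp; ring
  nlinarith

theorem norm_σ_le (h : JuliaPair c q σ) (hc : 0 < c) {M : ℝ} (hM : ‖q 1‖ ≤ M) {y : ℂ}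
    (hy : y ∈ rightHP) : ‖σ y‖ ≤ √(bound M y / c) := by
  have hy0 : 0 < y.re := hy
  refine Real.le_sqrt_of_sq_le ?_
  rw [le_div_iff₀ hc]
  have h1 := h.le y hy
  have h2 := (re_le_norm _).trans (h.norm_q_le hc.le hM hy)
  linarith

theorem exists_local_bound {M : ℝ} (hM : 0 ≤ M) {y : ℂ} (hy : y ∈ rightHP) :
    ∃ R > 0, ∃ N, ball y R ⊆ rightHP ∧ ∀ y' ∈ ball y R, bound M y' ≤ N := by
  have hy0 : 0 < y.re := hy
  have key : ∀ y' ∈ ball y (y.re / 2), y.re / 2 ≤ y'.re ∧ ‖y' + 1‖ ≤ ‖y + 1‖ + y.re / 2 := by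
    intro y' hy'
    rw [mem_ball, dist_eq_norm] at hy'
    have h1 := (abs_le.mp ((abs_re_le_norm (y' - y)).trans hy'.le)).1
    rw [sub_re] at h1
    refine ⟨by linarith, ?_⟩
    have : y' + 1 = (y + 1) + (y' - y) := by ring
    rw [this]
    exact (norm_add_le _ _).trans (by linarith)
  refine ⟨y.re / 2, by positivity, M + (‖y + 1‖ + y.re / 2) ^ 2 * M / (y.re / 2), fun y' hy' => ?_,
    fun y' hy' => ?_⟩
  · show 0 < y'.re
    linarith [(key y' hy').1]
  · obtain ⟨h1, h2⟩ := key y' hy'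
    unfold bound
    gcongr

/-- Ultralimits of Julia pairs. -/
theorem exists_limit {ι : Type*} (U : Ultrafilter ι) {q : ι → ℂ → ℂ} {σ : ι → ℂ → En n}
    (hc : 0 < c) {M : ℝ} (h : ∀ᶠ i in (U : Filter ι), JuliaPair c (q i) (σ i) ∧ ‖q i 1‖ ≤ M) :
    ∃ V S, JuliaPair c V S ∧ ∀ y ∈ rightHP, Tendsto (fun i => q i y) U (𝓝 (V y)) ∧
      Tendsto (fun i => σ i y) U (𝓝 (S y)) := by
  obtain ⟨i₀, -, hi₀⟩ := h.exists
  have hM : 0 ≤ M := (norm_nonneg _).trans hi₀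
  have hq : ∀ y ∈ rightHP, Tendsto (fun i => q i y) U (𝓝 (limUnder (U : Filter ι) fun i => q i y)) :=
    fun y hy => tendsto_ultrafilter_limUnder U
      (h.mono fun i hi => hi.1.norm_q_le hc.le hi.2 hy)
  have hσ : ∀ y ∈ rightHP, Tendsto (fun i => σ i y) U (𝓝 (limUnder (U : Filter ι) fun i => σ i y)) :=
    fun y hy => tendsto_ultrafilter_limUnder U
      (h.mono fun i hi => hi.1.norm_σ_le hc hi.2 hy)
  refine ⟨fun y => limUnder (U : Filter ι) fun i => q i y,
    fun y => limUnder (U : Filter ι) fun i => σ i y, ⟨fun y hy => ?_, fun y hy => ?_, fun y hy => ?_⟩,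
    fun y hy => ⟨hq y hy, hσ y hy⟩⟩
  · obtain ⟨R, hR, N, hsub, hN⟩ := exists_local_bound hM hy
    refine (differentiableAt_ultrafilter_limit U (M := N) hR (h.mono fun i hi => hi.1.diff_q.mono hsub)
      (h.mono fun i hi y' hy' => (hi.1.norm_q_le hc.le hi.2 (hsub hy')).trans (hN y' hy'))
      (fun y' hy' => hq y' (hsub hy'))).differentiableWithinAt
  · obtain ⟨R, hR, N, hsub, hN⟩ := exists_local_bound hM hy
    refine (differentiableAt_ultrafilter_limit U (M := √(N / c)) hR
      (h.mono fun i hi => hi.1.diff_σ.mono hsub)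
      (h.mono fun i hi y' hy' => (hi.1.norm_σ_le hc hi.2 (hsub hy')).trans
        (Real.sqrt_le_sqrt (by have := hN y' hy'; gcongr)))
      (fun y' hy' => hσ y' (hsub hy'))).differentiableWithinAt
  · have h1 := (((hσ y hy).norm.pow 2).const_mul c).add_const y.re
    have h2 := (continuous_re.tendsto _).comp (hq y hy)
    exact le_of_tendsto_of_tendsto h1 h2 (h.mono fun i hi => hi.1.le y hy)

/-- Rigidity: if the real part is linear on `(0, 1]` the pair is trivial. -/
theorem rigid (h : JuliaPair c q σ) (hc : 0 < c) {b : ℝ}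
    (hb : ∀ y : ℝ, 0 < y → y ≤ 1 → (q y).re = b * y) {y : ℂ} (hy : y ∈ rightHP) :
    q y = b * y + I * (q 1).im ∧ σ y = 0 := by
  have hq : ∀ y ∈ rightHP, q y = b * y + I * (q 1).im := fun y hy =>
    rigidity_rightHP h.diff_q (fun y hy => h.re_nonneg hc.le hy) hb hy
  refine ⟨hq y hy, ?_⟩
  ext j
  refine eq_zero_of_sq_norm_le_re (σ := fun y => σ y j) (C := b / c) ?_ (fun y hy => ?_) hy
  · exact (EuclideanSpace.proj (𝕜 := ℂ) j).differentiable.comp_differentiableOn h.diff_σ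
  · have h1 := h.le y hy
    have h2 : (q y).re = b * y.re := by
      rw [hq y hy]; simp
    have hy0 : 0 < y.re := hy
    have h3 : ‖σ y j‖ ≤ ‖σ y‖ := PiLp.norm_apply_le (σ y) j
    have h4 : ‖σ y j‖ ^ 2 ≤ ‖σ y‖ ^ 2 := by gcongr
    rw [div_mul_eq_mul_div, le_div_iff₀ hc]
    nlinarith

theorem harnack (h : JuliaPair c q σ) (hc : 0 ≤ c) {y x : ℝ} (hy : 0 < y) (hyx : y ≤ x) :
    y * (q x).re ≤ x * (q y).re :=
  harnack_real_rightHP h.diff_q (fun _ hy => h.re_nonneg hc hy) hy hyx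

end JuliaPair

/-- For a Julia pair the quadratic term is negligible at infinity along some ultrafilter. -/
theorem JuliaPair.not_sq_bound {c : ℝ} {q : ℂ → ℂ} {σ : ℂ → En n} (h : JuliaPair c q σ) (hc : 0 < c)
    (C : ℝ) : ¬ ∀ᶠ x : ℝ in atTop, (q x).re ≤ C * ‖σ x‖ ^ 2 := by
  intro hcon
  set U : Ultrafilter ℝ := Ultrafilter.of atTop with hU
  have hUle : (U : Filter ℝ) ≤ atTop := Ultrafilter.of_le _
  have hpos : ∀ᶠ x in (U : Filter ℝ), 1 ≤ x := hUle (eventually_ge_atTop 1)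
  have hbd : ∀ᶠ x : ℝ in (U : Filter ℝ),
      JuliaPair c (fun y => q (x * y) / x) (fun y => (((√x)⁻¹ : ℝ) : ℂ) • σ (x * y)) ∧
        ‖q (x * 1) / x‖ ≤ 5 * ‖q 1‖ := by
    filter_upwards [hpos] with x hx
    have hx0 : 0 < x := by linarith
    exact ⟨h.rescale hx0, h.norm_rescale_one_le hc.le le_rfl hx⟩
  obtain ⟨V, S, hVS, hlim⟩ := JuliaPair.exists_limit U hc hbd
  set f : ℝ → ℝ := fun x => (q x).re / x with hf
  have hanti : AntitoneOn f (Ici 1) := by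
    intro a ha b hb hab
    have ha0 : (0 : ℝ) < a := lt_of_lt_of_le one_pos ha
    have hb0 : (0 : ℝ) < b := lt_of_lt_of_le one_pos hb
    have := h.harnack hc.le ha0 hab
    simp only [hf]
    rw [div_le_div_iff₀ hb0 ha0]
    linarith
  obtain ⟨b, hb⟩ : ∃ b, Tendsto f atTop (𝓝 b) := by
    set g : ℝ → ℝ := fun x => f (max x 1) with hg
    have hga : Antitone g := fun x y hxy =>
      hanti (mem_Ici.mpr (le_max_right _ _)) (mem_Ici.mpr (le_max_right _ _)) (max_le_max_right 1 hxy)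
    have hgb : BddBelow (range g) := by
      refine ⟨0, ?_⟩
      rintro _ ⟨x, rfl⟩
      have h1 : 0 < max x 1 := lt_max_of_lt_right one_pos
      exact div_nonneg (h.re_nonneg hc.le (ofReal_mem_rightHP h1)) h1.le
    refine ⟨_, (tendsto_atTop_ciInf hga hgb).congr' ?_⟩
    filter_upwards [eventually_ge_atTop 1] with x hx
    simp only [hg, max_eq_left hx]
  have hVb : ∀ y : ℝ, 0 < y → y ≤ 1 → (V y).re = b * y := by
    intro y hy _
    have h1 := (continuous_re.tendsto _).comp (hlim y (ofReal_mem_rightHP hy)).1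
    have h2 : Tendsto (fun x : ℝ => f (x * y) * y) U (𝓝 (b * y)) :=
      ((hb.comp (tendsto_id.atTop_mul_const hy)).mono_left hUle).mul_const y
    refine tendsto_nhds_unique h1 (h2.congr' ?_)
    filter_upwards [hpos] with x hx
    have hx0 : x ≠ 0 := by linarith
    simp only [hf, Function.comp_apply, div_ofReal_re, ofReal_mul]
    field_simp
  have hS := (hVS.rigid hc hVb one_mem_rightHP).2
  have h1 := ((hlim 1 one_mem_rightHP).2.norm.pow 2).const_mul C
  rw [hS, norm_zero] at h1
  have h2 : (1 : ℝ) ≤ C * 0 ^ 2 := by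
    refine ge_of_tendsto h1 ?_
    filter_upwards [hpos, hUle hcon] with x hx hx'
    have hx0 : 0 < x := by linarith
    have h3 := h.re_le hc.le (ofReal_mem_rightHP hx0)
    rw [ofReal_re] at h3
    rw [mul_one, norm_smul, norm_real, mul_pow, norm_inv, inv_pow,
      Real.norm_of_nonneg (Real.sqrt_nonneg x), Real.sq_sqrt hx0.le]
    have : C * (x⁻¹ * ‖σ x‖ ^ 2) = (C * ‖σ x‖ ^ 2) / x := by field_simp
    rw [this, le_div_iff₀ hx0]
    linarith
  norm_num at h2

end

section

variable {n : ℕ} {Ω : Set (En n)} {p : En n}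

namespace LocalModel

/-- The uniform Julia inequality with constant `K`. -/
def Julia (M : LocalModel Ω p) (K : ℝ) : Prop :=
  0 < K ∧ ∀ G, TangentMap Ω p G → ∀ v : En n, M.ℓ v = 1 → ∀ x : ℂ, K * ‖v‖ ^ 2 < x.re →
    disc p v x ∈ Ω ∧ ‖G (disc p v x) - p‖ < M.ε ∧
    (x.re - K * ‖v‖ ^ 2) * ‖M.h (G (disc p v x) - p)‖ ^ 2 ≤
      (M.h (G (disc p v x) - p)).re - M.c * ‖G (disc p v x) - p‖ ^ 2

/-- The reciprocal of the local peak function. -/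
def w (M : LocalModel Ω p) (z : En n) : ℂ := (M.h (z - p))⁻¹

/-- The rescaled displacement from `p`. -/
def s (M : LocalModel Ω p) (z : En n) : En n := M.w z • (z - p)

/-- The linear disc through `p` in direction `v₀`, parametrised by the right half-plane. -/
def ray (M : LocalModel Ω p) (K : ℝ) (y : ℂ) : En n := disc p M.v₀ ((K * ‖M.v₀‖ ^ 2 : ℝ) + y)

theorem h_re_pos_of_ineq (M : LocalModel Ω p) {u : En n} (hu : u ≠ 0) {t : ℝ} (ht : 0 ≤ t)
    (h : t * ‖M.h u‖ ^ 2 ≤ (M.h u).re - M.c * ‖u‖ ^ 2) : 0 < (M.h u).re := by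
  have h1 : 0 < M.c * ‖u‖ ^ 2 := mul_pos M.c_pos (by have := norm_pos_iff.mpr hu; positivity)
  have h2 : 0 ≤ t * ‖M.h u‖ ^ 2 := by positivity
  linarith

theorem norm_h_pos_of_re (M : LocalModel Ω p) {u : En n} (h : 0 < (M.h u).re) : 0 < ‖M.h u‖ :=
  h.trans_le (re_le_norm _)

theorem w_re (M : LocalModel Ω p) (z : En n) :
    (M.w z).re = (M.h (z - p)).re / ‖M.h (z - p)‖ ^ 2 := by
  simp only [w, inv_re, normSq_eq_norm_sq]

theorem norm_s_sq (M : LocalModel Ω p) (z : En n) :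
    ‖M.s z‖ ^ 2 = ‖z - p‖ ^ 2 / ‖M.h (z - p)‖ ^ 2 := by
  simp only [s, w, norm_smul, norm_inv]
  rw [mul_pow, inv_pow, div_eq_inv_mul]

theorem juliaPair_of_ineq (M : LocalModel Ω p) {g : ℂ → En n} (hg : DifferentiableOn ℂ g rightHP)
    (hne : ∀ y ∈ rightHP, g y ≠ p)
    (hle : ∀ y ∈ rightHP, y.re * ‖M.h (g y - p)‖ ^ 2 ≤ (M.h (g y - p)).re - M.c * ‖g y - p‖ ^ 2) :
    JuliaPair M.c (fun y => M.w (g y)) (fun y => M.s (g y)) := by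
  have hpos : ∀ y ∈ rightHP, 0 < ‖M.h (g y - p)‖ := fun y hy =>
    M.norm_h_pos_of_re (M.h_re_pos_of_ineq (sub_ne_zero.mpr (hne y hy)) (le_of_lt hy) (hle y hy))
  have hd : DifferentiableOn ℂ (fun y => M.w (g y)) rightHP :=
    (M.differentiable_h.comp_differentiableOn (hg.sub_const p)).inv
      fun y hy => norm_pos_iff.mp (hpos y hy)
  refine ⟨hd, hd.smul (hg.sub_const p), fun y hy => ?_⟩
  have h0 := hpos y hy
  rw [w_re, norm_s_sq, le_div_iff₀ (by positivity)]
  have : (M.c * (‖g y - p‖ ^ 2 / ‖M.h (g y - p)‖ ^ 2) + y.re) * ‖M.h (g y - p)‖ ^ 2 =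
      M.c * ‖g y - p‖ ^ 2 + y.re * ‖M.h (g y - p)‖ ^ 2 := by field_simp
  rw [this]
  linarith [hle y hy]

section Ray

variable {M : LocalModel Ω p} {K : ℝ}

theorem Julia.lt_re (_hK : M.Julia K) {y : ℂ} (hy : y ∈ rightHP) :
    K * ‖M.v₀‖ ^ 2 < (((K * ‖M.v₀‖ ^ 2 : ℝ) : ℂ) + y).re := by
  have : 0 < y.re := hy
  rw [add_re, ofReal_re]; linarith

theorem Julia.ray_mem (hK : M.Julia K) {y : ℂ} (hy : y ∈ rightHP) : M.ray K y ∈ Ω :=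
  (hK.2 _ TangentMap.id _ M.ℓ_v₀ _ (hK.lt_re hy)).1

theorem Julia.near (hK : M.Julia K) {G : En n → En n} (hG : TangentMap Ω p G) {y : ℂ}
    (hy : y ∈ rightHP) : ‖G (M.ray K y) - p‖ < M.ε :=
  (hK.2 _ hG _ M.ℓ_v₀ _ (hK.lt_re hy)).2.1

theorem Julia.ineq (hK : M.Julia K) {G : En n → En n} (hG : TangentMap Ω p G) {y : ℂ}
    (hy : y ∈ rightHP) : y.re * ‖M.h (G (M.ray K y) - p)‖ ^ 2 ≤
      (M.h (G (M.ray K y) - p)).re - M.c * ‖G (M.ray K y) - p‖ ^ 2 := by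
  have := (hK.2 _ hG _ M.ℓ_v₀ _ (hK.lt_re hy)).2.2
  rwa [add_re, ofReal_re, add_sub_cancel_left] at this

theorem Julia.differentiableOn_ray (hK : M.Julia K) : DifferentiableOn ℂ (M.ray K) rightHP := by
  intro y hy
  have hne : ((K * ‖M.v₀‖ ^ 2 : ℝ) : ℂ) + y ≠ 0 := fun h0 => by
    have h1 := hK.lt_re hy
    rw [h0, zero_re] at h1
    have : 0 ≤ K * ‖M.v₀‖ ^ 2 := mul_nonneg hK.1.le (by positivity)
    linarith
  exact ((differentiableAt_disc p M.v₀ hne).comp y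
    ((differentiableAt_id).const_add ((K * ‖M.v₀‖ ^ 2 : ℝ) : ℂ))).differentiableWithinAt

theorem Julia.differentiableOn_comp_ray (hK : M.Julia K) {G : En n → En n}
    (hG : DifferentiableOn ℂ G Ω) : DifferentiableOn ℂ (fun y => G (M.ray K y)) rightHP :=
  hG.comp hK.differentiableOn_ray fun _ hy => hK.ray_mem hy

theorem Julia.juliaPair (hK : M.Julia K) (hp : p ∉ Ω) {G : En n → En n} (hG : TangentMap Ω p G) :
    JuliaPair M.c (fun y => M.w (G (M.ray K y))) (fun y => M.s (G (M.ray K y))) :=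
  M.juliaPair_of_ineq (hK.differentiableOn_comp_ray hG.diff)
    (fun _ hy h => hp (h ▸ hG.maps (hK.ray_mem hy))) fun _ hy => hK.ineq hG hy

end Ray

end LocalModel

theorem iterate_add_apply' {α : Type*} (F : α → α) (m k : ℕ) (z : α) :
    F^[m] (F^[k] z) = F^[m + k] z := (iterate_add_apply F m k z).symm

section Dynamics

variable {F : En n → En n}

theorem not_mem_of_mem_frontier (hΩ : IsOpen Ω) (hp : p ∈ frontier Ω) : p ∉ Ω := fun h => by
  rw [hΩ.frontier_eq] at hp; exact hp.2 h

/-- An orbit which does not accumulate at `p` only cannot accumulate at another boundary point. -/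
theorem mem_of_tendsto_orbit {ρ : En n → ℝ} (hρ : IsPcxCinfBoundary Ω ρ) (hΩ : IsOpen Ω)
    (hΩc : IsPreconnected Ω) (hbd : Bornology.IsBounded Ω) {M : LocalModel Ω p} {K : ℝ}
    (hK : M.Julia K) (hF : TangentMap Ω p F) {U : Ultrafilter ℕ} {b : En n}
    (hb : Tendsto (fun m => F^[m] (M.ray K 1)) U (𝓝 b)) (hbp : b ≠ p) : b ∈ Ω := by
  by_contra hbΩ
  obtain ⟨N, hN⟩ := hbd.exists_norm_le
  have hFm := fun m => hF.iterate m
  have hd : ∀ m, DifferentiableOn ℂ F^[m] Ω := fun m => (hFm m).diff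
  have hM : ∀ m, ∀ z ∈ Ω, ‖F^[m] z‖ ≤ N := fun m z hz => hN _ ((hFm m).maps hz)
  set g : En n → En n := ulim U (fun m => F^[m]) with hg
  have hgd : DifferentiableOn ℂ g Ω := differentiableOn_ulim hΩ hd hM
  have hgt : ∀ z ∈ Ω, Tendsto (fun m => F^[m] z) U (𝓝 (g z)) := fun z hz =>
    tendsto_ulim (f := fun m => F^[m]) (Eventually.of_forall fun m => hM m z hz)
  have hgm : MapsTo g Ω (closure Ω) := fun z hz =>
    ulim_mem_closure (fun m => hM m z hz) (fun m => (hFm m).maps hz)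
  have ha := hK.ray_mem one_mem_rightHP
  have hga : g (M.ray K 1) = b := tendsto_nhds_unique (hgt _ ha) hb
  have hfr : g (M.ray K 1) ∈ frontier Ω := by
    rw [hΩ.frontier_eq]
    exact ⟨hgm ha, by rwa [hga]⟩
  have hall := mapsTo_frontier_of_touching hρ hΩ hΩc hgd hgm ha hfr
  have hne : ∀ z ∈ Ω, g z ≠ p := fun z hz hzp =>
    hbp (hga ▸ M.eqOn_of_attains hΩ hΩc hgd hgm hz hzp _ ha)
  have hineq : ∀ y ∈ rightHP, y.re * ‖M.h (g (M.ray K y) - p)‖ ^ 2 ≤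
      (M.h (g (M.ray K y) - p)).re - M.c * ‖g (M.ray K y) - p‖ ^ 2 := by
    intro y hy
    have h1 : Tendsto (fun m => F^[m] (M.ray K y) - p) U (𝓝 (g (M.ray K y) - p)) :=
      (hgt _ (hK.ray_mem hy)).sub_const p
    have h2 := (M.differentiable_h.continuous.tendsto _).comp h1
    exact le_of_tendsto_of_tendsto' ((h2.norm.pow 2).const_mul y.re)
      (((continuous_re.tendsto _).comp h2).sub ((h1.norm.pow 2).const_mul M.c))
      fun m => hK.ineq (hFm m) hy
  have hpair := M.juliaPair_of_ineq (hK.differentiableOn_comp_ray hgd)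
    (fun y hy => hne _ (hK.ray_mem hy)) hineq
  have hc := M.c_pos
  have hε := M.ε_pos
  refine hpair.not_sq_bound hc M.C ?_
  filter_upwards [eventually_gt_atTop 0, eventually_gt_atTop (1 / (4 * (M.c * M.ε ^ 2)))] with x hx hx'
  have hxm := ofReal_mem_rightHP hx
  have h1 := hineq x hxm
  rw [ofReal_re] at h1
  set u := g (M.ray K x) - p with hu
  have hu0 : u ≠ 0 := sub_ne_zero.mpr (hne _ (hK.ray_mem hxm))
  have hre := M.h_re_pos_of_ineq hu0 hx.le h1
  have hn := M.norm_h_pos_of_re hre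
  have huε : ‖u‖ < M.ε := by
    by_contra hcon
    push Not at hcon
    have h2 : M.c * M.ε ^ 2 ≤ M.c * ‖u‖ ^ 2 := by gcongr
    have h3 := re_le_norm (M.h u)
    rw [div_lt_iff₀ (by positivity)] at hx'
    have h4 : M.c * M.ε ^ 2 + x * ‖M.h u‖ ^ 2 ≤ ‖M.h u‖ := by linarith
    nlinarith [sq_nonneg (2 * x * ‖M.h u‖ - 1), mul_le_mul_of_nonneg_left h4 hx.le]
  rw [LocalModel.w_re, LocalModel.norm_s_sq, ← mul_div_assoc]
  rw [← hu]
  gcongr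
  by_contra hcon
  push Not at hcon
  have h5 := M.upper u huε hcon
  rw [hu, add_sub_cancel] at h5
  exact not_mem_of_mem_frontier hΩ (hall _ (hK.ray_mem hxm)) h5

set_option maxHeartbeats 1000000 in
/-- If an orbit has a limit point in `Ω`, it stays away from every exterior point. -/
theorem exists_gap (hΩ : IsOpen Ω) (hbd : Bornology.IsBounded Ω) (hp : p ∉ Ω)
    (hF : DifferentiableOn ℂ F Ω) (hm : MapsTo F Ω Ω) {a b : En n} (ha : a ∈ Ω) (hb : b ∈ Ω)
    {U : Ultrafilter ℕ} (hU : (U : Filter ℕ) ≤ atTop)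
    (hlim : Tendsto (fun m => F^[m] a) U (𝓝 b)) : ∃ d > 0, ∀ m, d ≤ ‖F^[m] a - p‖ := by
  obtain ⟨N, hN⟩ := hbd.exists_norm_le
  have hmm : ∀ m, MapsTo F^[m] Ω Ω := fun m => hm.iterate m
  have hdm : ∀ m, DifferentiableOn ℂ F^[m] Ω := fun m => by
    induction m with
    | zero => exact differentiableOn_id
    | succ k ih => rw [iterate_succ]; exact ih.comp hF hm
  have hN0 : 0 ≤ N := (norm_nonneg a).trans (hN a ha)
  obtain ⟨r₀, hr₀, hsub⟩ := Metric.isOpen_iff.mp hΩ b hb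
  set r := r₀ / 3 with hr
  have hr0 : 0 < r := by positivity
  have hKsub : closedBall b r ⊆ Ω := (closedBall_subset_ball (by linarith)).trans hsub
  have hball : ∀ z ∈ closedBall b r, ball z r ⊆ Ω := fun z hz =>
    (ball_subset_ball' (by rw [mem_closedBall] at hz; linarith)).trans hsub
  set δ := min r (r * r / (4 * (N + 1))) with hδ
  have hδ0 : 0 < δ := lt_min hr0 (by positivity)
  have hvisit : ∀ j, ∃ m > j, ‖F^[m] a - b‖ < r / 2 := by
    intro j
    have h1 := (Metric.tendsto_nhds.mp hlim) (r / 2) (by positivity)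
    obtain ⟨m, hm1, hm2⟩ := (h1.and (hU (eventually_gt_atTop j))).exists
    exact ⟨m, hm2, by rwa [dist_eq_norm] at hm1⟩
  choose ν hν hνr using hvisit
  obtain ⟨t, htfin, htsub⟩ : ∃ t : Set ℕ, t.Finite ∧ ∀ j, F^[j] a ∈ closedBall b r →
      ∃ i ∈ t, F^[i] a ∈ closedBall b r ∧ ‖F^[j] a - F^[i] a‖ < δ := by
    have htb : TotallyBounded ((fun j => F^[j] a) '' {j | F^[j] a ∈ closedBall b r}) :=
      (isCompact_closedBall b r).totallyBounded.subset (by rintro _ ⟨j, hj, rfl⟩; exact hj)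
    obtain ⟨t', ht's, ht'f, ht'c⟩ := Metric.finite_approx_of_totallyBounded htb δ hδ0
    have ht'' : ∀ z, z ∈ t' → ∃ i, F^[i] a ∈ closedBall b r ∧ F^[i] a = z := fun z hz => ht's hz
    choose! φ hφ1 hφ2 using ht''
    refine ⟨φ '' t', ht'f.image φ, fun j hj => ?_⟩
    have := ht'c ⟨j, hj, rfl⟩
    simp only [mem_iUnion, mem_ball, exists_prop] at this
    obtain ⟨z, hz, hjz⟩ := this
    refine ⟨φ z, ⟨z, hz, rfl⟩, hφ1 z hz, ?_⟩
    have h2 : F^[φ z] a = z := hφ2 z hz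
    rw [h2, ← dist_eq_norm]; exact hjz
  obtain ⟨L, hL'⟩ := (htfin.image ν).bddAbove
  have hL : ∀ i ∈ t, ν i ≤ L := fun i hi => hL' ⟨i, hi, rfl⟩
  have hret : ∀ j, F^[j] a ∈ closedBall b r → ∃ m > j, m ≤ j + L ∧ F^[m] a ∈ closedBall b r := by
    intro j hj
    obtain ⟨i, hit, hi, hji⟩ := htsub j hj
    have hi' := hν i
    have hiL := hL i hit
    refine ⟨j + (ν i - i), by omega, by omega, ?_⟩
    have e1 : F^[j + (ν i - i)] a = F^[ν i - i] (F^[j] a) := by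
      rw [iterate_add_apply', add_comm]
    have e2 : F^[ν i] a = F^[ν i - i] (F^[i] a) := by
      rw [iterate_add_apply']; congr 1; omega
    have h3 := norm_sub_le_of_bounded_holo ((hdm (ν i - i)).mono (hball _ hi))
      (fun y hy => hN _ (hmm _ (hball _ hi hy)))
      (y := F^[j] a) (by rw [mem_ball, dist_eq_norm]; exact hji.trans_le (min_le_left _ _))
    rw [← e1, ← e2] at h3
    have h4 : 2 * N / r * ‖F^[j] a - F^[i] a‖ ≤ r / 2 := by
      have h5 : ‖F^[j] a - F^[i] a‖ ≤ r * r / (4 * (N + 1)) := hji.le.trans (min_le_right _ _)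
      calc 2 * N / r * ‖F^[j] a - F^[i] a‖ ≤ 2 * N / r * (r * r / (4 * (N + 1))) := by gcongr
        _ = r / 2 * (N / (N + 1)) := by field_simp; ring
        _ ≤ r / 2 * 1 := by gcongr; rw [div_le_one (by positivity)]; linarith
        _ = r / 2 := mul_one _
    rw [mem_closedBall, dist_eq_norm]
    have := norm_sub_le_norm_sub_add_norm_sub (F^[j + (ν i - i)] a) (F^[ν i] a) b
    linarith [hνr i]
  have hn₀ : F^[ν 0] a ∈ closedBall b r := by
    rw [mem_closedBall, dist_eq_norm]; linarith [hνr 0]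
  have hcover : ∀ m, ν 0 ≤ m → ∃ j ≤ m, m ≤ j + L ∧ F^[j] a ∈ closedBall b r := by
    intro m hm
    induction m, hm using Nat.le_induction with
    | base => exact ⟨ν 0, le_rfl, by omega, hn₀⟩
    | succ m hm ih =>
      obtain ⟨j, hjm, hmj, hj⟩ := ih
      rcases Nat.lt_or_ge m (j + L) with h | h
      · exact ⟨j, by omega, by omega, hj⟩
      · obtain ⟨m', h1, h2, h3⟩ := hret j hj
        exact ⟨m', by omega, by omega, h3⟩
  set Q : Set (En n) := (⋃ k ∈ Finset.range (L + 1), F^[k] '' closedBall b r) ∪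
    (fun m => F^[m] a) '' (Finset.range (ν 0) : Set ℕ) with hQ
  have hQc : IsCompact Q := by
    refine ((Finset.range (L + 1)).isCompact_biUnion fun k _ =>
      (isCompact_closedBall b r).image_of_continuousOn ((hdm k).continuousOn.mono hKsub)).union ?_
    exact ((Finset.range (ν 0)).finite_toSet.image _).isCompact
  have hQΩ : Q ⊆ Ω := by
    refine union_subset ?_ ?_
    · refine iUnion₂_subset fun k _ => ?_
      rintro _ ⟨z, hz, rfl⟩
      exact hmm k (hKsub hz)
    · rintro _ ⟨m, _, rfl⟩
      exact hmm m ha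
  have hQm : ∀ m, F^[m] a ∈ Q := by
    intro m
    rcases lt_or_ge m (ν 0) with h | h
    · exact Or.inr ⟨m, by simpa using h, rfl⟩
    · obtain ⟨j, hjm, hmj, hj⟩ := hcover m h
      refine Or.inl (mem_biUnion (x := m - j) (by simp; omega) ⟨F^[j] a, hj, ?_⟩)
      rw [iterate_add_apply']; congr 1; omega
  obtain ⟨d, hd, hdb⟩ := Metric.isOpen_iff.mp hQc.isClosed.isOpen_compl p fun h => hp (hQΩ h)
  refine ⟨d, hd, fun m => ?_⟩
  by_contra hcon
  push Not at hcon
  exact hdb (by rwa [mem_ball, dist_eq_norm]) (hQm m)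

/-- Convergence of one orbit to `p` forces locally uniform convergence. -/
theorem tendstoUniformlyOn_of_tendsto_orbit (hΩ : IsOpen Ω)
    (hΩc : IsPreconnected Ω) (hbd : Bornology.IsBounded Ω) (M : LocalModel Ω p)
    (hF : TangentMap Ω p F) {a : En n} (ha : a ∈ Ω)
    (hlim : Tendsto (fun m => F^[m] a) atTop (𝓝 p)) {Q : Set (En n)} (hQ : Q ⊆ Ω)
    (hQc : IsCompact Q) : TendstoUniformlyOn (fun m => F^[m]) (fun _ => p) atTop Q := by
  obtain ⟨N, hN⟩ := hbd.exists_norm_le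
  have hFm := fun m => hF.iterate m
  have hd : ∀ m, DifferentiableOn ℂ F^[m] Ω := fun m => (hFm m).diff
  have hM : ∀ m, ∀ z ∈ Ω, ‖F^[m] z‖ ≤ N := fun m z hz => hN _ ((hFm m).maps hz)
  rw [Metric.tendstoUniformlyOn_iff]
  intro ε hε
  by_contra hcon
  rw [not_eventually] at hcon
  have hcon' : ∃ᶠ m in atTop, ∃ z ∈ Q, ε ≤ dist p (F^[m] z) := hcon.mono fun m hm => by
    push Not at hm; exact hm
  set 𝓕 : Filter ℕ := atTop ⊓ 𝓟 {m | ∃ z ∈ Q, ε ≤ dist p (F^[m] z)} with h𝓕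
  have hne : NeBot 𝓕 := frequently_mem_iff_neBot.mp hcon'
  set U : Ultrafilter ℕ := Ultrafilter.of 𝓕 with hU
  have hUle : (U : Filter ℕ) ≤ 𝓕 := Ultrafilter.of_le _
  have hUS : ∀ᶠ m in (U : Filter ℕ), ∃ z ∈ Q, ε ≤ dist p (F^[m] z) :=
    hUle (mem_inf_of_right (mem_principal_self _))
  have hUt : (U : Filter ℕ) ≤ atTop := hUle.trans inf_le_left
  obtain ⟨m₀, z₀, hz₀, -⟩ := hUS.exists
  have hzex : ∀ m, ∃ z ∈ Q, (∃ z ∈ Q, ε ≤ dist p (F^[m] z)) → ε ≤ dist p (F^[m] z) := fun m => by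
    by_cases h : ∃ z ∈ Q, ε ≤ dist p (F^[m] z)
    · obtain ⟨z, hz, hz'⟩ := h
      exact ⟨z, hz, fun _ => hz'⟩
    · exact ⟨z₀, hz₀, fun h' => absurd h' h⟩
  choose z hzQ hz using hzex
  obtain ⟨z', hz'Q, hz'⟩ := hQc.ultrafilter_le_nhds' (U.map z)
    (Eventually.of_forall hzQ : ∀ᶠ m in (U : Filter ℕ), z m ∈ Q)
  set g : En n → En n := ulim U (fun m => F^[m]) with hg
  have hgd : DifferentiableOn ℂ g Ω := differentiableOn_ulim hΩ hd hM
  have hgm : MapsTo g Ω (closure Ω) := fun z hz =>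
    ulim_mem_closure (fun m => hM m z hz) (fun m => (hFm m).maps hz)
  have hga : g a = p := tendsto_nhds_unique
    (tendsto_ulim (f := fun m => F^[m]) (Eventually.of_forall fun m => hM m a ha))
    (hlim.mono_left hUt)
  have hgz := M.eqOn_of_attains hΩ hΩc hgd hgm ha hga z' (hQ hz'Q)
  have h1 : Tendsto (fun m => F^[m] (z m)) U (𝓝 p) := by
    rw [← hgz]
    exact tendsto_ulim_moving (f := fun m => F^[m]) hΩ hd hM (hQ hz'Q) hz'
  obtain ⟨m, hm1, hm2⟩ := ((Metric.tendsto_nhds.mp h1 ε hε).and hUS).exists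
  have := hz m hm2
  rw [dist_comm] at this
  linarith

end Dynamics

end

section

variable {n : ℕ} {Ω : Set (En n)} {p : En n}

namespace LocalModel

variable {M : LocalModel Ω p} {K : ℝ}

theorem Julia.exists_ball (hK : M.Julia K) {κ : ℝ} (hκ : 0 < κ) :
    ∃ r > 0, ∃ X > 0, ∀ x : ℂ, κ * ‖x‖ ≤ x.re → X ≤ ‖x‖ → ∀ z,
      ‖x * M.ℓ (z - disc p M.v₀ x)‖ < r → ‖x‖ * ‖z - disc p M.v₀ x‖ ^ 2 < r ^ 2 → z ∈ Ω ∧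
      ∀ G, TangentMap Ω p G → ‖G z - p‖ < M.ε ∧
        κ / 4 * ‖x‖ * ‖M.h (G z - p)‖ ^ 2 ≤ (M.h (G z - p)).re - M.c * ‖G z - p‖ ^ 2 := by
  obtain ⟨hK0, hJ⟩ := hK
  set r := min (min (κ / 16) (1 / 2)) (√(κ / (32 * K))) with hr
  have hr0 : 0 < r := lt_min (lt_min (by positivity) (by norm_num)) (by positivity)
  have hr1 : r ≤ κ / 16 := (min_le_left _ _).trans (min_le_left _ _)
  have hr2 : r ≤ 1 / 2 := (min_le_left _ _).trans (min_le_right _ _)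
  have hr3 : K * r ^ 2 ≤ κ / 32 := by
    have : r ^ 2 ≤ κ / (32 * K) := by
      calc r ^ 2 ≤ √(κ / (32 * K)) ^ 2 := by gcongr; exact min_le_right _ _
        _ = _ := Real.sq_sqrt (by positivity)
    rw [le_div_iff₀ (by positivity)] at this
    linarith
  refine ⟨r, hr0, max 1 (32 * K * ‖M.v₀‖ ^ 2 / κ), by positivity, fun x hx hX z hz1 hz2 => ?_⟩
  have hx1 : 1 ≤ ‖x‖ := (le_max_left _ _).trans hX
  have hx2 : 32 * K * ‖M.v₀‖ ^ 2 ≤ κ * ‖x‖ := by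
    have := (le_max_right _ _).trans hX
    rw [div_le_iff₀ hκ] at this; linarith
  have hxn : 0 < ‖x‖ := by linarith
  have hx0 : x ≠ 0 := norm_pos_iff.mp hxn
  set η := x * M.ℓ (z - disc p M.v₀ x) with hη
  have hd : 1 / 2 ≤ ‖1 + η‖ := by
    have := norm_sub_le_norm_add (1 : ℂ) η
    rw [norm_one] at this; linarith
  have hd0 : 1 + η ≠ 0 := norm_pos_iff.mp (by linarith)
  set x' := x / (1 + η) with hx'
  have hx'0 : x' ≠ 0 := div_ne_zero hx0 hd0
  set v := x' • (z - p) with hv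
  have hzp : z - p = (z - disc p M.v₀ x) + x⁻¹ • M.v₀ := by rw [← disc_sub p M.v₀ x]; abel
  have hℓ : M.ℓ v = 1 := by
    rw [hv, map_smul, hzp, map_add, map_smul, M.ℓ_v₀, smul_eq_mul, smul_eq_mul, hx']
    have : M.ℓ (z - disc p M.v₀ x) = η / x := by rw [hη]; field_simp
    rw [this]; field_simp
    ring
  have hdisc : disc p v x' = z := by
    rw [disc, hv, smul_smul, inv_mul_cancel₀ hx'0, one_smul, add_sub_cancel]
  have hx'n : ‖x'‖ ≤ 2 * ‖x‖ := by
    rw [hx', norm_div, div_le_iff₀ (by linarith)]; nlinarith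
  have hx're : 7 / 8 * κ * ‖x‖ ≤ x'.re := by
    have e : x' = x - x * η / (1 + η) := by rw [hx']; field_simp; ring
    have h1 : ‖x * η / (1 + η)‖ ≤ κ / 8 * ‖x‖ := by
      rw [norm_div, norm_mul, div_le_iff₀ (by linarith)]
      nlinarith [mul_pos hκ hxn]
    have h2 := (re_le_norm _).trans h1
    rw [e, sub_re]; linarith
  have hvn : ‖v‖ ≤ 2 * (‖x‖ * ‖z - disc p M.v₀ x‖ + ‖M.v₀‖) := by
    have h1 : ‖z - p‖ ≤ ‖z - disc p M.v₀ x‖ + ‖M.v₀‖ / ‖x‖ := by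
      rw [hzp]
      refine (norm_add_le _ _).trans ?_
      rw [norm_smul, norm_inv, inv_mul_eq_div]
    rw [hv, norm_smul]
    calc ‖x'‖ * ‖z - p‖ ≤ 2 * ‖x‖ * (‖z - disc p M.v₀ x‖ + ‖M.v₀‖ / ‖x‖) := by gcongr
      _ = _ := by field_simp
  have hKv : K * ‖v‖ ^ 2 ≤ κ / 2 * ‖x‖ := by
    have h1 : ‖v‖ ^ 2 ≤ 8 * (‖x‖ * (‖x‖ * ‖z - disc p M.v₀ x‖ ^ 2) + ‖M.v₀‖ ^ 2) := by
      calc ‖v‖ ^ 2 ≤ (2 * (‖x‖ * ‖z - disc p M.v₀ x‖ + ‖M.v₀‖)) ^ 2 := by gcongr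
        _ ≤ _ := by nlinarith [sq_nonneg (‖x‖ * ‖z - disc p M.v₀ x‖ - ‖M.v₀‖)]
    have h2 : ‖x‖ * (‖x‖ * ‖z - disc p M.v₀ x‖ ^ 2) ≤ ‖x‖ * r ^ 2 := by gcongr
    have h3 : K * ‖v‖ ^ 2 ≤ K * (8 * (‖x‖ * r ^ 2 + ‖M.v₀‖ ^ 2)) := by
      gcongr; linarith
    nlinarith
  have hlt : K * ‖v‖ ^ 2 < x'.re := by nlinarith [mul_pos hκ hxn]
  have hJ' := fun G hG => hJ G hG v hℓ x' hlt
  rw [hdisc] at hJ'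
  refine ⟨(hJ' _ TangentMap.id).1, fun G hG => ⟨(hJ' G hG).2.1, le_trans ?_ (hJ' G hG).2.2⟩⟩
  gcongr
  nlinarith [mul_pos hκ hxn]

end LocalModel

end

section

variable {n : ℕ} {Ω : Set (En n)} {p : En n}

namespace LocalModel

variable {M : LocalModel Ω p} {K : ℝ}

/-- Harnack comparison along a complex line through the centre of a region of `exists_ball`. -/
theorem norm_w_sub_le (hp : p ∉ Ω) {G : En n → En n} (hG : TangentMap Ω p G) {z₀ z₁ : En n} {R : ℝ}
    (hR : 1 < R) (hin : ∀ t ∈ ball (0 : ℂ) R, z₀ + t • (z₁ - z₀) ∈ Ω ∧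
      0 ≤ (M.h (G (z₀ + t • (z₁ - z₀)) - p)).re - M.c * ‖G (z₀ + t • (z₁ - z₀)) - p‖ ^ 2) :
    ‖M.w (G z₁) - M.w (G z₀)‖ * (R - 1) ≤ 2 * (M.w (G z₀)).re := by
  set l : ℂ → En n := fun t => z₀ + t • (z₁ - z₀) with hl
  have hld : Differentiable ℂ l := (differentiable_id.smul_const _).const_add _
  have hre : ∀ t ∈ ball (0 : ℂ) R, 0 < (M.h (G (l t) - p)).re := fun t ht => by
    refine M.h_re_pos_of_ineq (sub_ne_zero.mpr fun h => hp (h ▸ hG.maps (hin t ht).1)) le_rfl ?_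
    rw [zero_mul]; exact (hin t ht).2
  have hGd : DifferentiableOn ℂ (fun t => G (l t)) (ball 0 R) :=
    hG.diff.comp hld.differentiableOn fun t ht => (hin t ht).1
  have hkd : DifferentiableOn ℂ (fun t => M.w (G (l t))) (ball 0 R) :=
    (M.differentiable_h.comp_differentiableOn (hGd.sub_const p)).inv
      fun t ht => norm_pos_iff.mp (M.norm_h_pos_of_re (hre t ht))
  have hk0 : ∀ t ∈ ball (0 : ℂ) R, 0 ≤ (M.w (G (l t))).re := fun t ht => by
    rw [M.w_re]; have := hre t ht; positivity
  have h1 := norm_sub_le_re_disc hkd hk0 (x := 1) (by rw [mem_ball_zero_iff, norm_one]; exact hR)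
  have e1 : l 1 = z₁ := by simp [hl]
  have e0 : l 0 = z₀ := by simp [hl]
  simpa only [e1, e0, sub_zero, norm_one, mul_one] using h1

theorem h_smul_s {z : En n} (hw : M.w z ≠ 0) : M.h (z - p) • M.s z = z - p := by
  have : M.h (z - p) ≠ 0 := fun h => hw (by rw [w, h, inv_zero])
  rw [s, w, smul_smul, mul_inv_cancel₀ this, one_smul]

/-- Rescaled limits of the inverse coordinate translate into limits of the coordinates. -/
theorem tendsto_coords {ι : Type*} {U : Filter ι} {z : ι → En n} {x : ι → ℝ}
    (hx : Tendsto x U atTop) {Y : ℂ} (hY0 : Y ≠ 0)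
    (hq : Tendsto (fun i => M.w (z i) / x i) U (𝓝 Y))
    (hs : Tendsto (fun i => (((√(x i))⁻¹ : ℝ) : ℂ) • M.s (z i)) U (𝓝 0)) :
    Tendsto (fun i => ((√(x i) : ℝ) : ℂ) • (z i - p)) U (𝓝 0) ∧
      Tendsto (fun i => (x i : ℂ) * M.ℓ (z i - p)) U (𝓝 Y⁻¹) := by
  have hxpos : ∀ᶠ i in U, 0 < x i := hx.eventually_gt_atTop 0
  have hwne : ∀ᶠ i in U, M.w (z i) ≠ 0 := by
    filter_upwards [hq.eventually_ne hY0] with i hi h0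
    rw [h0, zero_div] at hi; exact hi rfl
  set u : ι → En n := fun i => z i - p with hu
  have hxh : Tendsto (fun i => (x i : ℂ) * M.h (u i)) U (𝓝 Y⁻¹) := by
    refine (hq.inv₀ hY0).congr fun i => ?_
    simp only [w, hu, div_eq_mul_inv, mul_inv, inv_inv]
    ring
  have hsu : Tendsto (fun i => ((√(x i) : ℝ) : ℂ) • u i) U (𝓝 0) := by
    have h1 := hxh.smul hs
    rw [smul_zero] at h1
    refine h1.congr' ?_
    filter_upwards [hxpos, hwne] with i hi hwi
    have e := h_smul_s hwi
    have hsq : ((√(x i) : ℝ) : ℂ) ≠ 0 := by exact_mod_cast (Real.sqrt_pos.mpr hi).ne'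
    have hxx : (x i : ℂ) = ((√(x i) : ℝ) : ℂ) * ((√(x i) : ℝ) : ℂ) := by
      exact_mod_cast (Real.mul_self_sqrt hi.le).symm
    rw [hu]
    simp only
    rw [← e, smul_smul, smul_smul, e]
    congr 1
    rw [ofReal_inv, hxx]
    field_simp
  have hBu : Tendsto (fun i => (x i : ℂ) * M.B (u i) (u i)) U (𝓝 0) := by
    have h1 := (isBoundedBilinearMap_apply.continuous.tendsto (M.B 0, (0 : En n))).comp
      (((M.B.continuous.tendsto 0).comp hsu).prodMk_nhds hsu)
    simp only [map_zero] at h1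
    refine h1.congr' ?_
    filter_upwards [hxpos] with i hi
    have hxx : (x i : ℂ) = ((√(x i) : ℝ) : ℂ) * ((√(x i) : ℝ) : ℂ) := by
      exact_mod_cast (Real.mul_self_sqrt hi.le).symm
    simp only [Function.comp_apply, map_smul, _root_.smul_apply, smul_eq_mul]
    rw [hxx]; ring
  have hxℓ : Tendsto (fun i => (x i : ℂ) * M.ℓ (u i)) U (𝓝 Y⁻¹) := by
    have h1 := hxh.sub hBu
    rw [sub_zero] at h1
    refine h1.congr fun i => ?_
    simp only [h]; ring
  exact ⟨hsu, hxℓ⟩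

set_option maxHeartbeats 1000000 in
/-- Composition rule for the rescaled limits. -/
theorem Julia.tendsto_comp (hK : M.Julia K) (hp : p ∉ Ω) {ι : Type*} {U : Filter ι}
    {G : ι → En n → En n} (hG : ∀ i, TangentMap Ω p (G i)) {z : ι → En n} {x : ι → ℝ}
    (hx : Tendsto x U atTop) {Y W : ℂ} (hY : Y ∈ rightHP)
    (hq : Tendsto (fun i => M.w (z i) / x i) U (𝓝 Y))
    (hs : Tendsto (fun i => (((√(x i))⁻¹ : ℝ) : ℂ) • M.s (z i)) U (𝓝 0))
    (hW : Tendsto (fun i => M.w (G i (M.ray K (x i * Y))) / x i) U (𝓝 W)) :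
    Tendsto (fun i => M.w (G i (z i)) / x i) U (𝓝 W) := by
  have hYre : 0 < Y.re := hY
  have hY0 : Y ≠ 0 := fun h => by rw [h, zero_re] at hYre; exact lt_irrefl _ hYre
  have hYn : 0 < ‖Y‖ := norm_pos_iff.mpr hY0
  set X' : ℝ := K * ‖M.v₀‖ ^ 2 with hX'
  have hX'0 : 0 ≤ X' := mul_nonneg hK.1.le (by positivity)
  have hxpos : ∀ᶠ i in U, 0 < x i := hx.eventually_gt_atTop 0
  have hxinv : Tendsto (fun i => ((x i : ℂ))⁻¹) U (𝓝 0) := tendsto_ofReal_inv_atTop.comp hx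
  -- the parameter of the centre
  set c : ι → ℂ := fun i => (X' : ℂ) + x i * Y with hc
  have hcx : Tendsto (fun i => c i / x i) U (𝓝 Y) := by
    have h1 : Tendsto (fun i => (X' : ℂ) * (x i : ℂ)⁻¹ + Y) U (𝓝 ((X' : ℂ) * 0 + Y)) :=
      (hxinv.const_mul _).add_const _
    rw [mul_zero, zero_add] at h1
    refine h1.congr' ?_
    filter_upwards [hxpos] with i hi
    have : (x i : ℂ) ≠ 0 := by exact_mod_cast hi.ne'
    simp only [hc]; field_simp
  have hcn : ∀ᶠ i in U, x i * ‖Y‖ / 2 ≤ ‖c i‖ ∧ ‖c i‖ ≤ 2 * (x i * ‖Y‖) := by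
    have h1 := hcx.norm
    filter_upwards [hxpos, h1.eventually_const_lt (show ‖Y‖ / 2 < ‖Y‖ by linarith),
      h1.eventually_lt_const (show ‖Y‖ < 2 * ‖Y‖ by linarith)] with i hi h2 h3
    rw [norm_div, norm_real, Real.norm_of_nonneg hi.le] at h2 h3
    rw [lt_div_iff₀ hi] at h2
    rw [div_lt_iff₀ hi] at h3
    constructor <;> linarith
  have hcinf : Tendsto (fun i => ‖c i‖) U atTop := by
    refine tendsto_atTop_mono' U (hcn.mono fun i hi => hi.1) ?_
    have := hx.atTop_mul_const (show 0 < ‖Y‖ / 2 by positivity)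
    refine this.congr fun i => by ring
  have hc0 : ∀ᶠ i in U, c i ≠ 0 := (hcinf.eventually_gt_atTop 0).mono fun i hi => norm_pos_iff.mp hi
  set u : ι → En n := fun i => z i - p with hu
  obtain ⟨hsu, hxℓ⟩ : Tendsto (fun i => ((√(x i) : ℝ) : ℂ) • u i) U (𝓝 0) ∧
      Tendsto (fun i => (x i : ℂ) * M.ℓ (u i)) U (𝓝 Y⁻¹) := tendsto_coords hx hY0 hq hs
  set φ : ι → En n := fun i => disc p M.v₀ (c i) with hφ
  have hzφ : ∀ i, z i - φ i = u i - (c i)⁻¹ • M.v₀ := fun i => by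
    rw [hu, hφ]; simp only; rw [← disc_sub p M.v₀ (c i)]; abel
  have hA : Tendsto (fun i => c i * M.ℓ (z i - φ i)) U (𝓝 0) := by
    have h1 := (hcx.mul hxℓ).sub_const 1
    rw [mul_inv_cancel₀ hY0, sub_self] at h1
    refine h1.congr' ?_
    filter_upwards [hxpos, hc0] with i hi hci
    have : (x i : ℂ) ≠ 0 := by exact_mod_cast hi.ne'
    have e : M.ℓ (z i - φ i) = M.ℓ (u i) - (c i)⁻¹ := by
      rw [hzφ, map_sub M.ℓ (u i), map_smul, M.ℓ_v₀, smul_eq_mul, mul_one]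
    rw [e]
    field_simp
  have hB : Tendsto (fun i => ‖c i‖ * ‖z i - φ i‖ ^ 2) U (𝓝 0) := by
    have h2 : Tendsto (fun i => (((√(x i) : ℝ) : ℂ) * (c i)⁻¹) • M.v₀) U (𝓝 0) := by
      have h3 : Tendsto (fun i => (((√(x i))⁻¹ : ℝ) : ℂ) * (c i / x i)⁻¹) U (𝓝 (0 * Y⁻¹)) := by
        refine Tendsto.mul ?_ (hcx.inv₀ hY0)
        have h4 : Tendsto (fun i => √(x i)) U atTop := Real.tendsto_sqrt_atTop.comp hx
        have := tendsto_ofReal_inv_atTop.comp h4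
        refine this.congr fun i => by simp
      rw [zero_mul] at h3
      have h5 := h3.smul_const M.v₀
      rw [zero_smul] at h5
      refine h5.congr' ?_
      filter_upwards [hxpos, hc0] with i hi hci
      have hsq : ((√(x i) : ℝ) : ℂ) ≠ 0 := by exact_mod_cast (Real.sqrt_pos.mpr hi).ne'
      have hxx : (x i : ℂ) = ((√(x i) : ℝ) : ℂ) * ((√(x i) : ℝ) : ℂ) := by
        exact_mod_cast (Real.mul_self_sqrt hi.le).symm
      congr 1
      rw [ofReal_inv, inv_div, hxx]
      field_simp
    have h6 := (hsu.sub h2).norm.pow 2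
    have h7 := hcx.norm.mul h6
    simp only [sub_zero, norm_zero, ne_eq, OfNat.ofNat_ne_zero, not_false_eq_true, zero_pow,
      mul_zero] at h7
    refine h7.congr' ?_
    filter_upwards [hxpos] with i hi
    rw [hzφ, mul_smul, ← smul_sub, norm_smul, norm_div, norm_real, norm_real,
      Real.norm_of_nonneg hi.le, Real.norm_of_nonneg (Real.sqrt_nonneg _), mul_pow,
      Real.sq_sqrt hi.le]
    field_simp
  set κ : ℝ := Y.re / ‖Y‖ with hκ
  have hκ0 : 0 < κ := by positivity
  have hκ1 : κ ≤ 1 := by rw [hκ, div_le_one hYn]; exact re_le_norm Y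
  have hκc : ∀ᶠ i in U, κ * ‖c i‖ ≤ (c i).re := by
    filter_upwards [hxpos] with i hi
    have h1 : ‖c i‖ ≤ X' + x i * ‖Y‖ := by
      refine (norm_add_le _ _).trans ?_
      rw [norm_mul, norm_real, norm_real, Real.norm_of_nonneg hi.le, Real.norm_of_nonneg hX'0]
    have h2 : (c i).re = X' + x i * Y.re := by simp [hc]
    have h3 : κ * ‖Y‖ = Y.re := by rw [hκ]; field_simp
    rw [h2]
    nlinarith [mul_le_mul_of_nonneg_left h1 hκ0.le]
  obtain ⟨r, hr, X, hX, hball⟩ := hK.exists_ball hκ0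
  have hdiff : Tendsto (fun i => M.w (G i (z i)) / x i - M.w (G i (φ i)) / x i) U (𝓝 0) := by
    rw [Metric.tendsto_nhds]
    intro ε hε
    set R : ℝ := 1 + (2 * (‖W‖ + 1)) / (ε / 2) with hR
    have hR1 : 1 < R := by rw [hR]; have : 0 < (2 * (‖W‖ + 1)) / (ε / 2) := by positivity
                           linarith
    have hWb := hW.norm.eventually_lt_const (show ‖W‖ < ‖W‖ + 1 by linarith)
    have hA' := hA.norm.eventually_lt_const
      (show ‖(0 : ℂ)‖ < r / R by rw [norm_zero]; positivity)
    have hB' := hB.eventually_lt_const (show (0 : ℝ) < r ^ 2 / R ^ 2 by positivity)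
    filter_upwards [hxpos, hWb, hA', hB', hκc, hcinf.eventually_ge_atTop X] with i hi h1 h2 h3 h4 h5
    rw [lt_div_iff₀ (by positivity)] at h2 h3
    have hin : ∀ t ∈ ball (0 : ℂ) R, φ i + t • (z i - φ i) ∈ Ω ∧
        0 ≤ (M.h (G i (φ i + t • (z i - φ i)) - p)).re -
          M.c * ‖G i (φ i + t • (z i - φ i)) - p‖ ^ 2 := by
      intro t ht
      rw [mem_ball_zero_iff] at ht
      have e : φ i + t • (z i - φ i) - disc p M.v₀ (c i) = t • (z i - φ i) := add_sub_cancel_left _ _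
      obtain ⟨h6, h7⟩ := hball (c i) h4 h5 (φ i + t • (z i - φ i)) (by
        rw [e, map_smul, smul_eq_mul, ← mul_assoc, mul_comm (c i) t, mul_assoc, norm_mul]
        nlinarith [norm_nonneg (c i * M.ℓ (z i - φ i))]) (by
        rw [e, norm_smul, mul_pow]
        have h8 : ‖t‖ ^ 2 ≤ R ^ 2 := by gcongr
        have h9 : 0 ≤ ‖c i‖ * ‖z i - φ i‖ ^ 2 := by positivity
        nlinarith [mul_le_mul_of_nonneg_right h8 h9])
      refine ⟨h6, le_trans ?_ (h7 (G i) (hG i)).2⟩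
      positivity
    have h10 := norm_w_sub_le hp (hG i) hR1 hin
    have hφr : φ i = M.ray K (x i * Y) := rfl
    rw [← hφr] at h1
    rw [norm_div, norm_real, Real.norm_of_nonneg hi.le, div_lt_iff₀ hi] at h1
    rw [dist_zero_right, ← sub_div, norm_div, norm_real, Real.norm_of_nonneg hi.le, div_lt_iff₀ hi]
    have h11 := re_le_norm (M.w (G i (φ i)))
    have h12 : R - 1 = (2 * (‖W‖ + 1)) / (ε / 2) := by rw [hR]; ring
    rw [h12, mul_div_assoc', div_le_iff₀ (by positivity)] at h10
    have h13 : ‖M.w (G i (z i)) - M.w (G i (φ i))‖ * (2 * (‖W‖ + 1)) ≤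
        (ε / 2 * x i) * (2 * (‖W‖ + 1)) := by nlinarith
    have h14 := le_of_mul_le_mul_right h13 (by positivity)
    nlinarith [mul_pos hε hi]
  have := hdiff.add hW
  rw [zero_add] at this
  refine this.congr fun i => ?_
  have hφr : φ i = M.ray K (x i * Y) := rfl
  rw [← hφr]; ring

end LocalModel

end

section

variable {n : ℕ} {Ω : Set (En n)} {p : En n}

namespace LocalModel

variable {M : LocalModel Ω p} {K : ℝ} {F : En n → En n}

/-- Limits of the rescaled iterates along ultrafilters in which the scale tends to infinity. -/
theorem Julia.exists_iterate_limit (hK : M.Julia K) (hp : p ∉ Ω) (hF : TangentMap Ω p F) {M₀ : ℝ}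
    (hM₀ : ∀ m, ‖M.w (F^[m] (M.ray K 1))‖ ≤ M₀) {U : Ultrafilter (ℕ × ℝ)}
    (hU : Tendsto Prod.snd (U : Filter (ℕ × ℝ)) atTop) :
    ∃ V S, JuliaPair M.c V S ∧ ∀ y ∈ rightHP,
      Tendsto (fun i : ℕ × ℝ => M.w (F^[i.1] (M.ray K (i.2 * y))) / i.2) U (𝓝 (V y)) ∧
      Tendsto (fun i : ℕ × ℝ => (((√i.2)⁻¹ : ℝ) : ℂ) • M.s (F^[i.1] (M.ray K (i.2 * y)))) U
        (𝓝 (S y)) := by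
  refine JuliaPair.exists_limit U M.c_pos (M := 5 * M₀) ?_
  filter_upwards [hU.eventually_ge_atTop 1] with i hi
  have h := hK.juliaPair hp (hF.iterate i.1)
  exact ⟨h.rescale (by linarith), h.norm_rescale_one_le M.c_pos.le (hM₀ i.1) hi⟩

set_option maxHeartbeats 1000000 in
/-- Every limit value of the rescaled iterates is one, and the transversal parts vanish. -/
theorem Julia.limit_eq_one (hK : M.Julia K) (hp : p ∉ Ω) (hF : TangentMap Ω p F) {M₀ : ℝ}
    (hM₀ : ∀ m, ‖M.w (F^[m] (M.ray K 1))‖ ≤ M₀) {U : Ultrafilter (ℕ × ℝ)}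
    (hU : Tendsto Prod.snd (U : Filter (ℕ × ℝ)) atTop) :
    Tendsto (fun i : ℕ × ℝ => M.w (F^[i.1] (M.ray K i.2)) / i.2) U (𝓝 1) ∧
      Tendsto (fun i : ℕ × ℝ => (((√i.2)⁻¹ : ℝ) : ℂ) • M.s (F^[i.1] (M.ray K i.2))) U (𝓝 0) := by
  set f : ℕ × ℝ → ℂ := fun i => M.w (F^[i.1] (M.ray K i.2)) / i.2 with hf
  set L : Filter (ℕ × ℝ) := comap Prod.snd atTop with hL
  have hL' : ∀ {W : Ultrafilter (ℕ × ℝ)}, (W : Filter (ℕ × ℝ)) ≤ L ↔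
      Tendsto Prod.snd (W : Filter (ℕ × ℝ)) atTop := fun {W} => tendsto_iff_comap.symm
  set Λ : Set ℂ := {l | MapClusterPt l L f} with hΛ
  have hmem : ∀ l, l ∈ Λ ↔ ∃ W : Ultrafilter (ℕ × ℝ),
      Tendsto Prod.snd (W : Filter (ℕ × ℝ)) atTop ∧ Tendsto f W (𝓝 l) := fun l => by
    rw [hΛ, mem_ofPred_eq, mapClusterPt_iff_ultrafilter]
    simp only [hL']
  have hbound : ∀ l ∈ Λ, 1 ≤ l.re ∧ ‖l‖ ≤ 5 * M₀ := by
    intro l hl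
    obtain ⟨W, hW, hWl⟩ := (hmem l).1 hl
    obtain ⟨V, S, hVS, hlim⟩ := hK.exists_iterate_limit hp hF hM₀ hW
    have h1 := (hlim 1 one_mem_rightHP).1
    simp only [mul_one] at h1
    have e : l = V 1 := tendsto_nhds_unique hWl h1
    constructor
    · rw [e]; simpa using hVS.re_le M.c_pos.le one_mem_rightHP
    · refine le_of_tendsto hWl.norm ?_
      filter_upwards [hW.eventually_ge_atTop 1] with i hi
      have h := (hK.juliaPair hp (hF.iterate i.1)).norm_rescale_one_le M.c_pos.le (hM₀ i.1) hi
      simpa only [mul_one] using h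
  have hclosed : IsClosed Λ := isClosed_setOfPred_clusterPt
  have hcomp : IsCompact Λ := by
    refine Metric.isCompact_of_isClosed_isBounded hclosed
      ((isBounded_closedBall (x := (0 : ℂ)) (r := 5 * M₀)).subset fun l hl => ?_)
    rw [mem_closedBall_zero_iff]; exact (hbound l hl).2
  have hscale : ∀ {W : Ultrafilter (ℕ × ℝ)} {V : ℂ → ℂ}, Tendsto Prod.snd (W : Filter (ℕ × ℝ)) atTop →
      (∀ y ∈ rightHP, Tendsto (fun i : ℕ × ℝ => M.w (F^[i.1] (M.ray K (i.2 * y))) / i.2) W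
        (𝓝 (V y))) → ∀ y : ℝ, 0 < y → V y / y ∈ Λ := by
    intro W V hW hV y hy
    rw [hmem]
    refine ⟨W.map fun i => (i.1, i.2 * y), ?_, ?_⟩
    · rw [Ultrafilter.coe_map, tendsto_map'_iff]
      exact hW.atTop_mul_const hy
    · rw [Ultrafilter.coe_map, tendsto_map'_iff]
      refine ((hV y (ofReal_mem_rightHP hy)).div_const (y : ℂ)).congr fun i => ?_
      simp only [hf, Function.comp_apply, ofReal_mul, div_div]
  have hdouble : ∀ {W : Ultrafilter (ℕ × ℝ)} {V : ℂ → ℂ} {S : ℂ → En n}, JuliaPair M.c V S →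
      Tendsto Prod.snd (W : Filter (ℕ × ℝ)) atTop →
      (∀ y ∈ rightHP, Tendsto (fun i : ℕ × ℝ => M.w (F^[i.1] (M.ray K (i.2 * y))) / i.2) W
        (𝓝 (V y)) ∧ Tendsto (fun i : ℕ × ℝ => (((√i.2)⁻¹ : ℝ) : ℂ) •
          M.s (F^[i.1] (M.ray K (i.2 * y)))) W (𝓝 (S y))) → S 1 = 0 → V (V 1) ∈ Λ := by
    intro W V S hVS hW hlim hS
    have hV1 : V 1 ∈ rightHP := by
      have := hVS.re_le M.c_pos.le one_mem_rightHP
      show 0 < (V 1).re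
      rw [one_re] at this; linarith
    have h1 := hlim 1 one_mem_rightHP
    simp only [mul_one, hS] at h1
    have h2 := hK.tendsto_comp hp (fun i : ℕ × ℝ => hF.iterate i.1) hW hV1 h1.1 h1.2
      (hlim _ hV1).1
    rw [hmem]
    refine ⟨W.map fun i => (i.1 + i.1, i.2), ?_, ?_⟩
    · rw [Ultrafilter.coe_map, tendsto_map'_iff]; exact hW
    · rw [Ultrafilter.coe_map, tendsto_map'_iff]
      refine h2.congr fun i => ?_
      simp only [hf, Function.comp_apply, iterate_add_apply']
  -- limits at a point of maximal real part are affine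
  have hrigid : ∀ (β : ℝ), (∀ l ∈ Λ, l.re ≤ β) → ∀ {W : Ultrafilter (ℕ × ℝ)} {V : ℂ → ℂ}
      {S : ℂ → En n}, JuliaPair M.c V S → Tendsto Prod.snd (W : Filter (ℕ × ℝ)) atTop →
      (∀ y ∈ rightHP, Tendsto (fun i : ℕ × ℝ => M.w (F^[i.1] (M.ray K (i.2 * y))) / i.2) W
        (𝓝 (V y)) ∧ Tendsto (fun i : ℕ × ℝ => (((√i.2)⁻¹ : ℝ) : ℂ) •
          M.s (F^[i.1] (M.ray K (i.2 * y)))) W (𝓝 (S y))) → (V 1).re = β →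
      S 1 = 0 ∧ (β * V 1 + I * (V 1).im : ℂ) ∈ Λ := by
    intro β hβ W V S hVS hW hlim hV1
    have heq : ∀ y : ℝ, 0 < y → y ≤ 1 → (V y).re = β * y := by
      intro y hy hy1
      refine le_antisymm ?_ ?_
      · have := hβ _ (hscale hW (fun y hy => (hlim y hy).1) y hy)
        rw [div_ofReal_re, div_le_iff₀ hy] at this
        exact this
      · have := hVS.harnack M.c_pos.le hy hy1
        rw [ofReal_one, hV1] at this
        linarith
    have hS := (hVS.rigid M.c_pos heq one_mem_rightHP).2
    refine ⟨hS, ?_⟩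
    have h2 := hdouble hVS hW hlim hS
    have hV1' : V 1 ∈ rightHP := by
      have := hVS.re_le M.c_pos.le one_mem_rightHP
      show 0 < (V 1).re
      rw [one_re] at this; linarith
    rwa [(hVS.rigid M.c_pos heq hV1').1] at h2
  have hne : Λ.Nonempty := by
    obtain ⟨V, S, hVS, hlim⟩ := hK.exists_iterate_limit hp hF hM₀ hU
    have := (hlim 1 one_mem_rightHP).1
    simp only [mul_one] at this
    exact ⟨V 1, (hmem _).2 ⟨U, hU, this⟩⟩
  have hre : ∀ l ∈ Λ, l.re = 1 := by
    obtain ⟨l₀, hl₀, hmax⟩ := hcomp.exists_isMaxOn hne continuous_re.continuousOn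
    obtain ⟨W, hW, hWl⟩ := (hmem l₀).1 hl₀
    obtain ⟨V, S, hVS, hlim⟩ := hK.exists_iterate_limit hp hF hM₀ hW
    have h1 := (hlim 1 one_mem_rightHP).1
    simp only [mul_one] at h1
    have e : l₀ = V 1 := tendsto_nhds_unique hWl h1
    have h2 := (hrigid l₀.re (fun l hl => hmax hl) hVS hW hlim (by rw [e])).2
    have h3 : (l₀.re * V 1 + I * (V 1).im : ℂ).re ≤ l₀.re := hmax h2
    rw [← e] at h3
    simp only [add_re, mul_re, ofReal_re, ofReal_im, zero_mul, sub_zero, I_re, I_im, mul_zero,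
      add_zero] at h3
    intro l hl
    have h4 : l.re ≤ l₀.re := hmax hl
    have h5 := (hbound l hl).1
    nlinarith
  have hfin : ∀ {W : Ultrafilter (ℕ × ℝ)} {V : ℂ → ℂ} {S : ℂ → En n}, JuliaPair M.c V S →
      Tendsto Prod.snd (W : Filter (ℕ × ℝ)) atTop →
      (∀ y ∈ rightHP, Tendsto (fun i : ℕ × ℝ => M.w (F^[i.1] (M.ray K (i.2 * y))) / i.2) W
        (𝓝 (V y)) ∧ Tendsto (fun i : ℕ × ℝ => (((√i.2)⁻¹ : ℝ) : ℂ) •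
          M.s (F^[i.1] (M.ray K (i.2 * y)))) W (𝓝 (S y))) →
      V 1 ∈ Λ ∧ S 1 = 0 ∧ (V 1 + I * (V 1).im : ℂ) ∈ Λ := by
    intro W V S hVS hW hlim
    have h1 := (hlim 1 one_mem_rightHP).1
    simp only [mul_one] at h1
    have h0 : V 1 ∈ Λ := (hmem _).2 ⟨W, hW, h1⟩
    have h2 := hrigid 1 (fun l hl => (hre l hl).le) hVS hW hlim (hre _ h0)
    rw [ofReal_one, one_mul] at h2
    exact ⟨h0, h2⟩
  have hone : ∀ l ∈ Λ, l = 1 := by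
    obtain ⟨l₀, hl₀, hmax⟩ := hcomp.exists_isMaxOn hne continuous_im.abs.continuousOn
    obtain ⟨W, hW, hWl⟩ := (hmem l₀).1 hl₀
    obtain ⟨V, S, hVS, hlim⟩ := hK.exists_iterate_limit hp hF hM₀ hW
    have h1 := (hlim 1 one_mem_rightHP).1
    simp only [mul_one] at h1
    have e : l₀ = V 1 := tendsto_nhds_unique hWl h1
    have h2 := (hfin hVS hW hlim).2.2
    rw [← e] at h2
    have h3 : |(l₀ + I * l₀.im : ℂ).im| ≤ |l₀.im| := hmax h2
    simp only [add_im, mul_im, ofReal_re, ofReal_im, I_re, I_im, mul_zero, one_mul,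
      zero_add] at h3
    rw [← two_mul, abs_mul, abs_two] at h3
    intro l hl
    have h4 : |l.im| ≤ |l₀.im| := hmax hl
    refine Complex.ext (by rw [hre l hl, one_re]) ?_
    rw [one_im]
    exact abs_nonpos_iff.mp (by linarith)
  obtain ⟨V, S, hVS, hlim⟩ := hK.exists_iterate_limit hp hF hM₀ hU
  obtain ⟨h1, h2, -⟩ := hfin hVS hU hlim
  have h3 := hlim 1 one_mem_rightHP
  simp only [mul_one, h2, hone _ h1] at h3
  exact h3

theorem Julia.tendsto_one (hK : M.Julia K) (hp : p ∉ Ω) (hF : TangentMap Ω p F) {M₀ : ℝ}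
    (hM₀ : ∀ m, ‖M.w (F^[m] (M.ray K 1))‖ ≤ M₀) :
    Tendsto (fun i : ℕ × ℝ => M.w (F^[i.1] (M.ray K i.2)) / i.2) (comap Prod.snd atTop) (𝓝 1) ∧
      Tendsto (fun i : ℕ × ℝ => (((√i.2)⁻¹ : ℝ) : ℂ) • M.s (F^[i.1] (M.ray K i.2)))
        (comap Prod.snd atTop) (𝓝 0) := by
  constructor <;> rw [tendsto_iff_ultrafilter] <;> intro U hU
  · exact (hK.limit_eq_one hp hF hM₀ (tendsto_iff_comap.2 hU)).1
  · exact (hK.limit_eq_one hp hF hM₀ (tendsto_iff_comap.2 hU)).2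

end LocalModel

end

section Mean

variable {E : Type*} [NormedAddCommGroup E] [NormedSpace ℂ E]

/-- The arithmetic mean of the first `N` terms of a sequence. -/
def mean (a : ℕ → E) (N : ℕ) : E := (N : ℂ)⁻¹ • ∑ m ∈ Finset.range N, a m

theorem norm_mean_le {a : ℕ → E} {C : ℝ} (ha : ∀ m, ‖a m‖ ≤ C) (N : ℕ) : ‖mean a N‖ ≤ C := by
  have hC : 0 ≤ C := (norm_nonneg _).trans (ha 0)
  rcases Nat.eq_zero_or_pos N with rfl | hN
  · simpa [mean] using hC
  have hN' : (0 : ℝ) < N := by exact_mod_cast hN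
  rw [mean, norm_smul, norm_inv, Complex.norm_natCast, inv_mul_le_iff₀ hN']
  refine (norm_sum_le _ _).trans ((Finset.sum_le_sum fun m _ => ha m).trans ?_)
  simp

theorem mean_const (b : E) {N : ℕ} (hN : 0 < N) : mean (fun _ => b) N = b := by
  have : (N : ℂ) ≠ 0 := by exact_mod_cast hN.ne'
  rw [mean, Finset.sum_const, Finset.card_range, ← Nat.cast_smul_eq_nsmul ℂ, smul_smul,
    inv_mul_cancel₀ this, one_smul]

theorem mean_sub (a b : ℕ → E) (N : ℕ) : mean (fun m => a m - b m) N = mean a N - mean b N := by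
  simp only [mean, Finset.sum_sub_distrib, smul_sub]

theorem map_mean {E' : Type*} [NormedAddCommGroup E'] [NormedSpace ℂ E'] (A : E →L[ℂ] E')
    (a : ℕ → E) (N : ℕ) : A (mean a N) = mean (fun m => A (a m)) N := by
  simp only [mean, map_smul, map_sum]

theorem tendsto_mean_shift_one {a : ℕ → E} {C : ℝ} (ha : ∀ m, ‖a m‖ ≤ C) {U : Filter ℕ}
    (hU : U ≤ atTop) {l : E} (h : Tendsto (mean a) U (𝓝 l)) :
    Tendsto (mean fun m => a (m + 1)) U (𝓝 l) := by
  have e : ∀ N, mean (fun m => a (m + 1)) N = mean a N + (N : ℂ)⁻¹ • (a N - a 0) := fun N => by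
    rw [mean, mean, ← smul_add]
    congr 1
    have h1 := Finset.sum_range_succ a N
    have h2 := Finset.sum_range_succ' a N
    rw [h1] at h2
    rw [← add_sub_assoc, h2, add_sub_cancel_right]
  have h0 : Tendsto (fun N : ℕ => (N : ℂ)⁻¹ • (a N - a 0)) U (𝓝 0) := by
    have h1 : Tendsto (fun N : ℕ => (N : ℝ)⁻¹ * (2 * C)) U (𝓝 0) := by
      simpa using (tendsto_inv_atTop_nhds_zero_nat (𝕜 := ℝ)).mono_left hU |>.mul_const (2 * C)
    refine squeeze_zero_norm (fun N => ?_) h1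
    rw [norm_smul, norm_inv, Complex.norm_natCast]
    gcongr
    refine (norm_sub_le _ _).trans ?_
    linarith [ha N, ha 0]
  have := h.add h0
  rw [add_zero] at this
  exact this.congr fun N => (e N).symm

theorem tendsto_mean_shift {a : ℕ → E} {C : ℝ} (ha : ∀ m, ‖a m‖ ≤ C) {U : Filter ℕ}
    (hU : U ≤ atTop) {l : E} (h : Tendsto (mean a) U (𝓝 l)) (k : ℕ) :
    Tendsto (mean fun m => a (k + m)) U (𝓝 l) := by
  induction k with
  | zero => simpa using h
  | succ k ih =>
    have := tendsto_mean_shift_one (fun m => ha (k + m)) hU ih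
    refine this.congr fun N => ?_
    congr 1
    funext m
    congr 1
    ring

end Mean

section Newton

variable {E : Type*} [NormedAddCommGroup E] [NormedSpace ℂ E]
  {G P : E → E} {c : E} {r C : ℝ} {U : Filter ℕ}

/-- Averaging an orbit of small diameter produces a point with quadratically smaller orbit. -/
theorem newton_step [U.NeBot] (hU : U ≤ atTop)
    (hd : ∀ m, DifferentiableOn ℂ G^[m] (ball c r))
    (hC : ∀ m, ∀ u ∈ ball c r, ‖G^[m] u‖ ≤ C)
    (hP : ∀ u ∈ ball c r, Tendsto (mean fun m => G^[m] u) U (𝓝 (P u)))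
    {u : E} (hu : u ∈ ball c (r / 2)) {d : ℝ} (hdr : d < r / 2) (hdu : ∀ m, ‖G^[m] u - u‖ ≤ d) :
    ‖P u - u‖ ≤ d ∧ ∀ k, ‖G^[k] (P u) - P u‖ ≤ 2 * (4 * C / (r / 2) ^ 2) * d ^ 2 := by
  have hd0 : 0 ≤ d := (norm_nonneg _).trans (hdu 0)
  have hsub : ball u (r / 2) ⊆ ball c r := by
    refine ball_subset_ball' ?_
    rw [mem_ball] at hu; linarith
  have hur : u ∈ ball c r := hsub (mem_ball_self (by linarith))
  have hNpos : ∀ᶠ N in U, 0 < N := hU (eventually_gt_atTop 0)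
  have hC0 : 0 ≤ C := (norm_nonneg _).trans (hC 0 u hur)
  have hlim := hP u hur
  have hsubl : Tendsto (mean fun m => G^[m] u - u) U (𝓝 (P u - u)) := by
    refine (hlim.sub_const u).congr' ?_
    filter_upwards [hNpos] with N hN
    rw [mean_sub, mean_const u hN]
  have hPu : ‖P u - u‖ ≤ d :=
    le_of_tendsto hsubl.norm (Eventually.of_forall fun N => norm_mean_le hdu N)
  refine ⟨hPu, fun k => ?_⟩
  set D := fderiv ℂ G^[k] u with hD
  set q := 4 * C / (r / 2) ^ 2 with hq
  have hq0 : 0 ≤ q := by positivity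
  have htaylor : ∀ y, ‖y - u‖ ≤ d → ‖G^[k] y - G^[k] u - D (y - u)‖ ≤ q * d ^ 2 := fun y hy => by
    refine (norm_taylor_le_of_bounded_holo ((hd k).mono hsub) (fun y hy => hC k y (hsub hy))
      (by rw [mem_ball, dist_eq_norm]; linarith)).trans ?_
    gcongr
  have h1 : Tendsto (mean fun m => G^[k] (G^[m] u) - G^[k] u - D (G^[m] u - u)) U
      (𝓝 (P u - G^[k] u - D (P u - u))) := by
    have h2 : Tendsto (mean fun m => G^[k] (G^[m] u)) U (𝓝 (P u)) := by
      have := tendsto_mean_shift (fun m => hC m u hur) hU hlim k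
      refine this.congr fun N => ?_
      congr 1
      funext m
      rw [iterate_add_apply']
    refine ((h2.sub_const (G^[k] u)).sub ((D.continuous.tendsto _).comp hsubl)).congr' ?_
    filter_upwards [hNpos] with N hN
    rw [Function.comp_apply, map_mean, mean_sub, mean_sub, mean_const _ hN]
  have h2 : ‖P u - G^[k] u - D (P u - u)‖ ≤ q * d ^ 2 :=
    le_of_tendsto h1.norm (Eventually.of_forall fun N => norm_mean_le (fun m => htaylor _ (hdu m)) N)
  have h3 := htaylor _ hPu
  have e : G^[k] (P u) - P u = (G^[k] (P u) - G^[k] u - D (P u - u)) -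
      (P u - G^[k] u - D (P u - u)) := by abel
  rw [e]
  refine (norm_sub_le _ _).trans ?_
  linarith

/-- Iterated averaging converges to a fixed point. -/
theorem newton [CompleteSpace E] [U.NeBot] (hU : U ≤ atTop)
    (hd : ∀ m, DifferentiableOn ℂ G^[m] (ball c r))
    (hC : ∀ m, ∀ u ∈ ball c r, ‖G^[m] u‖ ≤ C)
    (hP : ∀ u ∈ ball c r, Tendsto (mean fun m => G^[m] u) U (𝓝 (P u)))
    {u : E} (hu : u ∈ ball c (r / 4)) {d : ℝ} (hdr : d ≤ r / 8)
    (hdC : 2 * (4 * C / (r / 2) ^ 2) * d ≤ 1 / 2) (hdu : ∀ m, ‖G^[m] u - u‖ ≤ d) :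
    (∀ j, P^[j] u ∈ ball c (r / 2)) ∧ ∃ e, ‖e - u‖ ≤ 2 * d ∧
      (∀ j, ‖P^[j] u - e‖ ≤ 2 * d / 2 ^ j) ∧ G e = e := by
  have hd0 : 0 ≤ d := (norm_nonneg _).trans (hdu 0)
  have hr : 0 < r := by have := pos_of_mem_ball hu; linarith
  have hmem : ∀ y, ‖y - u‖ ≤ 2 * d → y ∈ ball c (r / 2) := fun y hy => by
    rw [mem_ball, dist_eq_norm] at hu ⊢
    have e : y - c = (y - u) + (u - c) := by abel
    rw [e]
    refine (norm_add_le _ _).trans_lt ?_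
    linarith
  have hstep : ∀ j, (∀ m, ‖G^[m] (P^[j] u) - P^[j] u‖ ≤ d / 2 ^ j) →
      P^[j] u ∈ ball c (r / 2) → ‖P^[j + 1] u - P^[j] u‖ ≤ d / 2 ^ j ∧
        ∀ m, ‖G^[m] (P^[j + 1] u) - P^[j + 1] u‖ ≤ d / 2 ^ (j + 1) := by
    intro j h1 h2
    have hpow : (1 : ℝ) ≤ 2 ^ j := one_le_pow₀ (by norm_num)
    have hdj : d / 2 ^ j ≤ d := div_le_self hd0 hpow
    have h3 := newton_step hU hd hC hP h2 (by linarith) h1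
    rw [iterate_succ_apply']
    refine ⟨h3.1, fun m => (h3.2 m).trans ?_⟩
    have hC0 : 0 ≤ C := (norm_nonneg _).trans (hC 0 c (mem_ball_self hr))
    have h4 : 2 * (4 * C / (r / 2) ^ 2) * (d / 2 ^ j) ≤ 1 / 2 :=
      (mul_le_mul_of_nonneg_left hdj (by positivity)).trans hdC
    have h5 : 0 ≤ d / 2 ^ j := by positivity
    have h6 : d / 2 ^ (j + 1) = 1 / 2 * (d / 2 ^ j) := by rw [pow_succ]; field_simp
    rw [h6, sq (d / 2 ^ j), ← mul_assoc]
    exact mul_le_mul_of_nonneg_right h4 h5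
  have hinv : ∀ j, (∀ m, ‖G^[m] (P^[j] u) - P^[j] u‖ ≤ d / 2 ^ j) ∧
      ‖P^[j] u - u‖ ≤ 2 * d * (1 - (1 / 2) ^ j) := by
    intro j
    induction j with
    | zero => simpa using hdu
    | succ j ih =>
      have hle : 2 * d * (1 - (1 / 2 : ℝ) ^ j) ≤ 2 * d := by
        have : (0 : ℝ) ≤ (1 / 2) ^ j := by positivity
        nlinarith
      have h1 := hstep j ih.1 (hmem _ (ih.2.trans hle))
      refine ⟨h1.2, ?_⟩
      have e : P^[j + 1] u - u = (P^[j + 1] u - P^[j] u) + (P^[j] u - u) := by abel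
      rw [e]
      refine (norm_add_le _ _).trans ((add_le_add h1.1 ih.2).trans (le_of_eq ?_))
      rw [pow_succ, one_div, inv_pow]
      field_simp
      ring
  have hball : ∀ j, P^[j] u ∈ ball c (r / 2) := fun j => hmem _ ((hinv j).2.trans (by
    have : (0 : ℝ) ≤ (1 / 2) ^ j := by positivity
    nlinarith))
  have hdist : ∀ j, dist (P^[j] u) (P^[j + 1] u) ≤ 2 * d / 2 / 2 ^ j := fun j => by
    rw [dist_comm, dist_eq_norm, mul_div_cancel_left₀ _ (by norm_num : (2 : ℝ) ≠ 0)]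
    exact (hstep j (hinv j).1 (hball j)).1
  obtain ⟨e, he⟩ := cauchySeq_tendsto_of_complete (cauchySeq_of_le_geometric_two hdist)
  have hrate : ∀ j, ‖P^[j] u - e‖ ≤ 2 * d / 2 ^ j := fun j => by
    rw [← dist_eq_norm]; exact dist_le_of_le_geometric_two_of_tendsto hdist he j
  have heu : ‖e - u‖ ≤ 2 * d := by
    have := hrate 0
    rw [norm_sub_rev]; simpa using this
  refine ⟨hball, e, heu, hrate, ?_⟩
  have hec : e ∈ ball c r := ball_subset_ball (by linarith) (hmem e heu)
  have hcont : ContinuousAt G e := by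
    have := hd 1
    rw [iterate_one] at this
    exact (this.differentiableAt (isOpen_ball.mem_nhds hec)).continuousAt
  have h1 : Tendsto (fun j => G (P^[j] u) - P^[j] u) atTop (𝓝 (G e - e)) :=
    (hcont.tendsto.comp he).sub he
  have h2 : Tendsto (fun j => G (P^[j] u) - P^[j] u) atTop (𝓝 0) := by
    refine squeeze_zero_norm (fun j => (hinv j).1 1) ?_
    have := tendsto_pow_atTop_nhds_zero_of_lt_one (r := (1 / 2 : ℝ)) (by norm_num) (by norm_num)
    have h3 := this.const_mul d
    rw [mul_zero] at h3
    refine h3.congr fun j => ?_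
    rw [one_div, inv_pow]; rfl
  exact sub_eq_zero.mp (tendsto_nhds_unique h1 h2)

end Newton

section

variable {n : ℕ} {Ω : Set (En n)} {p : En n}

namespace LocalModel

/-- The projection along `v₀` onto the kernel of the linear form of the model. -/
def tang (M : LocalModel Ω p) : En n →L[ℂ] En n :=
  ContinuousLinearMap.id ℂ (En n) - M.ℓ.smulRight M.v₀

/-- The anisotropic dilation of the model at scale `s`. -/
def dil (M : LocalModel Ω p) (s : ℝ) : En n →L[ℂ] En n :=
  ((s : ℂ)⁻¹ ^ 2) • M.ℓ.smulRight M.v₀ + (s : ℂ)⁻¹ • M.tang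

variable (M : LocalModel Ω p)

theorem tang_apply (u : En n) : M.tang u = u - M.ℓ u • M.v₀ := rfl

theorem tang_v₀ : M.tang M.v₀ = 0 := by rw [tang_apply, M.ℓ_v₀, one_smul, sub_self]

theorem ℓ_tang (u : En n) : M.ℓ (M.tang u) = 0 := by
  rw [tang_apply, map_sub, map_smul, M.ℓ_v₀, smul_eq_mul, mul_one, sub_self]

theorem tang_tang (u : En n) : M.tang (M.tang u) = M.tang u := by
  rw [tang_apply, ℓ_tang, zero_smul, sub_zero]

theorem dil_apply (s : ℝ) (u : En n) :
    M.dil s u = (((s : ℂ)⁻¹ ^ 2) * M.ℓ u) • M.v₀ + (s : ℂ)⁻¹ • M.tang u := by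
  simp only [dil, _root_.add_apply, _root_.smul_apply, ContinuousLinearMap.smulRight_apply, smul_smul]

theorem ℓ_dil (s : ℝ) (u : En n) : M.ℓ (M.dil s u) = (s : ℂ)⁻¹ ^ 2 * M.ℓ u := by
  rw [dil_apply, map_add, map_smul, map_smul, M.ℓ_v₀, ℓ_tang, smul_zero, add_zero, smul_eq_mul,
    mul_one]

theorem tang_dil (s : ℝ) (u : En n) : M.tang (M.dil s u) = (s : ℂ)⁻¹ • M.tang u := by
  rw [dil_apply, map_add, map_smul, map_smul, M.tang_v₀, smul_zero, zero_add, tang_tang]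

theorem dil_inv_dil {s : ℝ} (hs : s ≠ 0) (u : En n) : M.dil s⁻¹ (M.dil s u) = u := by
  have hs' : (s : ℂ) ≠ 0 := by exact_mod_cast hs
  rw [M.dil_apply s⁻¹, ℓ_dil, tang_dil, ofReal_inv, inv_inv, smul_smul, mul_inv_cancel₀ hs',
    one_smul, ← mul_assoc, ← mul_pow, mul_inv_cancel₀ hs', one_pow, one_mul, tang_apply]
  abel

theorem dil_dil_inv {s : ℝ} (hs : s ≠ 0) (u : En n) : M.dil s (M.dil s⁻¹ u) = u := by
  simpa using M.dil_inv_dil (inv_ne_zero hs) u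

theorem norm_dil_le {s : ℝ} (hs : 1 ≤ s) (u : En n) :
    ‖M.dil s u‖ ≤ s⁻¹ * ((‖M.ℓ‖ * ‖M.v₀‖ + ‖M.tang‖) * ‖u‖) := by
  have hs0 : 0 < s := by linarith
  have h1 : s⁻¹ ≤ 1 := inv_le_one_of_one_le₀ hs
  have h1' : 0 < s⁻¹ := by positivity
  rw [dil_apply]
  refine (norm_add_le _ _).trans ?_
  rw [norm_smul, norm_smul, norm_mul, norm_pow, norm_inv, norm_real, Real.norm_of_nonneg hs0.le]
  have h2 := M.ℓ.le_opNorm u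
  have h3 := M.tang.le_opNorm u
  have h4 : s⁻¹ ^ 2 ≤ s⁻¹ := by rw [sq]; exact mul_le_of_le_one_left h1'.le h1
  calc s⁻¹ ^ 2 * ‖M.ℓ u‖ * ‖M.v₀‖ + s⁻¹ * ‖M.tang u‖
      ≤ s⁻¹ * (‖M.ℓ‖ * ‖u‖) * ‖M.v₀‖ + s⁻¹ * (‖M.tang‖ * ‖u‖) := by gcongr
    _ = _ := by ring

/-- The chart of scale `s` centred at the boundary point. -/
def chart (s : ℝ) (u : En n) : En n := p + M.dil s u

/-- A self-map expressed in the chart of scale `s`. -/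
def conj (s : ℝ) (G : En n → En n) (u : En n) : En n := M.dil s⁻¹ (G (M.chart s u) - p)

theorem chart_conj {s : ℝ} (hs : s ≠ 0) (G : En n → En n) (u : En n) :
    M.chart s (M.conj s G u) = G (M.chart s u) := by
  rw [chart, conj, M.dil_dil_inv hs, add_sub_cancel]

theorem dil_inv_chart {s : ℝ} (hs : s ≠ 0) (u : En n) : M.dil s⁻¹ (M.chart s u - p) = u := by
  rw [chart, add_sub_cancel_left, M.dil_inv_dil hs]

theorem chart_dil_inv {s : ℝ} (hs : s ≠ 0) (z : En n) : M.chart s (M.dil s⁻¹ (z - p)) = z := by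
  rw [chart, M.dil_dil_inv hs, add_sub_cancel]

theorem conj_iterate {s : ℝ} (hs : s ≠ 0) (G : En n → En n) (m : ℕ) :
    (M.conj s G)^[m] = M.conj s G^[m] := by
  induction m with
  | zero => funext u; exact (M.dil_inv_chart hs u).symm
  | succ m ih =>
    funext u
    rw [iterate_succ_apply', ih, conj, M.chart_conj hs, conj, iterate_succ_apply']

theorem chart_v₀ (s : ℝ) : M.chart s M.v₀ = disc p M.v₀ ((s ^ 2 : ℝ) : ℂ) := by
  rw [chart, disc, dil_apply, M.ℓ_v₀, M.tang_v₀, smul_zero, add_zero, mul_one, ofReal_pow, inv_pow]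

theorem differentiable_chart (s : ℝ) : Differentiable ℂ (M.chart s) :=
  (M.dil s).differentiable.const_add p

variable {M} {K : ℝ} {F : En n → En n}

set_option maxHeartbeats 1000000 in
/-- In the charts of large scale, all tangent maps are uniformly bounded on a fixed ball. -/
theorem Julia.exists_chart (hK : M.Julia K) : ∃ r > 0, ∃ C, ∃ S ≥ 1, ∀ s ≥ S, ∀ u ∈ ball M.v₀ r,
    M.chart s u ∈ Ω ∧ ∀ G, TangentMap Ω p G → ‖M.conj s G u‖ ≤ C := by
  obtain ⟨r, hr, X, hX, hball⟩ := hK.exists_ball (κ := 1) one_pos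
  set A := ‖M.ℓ‖ * ‖M.v₀‖ + ‖M.tang‖ with hA
  have hA0 : 0 ≤ A := by positivity
  set r₀ := r / (1 + ‖M.ℓ‖ + A) with hr₀
  have hr₀0 : 0 < r₀ := by positivity
  have hr₀e : r₀ * (1 + ‖M.ℓ‖ + A) = r := by rw [hr₀]; field_simp
  clear_value r₀
  have hc := M.c_pos
  refine ⟨r₀, hr₀0, 4 * (1 + ‖M.B‖ / M.c) * ‖M.v₀‖ + ‖M.tang‖ * (2 / √M.c), max 1 X,
    le_max_left _ _, fun s hs u hu => ?_⟩
  have hs1 : 1 ≤ s := (le_max_left _ _).trans hs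
  have hsX : X ≤ s := (le_max_right _ _).trans hs
  have hs0 : 0 < s := by linarith
  have hsc : (s : ℂ) ≠ 0 := by exact_mod_cast hs0.ne'
  rw [mem_ball, dist_eq_norm] at hu
  have hnx : ‖((s ^ 2 : ℝ) : ℂ)‖ = s ^ 2 := by rw [norm_real, Real.norm_of_nonneg (by positivity)]
  have e : M.chart s u - disc p M.v₀ ((s ^ 2 : ℝ) : ℂ) = M.dil s (u - M.v₀) := by
    rw [← M.chart_v₀, chart, chart, map_sub]; abel
  obtain ⟨h1, h2⟩ := hball ((s ^ 2 : ℝ) : ℂ) (by rw [hnx, ofReal_re, one_mul])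
    (by rw [hnx]; nlinarith) (M.chart s u) (by
      rw [e, M.ℓ_dil, ← mul_assoc, ofReal_pow, ← mul_pow, mul_inv_cancel₀ hsc, one_pow, one_mul]
      refine (M.ℓ.le_opNorm _).trans_lt ?_
      nlinarith [mul_le_mul_of_nonneg_left hu.le (norm_nonneg M.ℓ), mul_nonneg hr₀0.le hA0]) (by
      rw [e, hnx, ← mul_pow]
      refine pow_lt_pow_left₀ ?_ (by positivity) two_ne_zero
      have := mul_le_mul_of_nonneg_left (M.norm_dil_le hs1 (u - M.v₀)) hs0.le
      rw [← mul_assoc, mul_inv_cancel₀ hs0.ne', one_mul] at this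
      refine this.trans_lt ?_
      nlinarith [mul_le_mul_of_nonneg_left hu.le hA0, mul_nonneg hr₀0.le (norm_nonneg M.ℓ)])
  refine ⟨h1, fun G hG => ?_⟩
  have h3 := (h2 G hG).2
  rw [conj]
  set w := G (M.chart s u) - p with hw
  clear_value w
  rw [hnx] at h3
  have hre := re_le_norm (M.h w)
  have hh : s ^ 2 * ‖M.h w‖ ≤ 4 := by
    by_contra hcon
    push Not at hcon
    have hpos : 0 < ‖M.h w‖ := by
      by_contra h0
      have : ‖M.h w‖ = 0 := le_antisymm (not_lt.mp h0) (norm_nonneg _)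
      rw [this] at hcon; linarith
    have : 0 ≤ M.c * ‖w‖ ^ 2 := by positivity
    nlinarith [mul_lt_mul_of_pos_right hcon hpos]
  have hw2 : M.c * (s * ‖w‖) ^ 2 ≤ 4 := by
    have h5 : M.c * ‖w‖ ^ 2 ≤ ‖M.h w‖ := by
      have : 0 ≤ 1 / 4 * s ^ 2 * ‖M.h w‖ ^ 2 := by positivity
      linarith
    have : s ^ 2 * (M.c * ‖w‖ ^ 2) ≤ s ^ 2 * ‖M.h w‖ := by gcongr
    nlinarith
  have hw2' : (s * ‖w‖) ^ 2 ≤ 4 / M.c := by rw [le_div_iff₀ hc]; linarith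
  have hw1 : s * ‖w‖ ≤ 2 / √M.c := by
    refine le_of_sq_le_sq ?_ (by positivity)
    rw [div_pow, Real.sq_sqrt hc.le]
    linarith
  have hℓ : s ^ 2 * ‖M.ℓ w‖ ≤ 4 * (1 + ‖M.B‖ / M.c) := by
    have e1 : M.ℓ w = M.h w - M.B w w := by rw [h]; ring
    have h5 : ‖M.ℓ w‖ ≤ ‖M.h w‖ + ‖M.B‖ * ‖w‖ * ‖w‖ := by
      rw [e1]; exact (norm_sub_le _ _).trans (add_le_add le_rfl (M.B.le_opNorm₂ w w))
    have h6 : s ^ 2 * ‖M.ℓ w‖ ≤ s ^ 2 * (‖M.h w‖ + ‖M.B‖ * ‖w‖ * ‖w‖) := by gcongr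
    have h7 : ‖M.B‖ * (s * ‖w‖) ^ 2 ≤ ‖M.B‖ * (4 / M.c) := by gcongr
    have h8 : 4 * (1 + ‖M.B‖ / M.c) = 4 + ‖M.B‖ * (4 / M.c) := by ring
    rw [h8]
    nlinarith
  rw [dil_apply, ofReal_inv, inv_inv]
  refine (norm_add_le _ _).trans ?_
  rw [norm_smul, norm_smul, norm_mul, norm_pow, norm_real, Real.norm_of_nonneg hs0.le]
  refine add_le_add (by gcongr) ?_
  have h9 := M.tang.le_opNorm w
  calc s * ‖M.tang w‖ ≤ s * (‖M.tang‖ * ‖w‖) := by gcongr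
    _ = ‖M.tang‖ * (s * ‖w‖) := by ring
    _ ≤ _ := by gcongr

set_option maxHeartbeats 1000000 in
/-- In the charts of large scale, the iterates almost fix the centre, uniformly. -/
theorem Julia.tendsto_conj (hK : M.Julia K) (hp : p ∉ Ω) (hF : TangentMap Ω p F) {M₀ : ℝ}
    (hM₀ : ∀ m, ‖M.w (F^[m] (M.ray K 1))‖ ≤ M₀) :
    Tendsto (fun i : ℕ × ℝ => M.conj i.2 F^[i.1] M.v₀) (comap Prod.snd atTop) (𝓝 M.v₀) := by
  set L : Filter (ℕ × ℝ) := comap Prod.snd atTop with hL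
  set X' : ℝ := K * ‖M.v₀‖ ^ 2 with hX'
  have hs : Tendsto (fun i : ℕ × ℝ => i.2) L atTop := tendsto_comap
  have hx : Tendsto (fun i : ℕ × ℝ => i.2 ^ 2 - X') L atTop :=
    tendsto_atTop_add_const_right _ _ ((tendsto_pow_atTop two_ne_zero).comp hs)
  have hg : Tendsto (fun i : ℕ × ℝ => (i.1, i.2 ^ 2 - X')) L L := by
    rw [hL, tendsto_comap_iff]; exact hx
  obtain ⟨h1, h2⟩ := hK.tendsto_one hp hF hM₀
  have h1' := h1.comp hg
  have h2' := h2.comp hg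
  simp only [Function.comp_def] at h1' h2'
  obtain ⟨h3, h4⟩ := tendsto_coords (M := M)
    (z := fun i : ℕ × ℝ => F^[i.1] (M.ray K ((i.2 ^ 2 - X' : ℝ) : ℂ)))
    (x := fun i : ℕ × ℝ => i.2 ^ 2 - X') hx one_ne_zero h1' h2'
  have hz : ∀ i : ℕ × ℝ, F^[i.1] (M.ray K ((i.2 ^ 2 - X' : ℝ) : ℂ)) = F^[i.1] (M.chart i.2 M.v₀) :=
    fun i => by
      rw [chart_v₀, ray]; congr 2; rw [hX']; push_cast; ring
  simp only [hz] at h3 h4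
  rw [inv_one] at h4
  have hratio : Tendsto (fun i : ℕ × ℝ => i.2 ^ 2 / (i.2 ^ 2 - X')) L (𝓝 1) := by
    have h5 : Tendsto (fun i : ℕ × ℝ => 1 + X' * (i.2 ^ 2 - X')⁻¹) L (𝓝 (1 + X' * 0)) :=
      (hx.inv_tendsto_atTop.const_mul X').const_add 1
    rw [mul_zero, add_zero] at h5
    refine h5.congr' ?_
    filter_upwards [hx.eventually_gt_atTop 0] with i hi
    have := hi.ne'
    field_simp
    ring
  have hA : Tendsto (fun i : ℕ × ℝ => (i.2 : ℂ) ^ 2 * M.ℓ (F^[i.1] (M.chart i.2 M.v₀) - p)) L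
      (𝓝 1) := by
    have h5 := ((continuous_ofReal.tendsto 1).comp hratio).mul h4
    rw [ofReal_one, mul_one] at h5
    refine h5.congr' ?_
    filter_upwards [hx.eventually_gt_atTop 0] with i hi
    have : ((i.2 ^ 2 - X' : ℝ) : ℂ) ≠ 0 := by exact_mod_cast hi.ne'
    rw [Function.comp_apply, ofReal_div, ofReal_pow, ← mul_assoc, div_mul_cancel₀ _ this]
  have hB : Tendsto (fun i : ℕ × ℝ => (i.2 : ℂ) • (F^[i.1] (M.chart i.2 M.v₀) - p)) L (𝓝 0) := by
    have h5 := (Real.continuous_sqrt.tendsto _).comp hratio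
    rw [Real.sqrt_one] at h5
    have h6 := ((continuous_ofReal.tendsto 1).comp h5).smul h3
    rw [smul_zero] at h6
    refine h6.congr' ?_
    filter_upwards [hx.eventually_gt_atTop 0, hs.eventually_gt_atTop 0] with i hi hi'
    simp only [Function.comp_apply]
    rw [smul_smul, ← ofReal_mul, Real.sqrt_div (by positivity), Real.sqrt_sq hi'.le,
      div_mul_cancel₀ _ (Real.sqrt_pos.mpr hi).ne']
  have h7 := (hA.smul_const M.v₀).add ((M.tang.continuous.tendsto _).comp hB)
  rw [one_smul, map_zero, add_zero] at h7
  refine h7.congr fun i => ?_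
  rw [conj, dil_apply, ofReal_inv, inv_inv, Function.comp_apply, map_smul]

end LocalModel

end

section

variable {n : ℕ} {Ω : Set (En n)} {p : En n}

namespace LocalModel

variable {M : LocalModel Ω p} {K : ℝ} {F Q : En n → En n} {U : Filter ℕ}

theorem differentiableOn_conj {s : ℝ} {G : En n → En n} (hG : DifferentiableOn ℂ G Ω)
    {W : Set (En n)} (hW : MapsTo (M.chart s) W Ω) : DifferentiableOn ℂ (M.conj s G) W :=
  (M.dil s⁻¹).differentiable.comp_differentiableOn
    ((hG.comp (M.differentiable_chart s).differentiableOn hW).sub_const p)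

/-- The averaging iteration of a tangent map in a fixed chart. -/
theorem exists_fixed_of_chart [U.NeBot] (hU : U ≤ atTop) (hF : TangentMap Ω p F)
    (hQ : ∀ z ∈ Ω, Tendsto (mean fun m => F^[m] z) U (𝓝 (Q z))) {s r C : ℝ} (hs : s ≠ 0)
    (hch : ∀ u ∈ ball M.v₀ r, M.chart s u ∈ Ω ∧ ∀ G, TangentMap Ω p G → ‖M.conj s G u‖ ≤ C)
    {u : En n} (hu : u ∈ ball M.v₀ (r / 4)) {d : ℝ} (hdr : d ≤ r / 8)
    (hdC : 2 * (4 * C / (r / 2) ^ 2) * d ≤ 1 / 2) (hdu : ∀ m, ‖M.conj s F^[m] u - u‖ ≤ d) :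
    (∀ j, Q^[j] (M.chart s u) ∈ Ω) ∧ ∃ e ∈ Ω, F e = e ∧ ‖M.dil s⁻¹ (e - p) - u‖ ≤ 2 * d ∧
      ∀ j, ‖Q^[j] (M.chart s u) - e‖ ≤ ‖M.dil s‖ * (2 * d / 2 ^ j) := by
  have hr : 0 < r := by have := pos_of_mem_ball hu; linarith
  have hchart : ∀ j, Q^[j] (M.chart s u) = M.chart s ((M.conj s Q)^[j] u) := fun j => by
    rw [M.conj_iterate hs, M.chart_conj hs]
  obtain ⟨h1, e, heu, hrate, hfix⟩ := newton (G := M.conj s F) (P := M.conj s Q) (c := M.v₀) (r := r)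
    (C := C) hU (fun m => by
      rw [M.conj_iterate hs]
      exact differentiableOn_conj (hF.iterate m).diff fun u hu => (hch u hu).1)
    (fun m u hu => by rw [M.conj_iterate hs]; exact (hch u hu).2 _ (hF.iterate m))
    (fun u hu => by
      have h2 := ((M.dil s⁻¹).continuous.tendsto _).comp ((hQ _ (hch u hu).1).sub_const p)
      refine h2.congr' ?_
      filter_upwards [hU (eventually_gt_atTop 0)] with N hN
      rw [Function.comp_apply]
      have e1 : mean (fun m => F^[m] (M.chart s u)) N - p =
          mean (fun m => F^[m] (M.chart s u) - p) N := by rw [mean_sub, mean_const p hN]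
      rw [e1, map_mean]
      congr 1
      funext m
      rw [M.conj_iterate hs, conj])
    hu hdr hdC (fun m => by rw [M.conj_iterate hs]; exact hdu m)
  have her : e ∈ ball M.v₀ r := by
    rw [mem_ball, dist_eq_norm] at hu ⊢
    have e1 : e - M.v₀ = (e - u) + (u - M.v₀) := by abel
    rw [e1]
    refine (norm_add_le _ _).trans_lt ?_
    linarith
  refine ⟨fun j => ?_, M.chart s e, (hch e her).1, ?_, ?_, fun j => ?_⟩
  · rw [hchart]
    exact (hch _ (ball_subset_ball (by linarith) (h1 j))).1
  · rw [← M.chart_conj hs F e, hfix]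
  · rw [M.dil_inv_chart hs]; exact heu
  · rw [hchart, chart, chart, add_sub_add_left_eq_sub, ← map_sub]
    refine (ContinuousLinearMap.le_opNorm _ _).trans ?_
    gcongr
    exact hrate j

set_option maxHeartbeats 1000000 in
/-- A curve of fixed points tending to the boundary point along the axis of the model. -/
theorem Julia.exists_fixed_curve (hK : M.Julia K) (hΩ : IsOpen Ω) (hbd : Bornology.IsBounded Ω)
    (hp : p ∉ Ω) (hF : TangentMap Ω p F) {M₀ : ℝ} (hM₀ : ∀ m, ‖M.w (F^[m] (M.ray K 1))‖ ≤ M₀) :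
    ∃ X ≥ 1, ∃ e : ℝ → En n, ContinuousOn e (Ici X) ∧ (∀ s ∈ Ici X, e s ∈ Ω ∧ F (e s) = e s) ∧
      Tendsto (fun s => M.dil s⁻¹ (e s - p)) atTop (𝓝 M.v₀) := by
  obtain ⟨r, hr, C, S, hS, hch⟩ := hK.exists_chart
  obtain ⟨R, hR⟩ := hbd.exists_norm_le
  set U : Ultrafilter ℕ := hyperfilter ℕ with hU'
  have hU : (U : Filter ℕ) ≤ atTop := Nat.hyperfilter_le_atTop
  set f : ℕ → En n → En n := fun N z => mean (fun m => F^[m] z) N with hf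
  have hFd : ∀ m, DifferentiableOn ℂ F^[m] Ω := fun m => (hF.iterate m).diff
  have hfd : ∀ N, DifferentiableOn ℂ (f N) Ω := fun N => by
    simp only [hf, mean]
    exact DifferentiableOn.fun_const_smul (DifferentiableOn.fun_sum fun m _ => hFd m) _
  have hfb : ∀ N, ∀ z ∈ Ω, ‖f N z‖ ≤ R := fun N z hz =>
    norm_mean_le (fun m => hR _ ((hF.iterate m).maps hz)) N
  set Q : En n → En n := ulim U f with hQ'
  have hQd : DifferentiableOn ℂ Q Ω := differentiableOn_ulim hΩ hfd hfb
  have hQ : ∀ z ∈ Ω, Tendsto (mean fun m => F^[m] z) U (𝓝 (Q z)) := fun z hz =>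
    tendsto_ulim (Eventually.of_forall fun N => hfb N z hz)
  clear_value Q
  have hC : 0 ≤ C := (norm_nonneg _).trans
    ((hch S le_rfl M.v₀ (mem_ball_self hr)).2 _ TangentMap.id)
  set q := 2 * (4 * C / (r / 2) ^ 2) with hq
  have hq0 : 0 ≤ q := by positivity
  obtain ⟨d, hd0, hdr, hdC⟩ : ∃ d > 0, d ≤ r / 8 ∧ q * d ≤ 1 / 2 := by
    refine ⟨min (r / 8) (1 / (2 * (q + 1))), by positivity, min_le_left _ _, ?_⟩
    refine (mul_le_mul_of_nonneg_left (min_le_right _ _) hq0).trans ?_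
    rw [mul_one_div, div_le_div_iff₀ (by positivity) (by norm_num)]
    linarith
  have hsmall : ∀ δ > 0, ∃ S₁, ∀ s ≥ S₁, ∀ m, ‖M.conj s F^[m] M.v₀ - M.v₀‖ ≤ δ := by
    intro δ hδ
    have h1 := (Metric.tendsto_nhds.mp (hK.tendsto_conj hp hF hM₀)) δ hδ
    rw [eventually_comap] at h1
    obtain ⟨S₁, hS₁⟩ := eventually_atTop.mp h1
    exact ⟨S₁, fun s hs m => by
      rw [← dist_eq_norm]; exact (hS₁ s hs (m, s) rfl).le⟩
  obtain ⟨S₁, hS₁⟩ := hsmall (d / 2) (by positivity)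
  set X := max S S₁ with hX
  have hX1 : 1 ≤ X := le_max_of_le_left hS
  set e : ℝ → En n := fun s => limUnder atTop fun j => Q^[j] (M.chart s M.v₀) with he
  have hlim : ∀ {s : ℝ} {x : En n} {c : ℝ},
      (∀ j : ℕ, ‖Q^[j] (M.chart s M.v₀) - x‖ ≤ c * (2 * d / 2 ^ j)) → e s = x := by
    intro s x c h
    refine Tendsto.limUnder_eq (tendsto_iff_norm_sub_tendsto_zero.mpr ?_)
    refine squeeze_zero (fun _ => norm_nonneg _) h ?_
    have := tendsto_pow_atTop_nhds_zero_of_lt_one (r := (1 / 2 : ℝ)) (by norm_num) (by norm_num)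
    have h3 := this.const_mul (c * (2 * d))
    rw [mul_zero] at h3
    refine h3.congr fun j => ?_
    rw [one_div, inv_pow]; ring
  have hpoint : ∀ s ≥ X, ∀ δ ≤ d, (∀ m, ‖M.conj s F^[m] M.v₀ - M.v₀‖ ≤ δ) →
      e s ∈ Ω ∧ F (e s) = e s ∧ ‖M.dil s⁻¹ (e s - p) - M.v₀‖ ≤ 2 * δ ∧
        ∀ j, Q^[j] (M.chart s M.v₀) ∈ Ω := by
    intro s hs δ hδ hm
    have hsS : S ≤ s := (le_max_left _ _).trans hs
    obtain ⟨h1, x, hx, hfix, hxu, hrate⟩ := exists_fixed_of_chart hU hF hQ (by linarith) (hch s hsS)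
      (mem_ball_self (by positivity)) (hδ.trans hdr)
      ((mul_le_mul_of_nonneg_left hδ hq0).trans hdC) hm
    have hδ0 : 0 ≤ δ := (norm_nonneg _).trans (hm 0)
    have : e s = x := hlim fun j => (hrate j).trans (by gcongr)
    rw [this]
    exact ⟨hx, hfix, hxu, h1⟩
  have hpoint' : ∀ s ≥ X, e s ∈ Ω ∧ F (e s) = e s ∧ ∀ j, Q^[j] (M.chart s M.v₀) ∈ Ω := fun s hs => by
    obtain ⟨h1, h2, -, h3⟩ := hpoint s hs (d / 2) (by linarith) (hS₁ s ((le_max_right _ _).trans hs))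
    exact ⟨h1, h2, h3⟩
  refine ⟨X, hX1, e, fun s hs => ContinuousAt.continuousWithinAt ?_,
    fun s hs => ⟨(hpoint' s hs).1, (hpoint' s hs).2.1⟩, ?_⟩
  · have hs0 : s ≠ 0 := by have : X ≤ s := hs
                           linarith
    have hsS : S ≤ s := (le_max_left _ _).trans hs
    have hcs : ContinuousAt (fun t : ℝ => M.chart t M.v₀) s := by
      have h1 : ContinuousAt (fun t : ℝ => ((t : ℂ)⁻¹ ^ 2) • M.v₀) s :=
        ((continuous_ofReal.continuousAt.inv₀ (by exact_mod_cast hs0)).pow 2).smul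
          continuousAt_const
      refine (h1.const_add p).congr (Eventually.of_forall fun t => ?_)
      simp only [chart, dil_apply, M.ℓ_v₀, M.tang_v₀, smul_zero, add_zero, mul_one]
    have hcu : Tendsto (fun t : ℝ => M.dil s⁻¹ (M.chart t M.v₀ - p)) (𝓝 s) (𝓝 M.v₀) := by
      have h1 := ((M.dil s⁻¹).continuous.tendsto _).comp (hcs.tendsto.sub_const p)
      rwa [M.dil_inv_chart hs0] at h1
    set δ := min (r / 4) (d / 2 / (2 * C / r + 1)) with hδ
    have hδ0 : 0 < δ := by positivity
    have hev : ∀ᶠ t in 𝓝 s, ∀ j, ‖Q^[j] (M.chart t M.v₀) - e t‖ ≤ ‖M.dil s‖ * (2 * d / 2 ^ j) := by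
      filter_upwards [hcu (ball_mem_nhds _ hδ0)] with t ht
      set u := M.dil s⁻¹ (M.chart t M.v₀ - p) with hu
      have hut : M.chart s u = M.chart t M.v₀ := M.chart_dil_inv hs0 _
      have hu4 : u ∈ ball M.v₀ (r / 4) := ball_subset_ball (min_le_left _ _) ht
      have hur : u ∈ ball M.v₀ r := ball_subset_ball (by linarith) hu4
      have hdu : ∀ m, ‖M.conj s F^[m] u - u‖ ≤ d := by
        intro m
        have h1 := norm_sub_le_of_bounded_holo (differentiableOn_conj (M := M) (s := s) (hFd m)
          (W := ball M.v₀ r) fun u hu => (hch s hsS u hu).1)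
          (fun u hu => (hch s hsS u hu).2 _ (hF.iterate m)) hur
        have h2 := hS₁ s ((le_max_right _ _).trans hs) m
        have h3 : ‖u - M.v₀‖ ≤ d / 2 / (2 * C / r + 1) := by
          have : ‖u - M.v₀‖ < δ := by rw [← dist_eq_norm]; exact ht
          exact this.le.trans (min_le_right _ _)
        rw [le_div_iff₀ (by positivity)] at h3
        have e1 : M.conj s F^[m] u - u = (M.conj s F^[m] u - M.conj s F^[m] M.v₀) +
          (M.conj s F^[m] M.v₀ - M.v₀) - (u - M.v₀) := by abel
        rw [e1]
        refine (norm_sub_le _ _).trans ((add_le_add (norm_add_le _ _) le_rfl).trans ?_)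
        linarith
      obtain ⟨-, x, -, -, -, hrate⟩ := exists_fixed_of_chart hU hF hQ hs0 (hch s hsS) hu4 hdr hdC hdu
      rw [hut] at hrate
      have : e t = x := hlim hrate
      rw [this]
      exact hrate
    have hQj : ∀ j, ContinuousAt (fun t : ℝ => Q^[j] (M.chart t M.v₀)) s := by
      intro j
      induction j with
      | zero => exact hcs
      | succ j ih =>
        have h1 : ContinuousAt Q (Q^[j] (M.chart s M.v₀)) :=
          (hQd.differentiableAt (hΩ.mem_nhds ((hpoint' s hs).2.2 j))).continuousAt
        simp only [iterate_succ_apply']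
        exact ContinuousAt.comp (f := fun t : ℝ => Q^[j] (M.chart t M.v₀)) h1 ih
    refine continuousAt_of_locally_uniform_approx_of_continuousAt fun V hV => ?_
    obtain ⟨ε, hε, hεV⟩ := Metric.mem_uniformity_dist.mp hV
    have htend : Tendsto (fun j : ℕ => ‖M.dil s‖ * (2 * d / 2 ^ j)) atTop (𝓝 0) := by
      have := tendsto_pow_atTop_nhds_zero_of_lt_one (r := (1 / 2 : ℝ)) (by norm_num) (by norm_num)
      have h3 := this.const_mul (‖M.dil s‖ * (2 * d))
      rw [mul_zero] at h3
      refine h3.congr fun j => ?_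
      rw [one_div, inv_pow]; ring
    obtain ⟨j, hj⟩ := (htend.eventually_lt_const hε).exists
    refine ⟨_, hev, fun t => Q^[j] (M.chart t M.v₀), hQj j, fun t ht => hεV ?_⟩
    rw [dist_comm, dist_eq_norm]
    exact (ht j).trans_lt hj
  · rw [Metric.tendsto_nhds]
    intro ε hε
    have hδ0 : 0 < min d (ε / 4) := lt_min hd0 (by positivity)
    obtain ⟨S₂, hS₂⟩ := hsmall _ hδ0
    filter_upwards [eventually_ge_atTop X, eventually_ge_atTop S₂] with s h1 h2
    have h3 := (hpoint s h1 _ (min_le_left _ _) (hS₂ s h2)).2.2.1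
    rw [dist_eq_norm]
    have := min_le_right d (ε / 4)
    linarith

end LocalModel

end

section

variable {n : ℕ} {Ω : Set (En n)} {p : En n}

/-- A bounded operator that almost fixes a vector and almost acts trivially modulo that vector has
no eigenvalue away from one. -/
theorem eq_zero_of_eigen_of_almost_id {E : Type*} [NormedAddCommGroup E] [NormedSpace ℂ E]
    {ℓ : E →L[ℂ] ℂ} {v : E} {L : E →L[ℂ] E} {D η : ℝ} (hD : ‖L‖ ≤ D)
    (hv : ‖L v - v‖ ≤ η) (ht : ∀ b, ‖(L b - b) - ℓ (L b - b) • v‖ ≤ η * ‖b‖) {μ : ℂ} (hμ : μ ≠ 1)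
    (hsmall : ‖ℓ‖ * η + (D + 1) * (η / ‖μ - 1‖) < ‖μ - 1‖) {b : E} (hb : L b = μ • b) : b = 0 := by
  by_contra hb0
  have hbn : 0 < ‖b‖ := norm_pos_iff.mpr hb0
  have hκ : 0 < ‖μ - 1‖ := norm_pos_iff.mpr (sub_ne_zero.mpr hμ)
  have hD0 : 0 ≤ D := (norm_nonneg _).trans hD
  have e1 : L b - b = (μ - 1) • b := by rw [hb, sub_smul, one_smul]
  set b' := b - ℓ b • v with hb'
  have h1 : ‖b'‖ ≤ η / ‖μ - 1‖ * ‖b‖ := by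
    have h2 := ht b
    have e2 : (L b - b) - ℓ (L b - b) • v = (μ - 1) • b' := by
      rw [e1, map_smul, smul_eq_mul, mul_smul, ← smul_sub]
    rw [e2, norm_smul] at h2
    rw [div_mul_eq_mul_div, le_div_iff₀ hκ]
    linarith
  have e3 : (μ - 1) • b = ℓ b • (L v - v) + (L b' - b') := by
    rw [← e1, hb', map_sub, map_smul, smul_sub]; abel
  have h2 : ‖μ - 1‖ * ‖b‖ ≤ ‖ℓ‖ * ‖b‖ * η + (D * ‖b'‖ + ‖b'‖) := by
    rw [← norm_smul, e3]
    refine (norm_add_le _ _).trans (add_le_add ?_ ?_)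
    · rw [norm_smul]
      exact mul_le_mul (ℓ.le_opNorm b) hv (norm_nonneg _) (by positivity)
    · refine (norm_sub_le _ _).trans (add_le_add ?_ le_rfl)
      exact (L.le_opNorm b').trans (mul_le_mul_of_nonneg_right hD (norm_nonneg _))
  have h3 : (D + 1) * ‖b'‖ ≤ (D + 1) * (η / ‖μ - 1‖ * ‖b‖) := by gcongr
  nlinarith [mul_lt_mul_of_pos_right hsmall hbn]

namespace LocalModel

variable {M : LocalModel Ω p} {K : ℝ} {F : En n → En n}

theorem dil_mul (M : LocalModel Ω p) (s t : ℝ) (u : En n) :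
    M.dil s (M.dil t u) = M.dil (s * t) u := by
  rw [M.dil_apply s, ℓ_dil, tang_dil, M.dil_apply (s * t), ofReal_mul, smul_smul, ← mul_assoc,
    ← mul_pow, ← mul_inv]

/-- Tangency to the identity in the charts: tangential coordinates are almost preserved. -/
theorem tendsto_tang_conj (hF : TangentMap Ω p F) {r S : ℝ}
    (hch : ∀ s ≥ S, ∀ u ∈ ball M.v₀ r, M.chart s u ∈ Ω) {η : ℝ} (hη : 0 < η) :
    ∀ᶠ s in atTop, ∀ u ∈ ball M.v₀ r, ‖M.tang (M.conj s F u) - M.tang u‖ ≤ η := by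
  set A := (‖M.ℓ‖ * ‖M.v₀‖ + ‖M.tang‖) * (‖M.v₀‖ + |r|) with hA
  have hA0 : 0 ≤ A := by positivity
  set η' := η / (‖M.tang‖ * A + 1) with hη'
  have hη'0 : 0 < η' := by positivity
  have hη'e : η' * (‖M.tang‖ * A + 1) = η := by rw [hη']; field_simp
  clear_value η'
  obtain ⟨δ, hδ, hT⟩ := hF.tangent η' hη'0
  filter_upwards [eventually_ge_atTop S, eventually_ge_atTop 1, eventually_gt_atTop (A / δ)]
    with s hsS hs1 hsδ u hu
  have hs0 : 0 < s := by linarith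
  have hsc : (s : ℂ) ≠ 0 := by exact_mod_cast hs0.ne'
  have hun : ‖u‖ ≤ ‖M.v₀‖ + |r| := by
    rw [mem_ball, dist_eq_norm] at hu
    have := norm_le_norm_add_norm_sub' u M.v₀
    linarith [le_abs_self r]
  set z := M.chart s u with hz
  have hzp : ‖z - p‖ ≤ s⁻¹ * A := by
    rw [hz, chart, add_sub_cancel_left]
    refine (M.norm_dil_le hs1 u).trans ?_
    rw [hA]; gcongr
  have hzδ : ‖z - p‖ < δ := by
    refine hzp.trans_lt ?_
    rw [div_lt_iff₀ hδ] at hsδ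
    rw [inv_mul_lt_iff₀ hs0]; exact hsδ
  have h1 := hT z (hch s hsS u hu) hzδ
  have e1 : M.tang (M.conj s F u) - M.tang u = (s : ℂ) • M.tang (F z - z) := by
    have e2 : M.tang u = (s : ℂ) • M.tang (z - p) := by
      rw [hz, chart, add_sub_cancel_left, tang_dil, smul_smul, mul_inv_cancel₀ hsc, one_smul]
    rw [e2, conj, ← hz, tang_dil, ofReal_inv, inv_inv, ← smul_sub, ← map_sub,
      sub_sub_sub_cancel_right]
  rw [e1, norm_smul, norm_real, Real.norm_of_nonneg hs0.le]
  calc s * ‖M.tang (F z - z)‖ ≤ s * (‖M.tang‖ * (η' * (s⁻¹ * A))) := by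
        gcongr
        exact (M.tang.le_opNorm _).trans (mul_le_mul_of_nonneg_left
          (h1.trans (by gcongr)) (norm_nonneg _))
    _ = η' * (‖M.tang‖ * A) := by field_simp
    _ ≤ η := by rw [← hη'e]; nlinarith

/-- In the charts of large scale a tangent map almost fixes the axis. -/
theorem Julia.tendsto_conj_axis (hK : M.Julia K) (hp : p ∉ Ω) (hF : TangentMap Ω p F) {M₀ : ℝ}
    (hM₀ : ∀ m, ‖M.w (F^[m] (M.ray K 1))‖ ≤ M₀) {a : ℝ} (ha : 0 < a) :
    Tendsto (fun s => M.conj s F (M.dil a M.v₀)) atTop (𝓝 (M.dil a M.v₀)) := by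
  have hg : Tendsto (fun s : ℝ => ((1 : ℕ), s * a)) atTop (comap Prod.snd atTop) := by
    rw [tendsto_comap_iff]; exact tendsto_id.atTop_mul_const ha
  have h1 := ((M.dil a).continuous.tendsto _).comp ((hK.tendsto_conj hp hF hM₀).comp hg)
  refine h1.congr' ?_
  filter_upwards [eventually_gt_atTop 0] with s hs
  simp only [Function.comp_apply, conj, iterate_one, chart, dil_mul]
  congr 3
  field_simp

set_option maxHeartbeats 1000000 in
/-- Along a curve of fixed points tending to the boundary point along the axis, a given number
different from one is eventually not an eigenvalue of the derivative. -/
theorem Julia.eventually_no_eigen (hK : M.Julia K) (hΩ : IsOpen Ω)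
    (hp : p ∉ Ω) (hF : TangentMap Ω p F) {M₀ : ℝ} (hM₀ : ∀ m, ‖M.w (F^[m] (M.ray K 1))‖ ≤ M₀)
    {e : ℝ → En n} (he : ∀ᶠ s in atTop, e s ∈ Ω ∧ F (e s) = e s)
    (hlim : Tendsto (fun s => M.dil s⁻¹ (e s - p)) atTop (𝓝 M.v₀)) {μ : ℂ} (hμ : μ ≠ 1) :
    ∀ᶠ s in atTop, ∀ b, fderiv ℂ F (e s) b = μ • b → b = 0 := by
  obtain ⟨r, hr, C, S, hS, hch⟩ := hK.exists_chart
  have hC : 0 ≤ C := (norm_nonneg _).trans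
    ((hch S le_rfl M.v₀ (mem_ball_self hr)).2 _ TangentMap.id)
  set D := 2 * C / (r / 2) with hD
  set q := 4 * C / (r / 2) ^ 2 with hq
  have hD0 : 0 ≤ D := by positivity
  have hq0 : 0 ≤ q := by positivity
  set κ := ‖μ - 1‖ with hκ
  have hκ0 : 0 < κ := norm_pos_iff.mpr (sub_ne_zero.mpr hμ)
  obtain ⟨η, hη, hsmall⟩ : ∃ η > 0, ‖M.ℓ‖ * η + (D + 1) * (η / κ) < κ := by
    refine ⟨κ / (‖M.ℓ‖ + (D + 1) / κ + 1), by positivity, ?_⟩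
    set Z := ‖M.ℓ‖ + (D + 1) / κ with hZ
    have hZ0 : 0 ≤ Z := by positivity
    have e1 : ‖M.ℓ‖ * (κ / (Z + 1)) + (D + 1) * (κ / (Z + 1) / κ) = Z * κ / (Z + 1) := by
      rw [hZ]; field_simp
    rw [e1, div_lt_iff₀ (by positivity)]
    nlinarith
  -- a point of the axis close to the centre
  obtain ⟨t, ht0, htr, htq⟩ : ∃ t > 0, t * ‖M.v₀‖ < r / 4 ∧ q * ‖M.v₀‖ ^ 2 * t < η := by
    refine ⟨min (r / 4 / (‖M.v₀‖ + 1)) (η / (q * ‖M.v₀‖ ^ 2 + 1)), by positivity, ?_, ?_⟩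
    · refine (mul_le_mul_of_nonneg_right (min_le_left _ _) (norm_nonneg _)).trans_lt ?_
      rw [div_mul_eq_mul_div, div_lt_iff₀ (by positivity)]
      nlinarith [norm_nonneg M.v₀]
    · refine (mul_le_mul_of_nonneg_left (min_le_right _ _) (by positivity)).trans_lt ?_
      rw [mul_div_assoc', div_lt_iff₀ (by positivity)]
      nlinarith
  set a := (√(1 + t))⁻¹ with ha
  have ha0 : 0 < a := by positivity
  have hav : M.dil a M.v₀ = M.v₀ + (t : ℂ) • M.v₀ := by
    rw [dil_apply, M.ℓ_v₀, M.tang_v₀, smul_zero, add_zero, mul_one, ← ofReal_inv, ha, inv_inv,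
      ← ofReal_pow, Real.sq_sqrt (by positivity), ofReal_add, ofReal_one, add_smul, one_smul]
  have hy := hK.tendsto_conj_axis hp hF hM₀ ha0
  set y := M.dil a M.v₀ with hy'
  clear_value y
  have hyn : Tendsto (fun s => ‖M.conj s F y - y‖) atTop (𝓝 0) :=
    tendsto_iff_norm_sub_tendsto_zero.mp hy
  have hδn : Tendsto (fun s => ‖M.v₀ - M.dil s⁻¹ (e s - p)‖) atTop (𝓝 0) := by
    simp only [norm_sub_rev M.v₀]
    exact tendsto_iff_norm_sub_tendsto_zero.mp hlim
  have herr : Tendsto (fun s => ‖M.conj s F y - y‖ +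
      q * (t * ‖M.v₀‖ + ‖M.v₀ - M.dil s⁻¹ (e s - p)‖) ^ 2 +
      (D + 1) * ‖M.v₀ - M.dil s⁻¹ (e s - p)‖) atTop (𝓝 (0 + q * (t * ‖M.v₀‖ + 0) ^ 2 +
      (D + 1) * 0)) :=
    (hyn.add (((hδn.const_add _).pow 2).const_mul q)).add (hδn.const_mul _)
  have hlt : 0 + q * (t * ‖M.v₀‖ + 0) ^ 2 + (D + 1) * 0 < t * η := by nlinarith
  filter_upwards [he, herr.eventually_lt_const hlt, eventually_ge_atTop S,
    hδn.eventually_lt_const (show 0 < r / 4 by positivity),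
    tendsto_tang_conj hF (fun s hs u hu => (hch s hs u hu).1) (η := η * (r / 4)) (by positivity)]
    with s hes herrs hsS hδs htang b hb
  have hs0 : s ≠ 0 := by linarith
  set G := M.conj s F with hG
  set u := M.dil s⁻¹ (e s - p) with hu
  have hcu : M.chart s u = e s := M.chart_dil_inv hs0 _
  have hur : ball u (r / 2) ⊆ ball M.v₀ r := by
    refine ball_subset_ball' ?_
    rw [dist_comm, dist_eq_norm]; linarith
  have hGd : DifferentiableOn ℂ G (ball u (r / 2)) :=
    differentiableOn_conj hF.diff fun x hx => (hch s hsS x (hur hx)).1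
  have hGb : ∀ x ∈ ball u (r / 2), ‖G x‖ ≤ C := fun x hx => (hch s hsS x (hur hx)).2 _ hF
  have hGu : G u = u := by rw [hG, conj, hcu, hes.2]
  have huu : u ∈ ball u (r / 2) := mem_ball_self (by positivity)
  have hGdu : DifferentiableAt ℂ G u := hGd.differentiableAt (isOpen_ball.mem_nhds huu)
  set L := fderiv ℂ G u with hL
  have hLn : ‖L‖ ≤ D := norm_fderiv_le_of_bounded_holo (by positivity) hGd hGb
  have hLv : ‖L M.v₀ - M.v₀‖ ≤ η := by
    have hyu : y - u = (t : ℂ) • M.v₀ + (M.v₀ - u) := by rw [hav]; abel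
    have hyun : ‖y - u‖ ≤ t * ‖M.v₀‖ + ‖M.v₀ - u‖ := by
      rw [hyu]
      refine (norm_add_le _ _).trans (le_of_eq ?_)
      rw [norm_smul, norm_real, Real.norm_of_nonneg ht0.le]
    have h1 := norm_taylor_le_of_bounded_holo hGd hGb (y := y)
      (by rw [mem_ball, dist_eq_norm]; linarith)
    have e1 : (t : ℂ) • (L M.v₀ - M.v₀) = (G y - y) - (G y - G u - L (y - u)) -
        (L (M.v₀ - u) - (M.v₀ - u)) := by
      rw [hGu, hyu, map_add, map_smul, smul_sub, hav]; abel
    have h2 : t * ‖L M.v₀ - M.v₀‖ ≤ t * η := by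
      have e2 : t * ‖L M.v₀ - M.v₀‖ = ‖(t : ℂ) • (L M.v₀ - M.v₀)‖ := by
        rw [norm_smul, norm_real, Real.norm_of_nonneg ht0.le]
      rw [e2, e1]
      refine (norm_sub_le _ _).trans ((add_le_add (norm_sub_le _ _) (norm_sub_le _ _)).trans
        (le_trans ?_ herrs.le))
      have h3 : ‖L (M.v₀ - u)‖ ≤ D * ‖M.v₀ - u‖ :=
        (L.le_opNorm _).trans (mul_le_mul_of_nonneg_right hLn (norm_nonneg _))
      have h4 : q * ‖y - u‖ ^ 2 ≤ q * (t * ‖M.v₀‖ + ‖M.v₀ - u‖) ^ 2 := by gcongr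
      linarith
    exact le_of_mul_le_mul_left h2 ht0
  have hLt : ∀ x, ‖(L x - x) - M.ℓ (L x - x) • M.v₀‖ ≤ η * ‖x‖ := by
    intro x
    have hHd : DifferentiableOn ℂ (fun x => M.tang (G x) - M.tang x) (ball u (r / 2)) :=
      (M.tang.differentiable.comp_differentiableOn hGd).sub M.tang.differentiable.differentiableOn
    have h1 := norm_fderiv_le_of_bounded_holo (by positivity) hHd
      fun x hx => htang x (hur hx)
    have h2 : HasFDerivAt (fun x => M.tang (G x) - M.tang x) (M.tang.comp L - M.tang) u :=
      (M.tang.hasFDerivAt.comp u hGdu.hasFDerivAt).sub M.tang.hasFDerivAt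
    rw [h2.fderiv] at h1
    have h3 : 2 * (η * (r / 4)) / (r / 2) = η := by field_simp; ring
    rw [h3] at h1
    have e1 : (L x - x) - M.ℓ (L x - x) • M.v₀ = (M.tang.comp L - M.tang) x := by
      rw [← M.tang_apply, map_sub]; rfl
    rw [e1]
    exact (ContinuousLinearMap.le_opNorm _ _).trans (mul_le_mul_of_nonneg_right h1 (norm_nonneg _))
  have hLb : L (M.dil s⁻¹ b) = μ • M.dil s⁻¹ b := by
    have hFd : HasFDerivAt F (fderiv ℂ F (e s)) (M.chart s u) := by
      rw [hcu]; exact (hF.diff.differentiableAt (hΩ.mem_nhds hes.1)).hasFDerivAt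
    have hcd : HasFDerivAt (M.chart s) (M.dil s) u := (M.dil s).hasFDerivAt.const_add p
    have h1 : HasFDerivAt G ((M.dil s⁻¹).comp ((fderiv ℂ F (e s)).comp (M.dil s))) u :=
      (M.dil s⁻¹).hasFDerivAt.comp u ((hFd.comp u hcd).sub_const p)
    rw [hL, h1.fderiv]
    simp only [ContinuousLinearMap.comp_apply]
    rw [M.dil_dil_inv hs0, hb, map_smul]
  have h5 := eq_zero_of_eigen_of_almost_id hLn hLv hLt hμ hsmall hLb
  rw [← M.dil_dil_inv hs0 b, h5, map_zero]

end LocalModel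

end

section PowerBounded

variable {E : Type*} [NormedAddCommGroup E] [NormedSpace ℂ E] {L P : E →L[ℂ] E} {C : ℝ} {μ : ℂ}
  {U : Filter ℕ}

theorem tendsto_mean_apply
    (hP : Tendsto (mean fun m => (μ⁻¹) ^ m • L ^ m) U (𝓝 P)) (b : E) :
    Tendsto (mean fun m => (μ⁻¹) ^ m • (L ^ m) b) U (𝓝 (P b)) := by
  have h1 := ((ContinuousLinearMap.apply ℂ E b).continuous.tendsto P).comp hP
  refine h1.congr fun N => ?_
  simp only [Function.comp_apply, map_mean]
  rfl

/-- Averages of the rotated powers fix the eigenvectors. -/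
theorem mean_limit_apply_eigen [U.NeBot] (hU : U ≤ atTop) (hμ : ‖μ‖ = 1)
    (hP : Tendsto (mean fun m => (μ⁻¹) ^ m • L ^ m) U (𝓝 P)) {b : E} (hb : L b = μ • b) :
    P b = b := by
  have hμ0 : μ ≠ 0 := by rintro rfl; simp at hμ
  have h1 : ∀ m, (μ⁻¹) ^ m • (L ^ m) b = b := by
    have h2 : ∀ m, (L ^ m) b = μ ^ m • b := by
      intro m
      induction m with
      | zero => simp
      | succ m ih =>
        rw [pow_succ', mul_apply_eq_comp, ih, map_smul, hb, smul_smul, pow_succ]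
    intro m
    rw [h2, smul_smul, ← mul_pow, inv_mul_cancel₀ hμ0, one_pow, one_smul]
  have h3 := tendsto_mean_apply hP b
  simp only [h1] at h3
  refine tendsto_nhds_unique h3 ((tendsto_const_nhds (x := b)).congr' ?_)
  filter_upwards [hU (eventually_gt_atTop 0)] with N hN
  exact (mean_const b hN).symm

/-- Averages of the rotated powers take values in the eigenspace. -/
theorem eigen_mean_limit_apply [U.NeBot] (hU : U ≤ atTop) (hμ : ‖μ‖ = 1) (hC : ∀ m, ‖L ^ m‖ ≤ C)
    (hP : Tendsto (mean fun m => (μ⁻¹) ^ m • L ^ m) U (𝓝 P)) (b : E) : L (P b) = μ • P b := by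
  have hμ0 : μ ≠ 0 := by rintro rfl; simp at hμ
  have h1 := tendsto_mean_apply hP b
  have h2 : ∀ m, ‖(μ⁻¹) ^ m • (L ^ m) b‖ ≤ C * ‖b‖ := by
    intro m
    rw [norm_smul, norm_pow, norm_inv, hμ, inv_one, one_pow, one_mul]
    exact ((L ^ m).le_opNorm b).trans (mul_le_mul_of_nonneg_right (hC m) (norm_nonneg _))
  have h3 := tendsto_mean_shift_one h2 hU h1
  have h4 : Tendsto (fun N => (μ⁻¹ • L) (mean (fun m => (μ⁻¹) ^ m • (L ^ m) b) N)) U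
      (𝓝 ((μ⁻¹ • L) (P b))) := ((μ⁻¹ • L).continuous.tendsto _).comp h1
  have h5 : (mean fun m => (μ⁻¹) ^ (m + 1) • (L ^ (m + 1)) b) =
      fun N => (μ⁻¹ • L) (mean (fun m => (μ⁻¹) ^ m • (L ^ m) b) N) := by
    funext N
    rw [map_mean]
    congr 1
    funext m
    rw [pow_succ', pow_succ', mul_apply_eq_comp, _root_.smul_apply, map_smul, smul_smul]
  rw [h5] at h3
  have h6 := tendsto_nhds_unique h4 h3
  conv_rhs => rw [← h6, _root_.smul_apply, smul_smul, mul_inv_cancel₀ hμ0, one_smul]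

theorem one_le_norm_of_apply_eq {b : E} (hb : b ≠ 0) (h : P b = b) : 1 ≤ ‖P‖ := by
  have h1 := P.le_opNorm b
  rw [h] at h1
  have := norm_pos_iff.mpr hb
  by_contra! hlt
  nlinarith

end PowerBounded

section FixedPoint

variable {n : ℕ} {Ω : Set (En n)} {F : En n → En n}

theorem hasFDerivAt_iterate (hΩ : IsOpen Ω) (hF : DifferentiableOn ℂ F Ω) {x : En n} (hx : x ∈ Ω)
    (hfix : F x = x) (m : ℕ) : HasFDerivAt F^[m] (fderiv ℂ F x ^ m) x :=
  (hF.differentiableAt (hΩ.mem_nhds hx)).hasFDerivAt.iterate hfix m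

theorem differentiableOn_iterate (hF : DifferentiableOn ℂ F Ω) (hm : MapsTo F Ω Ω) (m : ℕ) :
    DifferentiableOn ℂ F^[m] Ω := by
  induction m with
  | zero => exact differentiableOn_id
  | succ m ih => rw [iterate_succ']; exact hF.comp ih (hm.iterate m)

theorem exists_norm_fderiv_pow_le (hΩ : IsOpen Ω) (hbd : Bornology.IsBounded Ω)
    (hF : DifferentiableOn ℂ F Ω) (hm : MapsTo F Ω Ω) {x : En n} (hx : x ∈ Ω) (hfix : F x = x) :
    ∃ C, ∀ m, ‖fderiv ℂ F x ^ m‖ ≤ C := by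
  obtain ⟨B, hB⟩ := hbd.exists_norm_le
  obtain ⟨R, hR, hRΩ⟩ := Metric.isOpen_iff.mp hΩ x hx
  refine ⟨2 * B / R, fun m => ?_⟩
  rw [← (hasFDerivAt_iterate hΩ hF hx hfix m).fderiv]
  exact norm_fderiv_le_of_bounded_holo hR ((differentiableOn_iterate hF hm m).mono hRΩ)
    fun y hy => hB _ (hm.iterate m (hRΩ hy))

/-- On a connected family of fixed points, a unimodular number is an eigenvalue of the derivative
at all points or at none. -/
theorem no_eigen_of_eventually_no_eigen (hΩ : IsOpen Ω) (hbd : Bornology.IsBounded Ω)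
    (hF : DifferentiableOn ℂ F Ω) (hm : MapsTo F Ω Ω) {X : ℝ} {e : ℝ → En n}
    (hec : ContinuousOn e (Ici X)) (he : ∀ s ∈ Ici X, e s ∈ Ω ∧ F (e s) = e s) {μ : ℂ}
    (hμ : ‖μ‖ = 1) (hev : ∀ᶠ s in atTop, ∀ b, fderiv ℂ F (e s) b = μ • b → b = 0) :
    ∀ s ∈ Ici X, ∀ b, fderiv ℂ F (e s) b = μ • b → b = 0 := by
  obtain ⟨B, hB⟩ := hbd.exists_norm_le
  let V : Ultrafilter ℕ := hyperfilter ℕ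
  have hV : (V : Filter ℕ) ≤ atTop := Nat.hyperfilter_le_atTop
  let f : ℕ → En n → En n := fun N z => mean (fun m => (μ⁻¹) ^ m • F^[m] z) N
  have hfd : ∀ N, DifferentiableOn ℂ (f N) Ω := fun N =>
    (DifferentiableOn.fun_sum fun m _ =>
      (differentiableOn_iterate hF hm m).fun_const_smul _).fun_const_smul _
  have hfB : ∀ N, ∀ z ∈ Ω, ‖f N z‖ ≤ B := fun N z hz => norm_mean_le (fun m => by
    rw [norm_smul, norm_pow, norm_inv, hμ, inv_one, one_pow, one_mul]
    exact hB _ (hm.iterate m hz)) N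
  have hΦ : DifferentiableOn ℂ (ulim V f) Ω := differentiableOn_ulim hΩ hfd hfB
  have hΦB : ∀ z ∈ Ω, ‖ulim V f z‖ ≤ B := fun z hz =>
    le_of_tendsto (tendsto_ulim (Eventually.of_forall fun N => hfB N z hz)).norm
      (Eventually.of_forall fun N => hfB N z hz)
  let P : ℝ → En n →L[ℂ] En n := fun s => fderiv ℂ (ulim V f) (e s)
  have hPlim : ∀ s ∈ Ici X,
      Tendsto (mean fun m => (μ⁻¹) ^ m • fderiv ℂ F (e s) ^ m) V (𝓝 (P s)) := by
    intro s hs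
    refine (tendsto_fderiv_ulim hΩ hfd hfB (he s hs).1).congr fun N => ?_
    exact HasFDerivAt.fderiv (HasFDerivAt.fun_const_smul (HasFDerivAt.fun_sum fun m _ =>
      (hasFDerivAt_iterate hΩ hF (he s hs).1 (he s hs).2 m).fun_const_smul _) _)
  have hPc : ContinuousOn (fun s => ‖P s‖) (Ici X) := by
    refine ContinuousOn.norm ?_
    rw [continuousOn_clm_apply]
    intro a
    exact (differentiableOn_fderiv_apply hΩ hΦ hΦB a).continuousOn.comp hec fun s hs => (he s hs).1
  have hdich : ∀ s ∈ Ici X, P s = 0 ∨ 1 ≤ ‖P s‖ := by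
    intro s hs
    by_cases h0 : P s = 0
    · exact Or.inl h0
    · right
      obtain ⟨b, hb⟩ : ∃ b, P s b ≠ 0 := by
        by_contra! h; exact h0 (ContinuousLinearMap.ext h)
      obtain ⟨C, hC⟩ := exists_norm_fderiv_pow_le hΩ hbd hF hm (he s hs).1 (he s hs).2
      exact one_le_norm_of_apply_eq hb
        (mean_limit_apply_eigen hV hμ (hPlim s hs) (eigen_mean_limit_apply hV hμ hC (hPlim s hs) b))
  have hzero : ∀ s ∈ Ici X, P s = 0 := by
    intro s hs
    refine (hdich s hs).resolve_right fun hge => ?_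
    obtain ⟨t, ht, htX⟩ := (hev.and (eventually_ge_atTop X)).exists
    have htP : ‖P t‖ = 0 := by
      rw [norm_eq_zero]
      obtain ⟨C, hC⟩ := exists_norm_fderiv_pow_le hΩ hbd hF hm (he t htX).1 (he t htX).2
      exact ContinuousLinearMap.ext fun b => ht _ (eigen_mean_limit_apply hV hμ hC (hPlim t htX) b)
    obtain ⟨q, hq, hqe⟩ := isPreconnected_Ici.intermediate_value (show t ∈ Ici X from htX) hs hPc
      (show (1 / 2 : ℝ) ∈ Icc ‖P t‖ ‖P s‖ from ⟨by rw [htP]; norm_num, by linarith⟩)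
    simp only at hqe
    rcases hdich q hq with h | h
    · rw [h, norm_zero] at hqe; norm_num at hqe
    · linarith
  intro s hs b hb
  rw [← mean_limit_apply_eigen hV hμ (hPlim s hs) hb, hzero s hs, _root_.zero_apply]

end FixedPoint

section Idempotent

attribute [local instance] Ultrafilter.add Ultrafilter.addSemigroup

theorem exists_idempotent_ultrafilter : ∃ U : Ultrafilter ℕ+, ∀ q : ℕ+ → Prop,
    (∀ᶠ m in (U : Filter ℕ+), q m) → ∀ᶠ m in (U : Filter ℕ+), ∀ᶠ k in (U : Filter ℕ+), q (m + k) := by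
  obtain ⟨U, hU⟩ := exists_idempotent_of_compact_t2_of_continuous_add_left
    (M := Ultrafilter ℕ+) Ultrafilter.continuous_add_left
  refine ⟨U, fun q hq => ?_⟩
  rw [← Ultrafilter.eventually_add, hU]
  exact hq

end Idempotent

section Linear

variable {E : Type*} [NormedAddCommGroup E] [NormedSpace ℂ E] [FiniteDimensional ℂ E]
  {L R : E →L[ℂ] E} {C : ℝ} {U : Ultrafilter ℕ+}

/-- A power bounded operator without unimodular eigenvalues except one acts trivially on the range
of an idempotent limit of its powers. -/
theorem mul_limit_eq_of_no_eigen (hR : Tendsto (fun m : ℕ+ => L ^ (m : ℕ)) U (𝓝 R))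
    (hRR : R * R = R) (hC : ∀ m, ‖L ^ m‖ ≤ C)
    (hμ : ∀ μ : ℂ, ‖μ‖ = 1 → μ ≠ 1 → ∀ b, L b = μ • b → b = 0) : L * R = R := by
  have hcomm : L * R = R * L := by
    refine tendsto_nhds_unique (hR.const_mul L) ((hR.mul_const L).congr fun m => ?_)
    rw [← pow_succ, ← pow_succ']
  have happ : ∀ b, Tendsto (fun m : ℕ+ => (L ^ (m : ℕ)) b) U (𝓝 (R b)) := fun b =>
    ((ContinuousLinearMap.apply ℂ E b).continuous.tendsto R).comp hR
  have hpow : ∀ (ν : ℂ) (a : E), L a = ν • a → ∀ m : ℕ, (L ^ m) a = ν ^ m • a := by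
    intro ν a ha m
    induction m with
    | zero => simp
    | succ m ih => rw [pow_succ', mul_apply_eq_comp, ih, map_smul, ha, smul_smul, pow_succ]
  by_contra hne
  set T : E →L[ℂ] E := (L - 1) * R with hT
  have hT0 : T ≠ 0 := by rw [hT, sub_mul, one_mul]; exact sub_ne_zero.mpr hne
  have hLT : L * T = T * L := by
    rw [hT, mul_assoc, ← hcomm]; noncomm_ring
  have hRT : R * T = T := by
    calc R * ((L - 1) * R) = R * L * R - R * R := by noncomm_ring
      _ = L * (R * R) - R * R := by rw [← hcomm, mul_assoc]
      _ = (L - 1) * R := by rw [hRR, sub_mul, one_mul]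
  let S : Submodule ℂ E := LinearMap.range (T : E →ₗ[ℂ] E)
  have hS : ∀ x ∈ S, (L : E →ₗ[ℂ] E) x ∈ S := by
    rintro _ ⟨u, rfl⟩
    exact ⟨L u, (DFunLike.congr_fun hLT u).symm⟩
  obtain ⟨u₀, hu₀⟩ : ∃ b, T b ≠ 0 := by
    by_contra! h; exact hT0 (ContinuousLinearMap.ext h)
  have : Nontrivial S := ⟨⟨⟨T u₀, u₀, rfl⟩, 0, fun h => hu₀ (congrArg Subtype.val h)⟩⟩
  obtain ⟨ν, hν⟩ := Module.End.exists_eigenvalue ((L : E →ₗ[ℂ] E).restrict hS)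
  obtain ⟨⟨a, u, rfl⟩, ha⟩ := hν.exists_hasEigenvector
  have ha0 : T u ≠ 0 := fun h => ha.2 (Subtype.ext h)
  have haL : L (T u) = ν • T u := congrArg Subtype.val ha.apply_eq_smul
  have han : 0 < ‖T u‖ := norm_pos_iff.mpr ha0
  have hRa : R (T u) = T u := DFunLike.congr_fun hRT u
  have h1 := (happ (T u)).norm
  simp only [hpow ν _ haL, hRa, norm_smul, norm_pow] at h1
  have hν1 : ‖ν‖ = 1 := by
    rcases lt_trichotomy ‖ν‖ 1 with h | h | h
    · have h2 : ‖T u‖ ≤ ‖ν‖ * ‖T u‖ := le_of_tendsto h1 (Eventually.of_forall fun m =>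
        mul_le_mul_of_nonneg_right (pow_le_of_le_one (norm_nonneg _) h.le m.pos.ne') han.le)
      nlinarith
    · exact h
    · have h2 : ‖ν‖ * ‖T u‖ ≤ ‖T u‖ := ge_of_tendsto h1 (Eventually.of_forall fun m =>
        mul_le_mul_of_nonneg_right (le_self_pow₀ h.le m.pos.ne') han.le)
      nlinarith
  have hνe : ν = 1 := by
    by_contra h
    exact ha0 (hμ ν hν1 h _ haL)
  subst hνe
  rw [one_smul] at haL
  have hb : L (R u) = R u + T u := by
    rw [hT, mul_apply_eq_comp, _root_.sub_apply, one_apply_eq_self]; abel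
  have hLm : ∀ m : ℕ, (L ^ m) (R u) = R u + (m : ℂ) • T u := by
    intro m
    induction m with
    | zero => simp
    | succ m ih =>
      rw [pow_succ', mul_apply_eq_comp, ih, map_add, map_smul, haL, hb, Nat.cast_succ, add_smul,
        one_smul]
      abel
  obtain ⟨m, hm⟩ := exists_nat_gt ((C * ‖R u‖ + ‖R u‖) / ‖T u‖)
  rw [div_lt_iff₀ han] at hm
  have h3 : ‖(m : ℂ) • T u‖ ≤ C * ‖R u‖ + ‖R u‖ := by
    have e1 : (m : ℂ) • T u = (L ^ m) (R u) - R u := by rw [hLm]; abel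
    rw [e1]
    refine (norm_sub_le _ _).trans (add_le_add ?_ le_rfl)
    exact ((L ^ m).le_opNorm _).trans (mul_le_mul_of_nonneg_right (hC m) (norm_nonneg _))
  rw [norm_smul, _root_.norm_natCast] at h3
  linarith

end Linear

section Retraction

variable {n : ℕ} {Ω : Set (En n)} {F : En n → En n}

set_option maxHeartbeats 1000000 in
/-- A self-map with a fixed point at which the derivative has no unimodular eigenvalues except one
has a holomorphic retraction onto its fixed point set. -/
theorem exists_retraction {ρ : En n → ℝ} (hρ : IsPcxCinfBoundary Ω ρ) (hΩ : IsOpen Ω)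
    (hΩc : IsPreconnected Ω) (hbd : Bornology.IsBounded Ω) (hF : DifferentiableOn ℂ F Ω)
    (hm : MapsTo F Ω Ω) {x : En n} (hx : x ∈ Ω) (hfix : F x = x)
    (hμ : ∀ μ : ℂ, ‖μ‖ = 1 → μ ≠ 1 → ∀ b, fderiv ℂ F x b = μ • b → b = 0) :
    ∃ r : En n → En n, DifferentiableOn ℂ r Ω ∧ MapsTo r Ω Ω ∧ (∀ z ∈ Ω, r (r z) = r z) ∧
      (∀ z ∈ Ω, F (r z) = r z) ∧ ∀ z ∈ Ω, F z = z → r z = z := by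
  obtain ⟨B, hB⟩ := hbd.exists_norm_le
  obtain ⟨U, hU⟩ := exists_idempotent_ultrafilter
  have hdi := differentiableOn_iterate hF hm
  let f : ℕ+ → En n → En n := fun m => F^[(m : ℕ)]
  have hfd : ∀ m, DifferentiableOn ℂ (f m) Ω := fun m => hdi m
  have hfB : ∀ m, ∀ z ∈ Ω, ‖f m z‖ ≤ B := fun m z hz => hB _ (hm.iterate m hz)
  set r := ulim U f with hr
  have hrd : DifferentiableOn ℂ r Ω := differentiableOn_ulim hΩ hfd hfB
  have hlim : ∀ z ∈ Ω, Tendsto (fun m : ℕ+ => F^[(m : ℕ)] z) U (𝓝 (r z)) := fun z hz =>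
    tendsto_ulim (Eventually.of_forall fun m => hfB m z hz)
  have hRlim := tendsto_fderiv_ulim (U := U) hΩ hfd hfB hx
  rw [← hr] at hRlim
  clear_value r
  have hrfix : ∀ z ∈ Ω, F z = z → r z = z := by
    intro z hz hzf
    refine tendsto_nhds_unique (hlim z hz) ((tendsto_const_nhds (x := z)).congr fun m => ?_)
    exact (iterate_fixed hzf _).symm
  have hrcl : MapsTo r Ω (closure Ω) := fun z hz =>
    mem_closure_of_tendsto (hlim z hz) (Eventually.of_forall fun m => hm.iterate m hz)
  have hrm : MapsTo r Ω Ω := by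
    intro z hz
    by_contra hrz
    have h1 : r z ∈ frontier Ω := by rw [hΩ.frontier_eq]; exact ⟨hrcl hz, hrz⟩
    have h2 := mapsTo_frontier_of_touching hρ hΩ hΩc hrd hrcl hz h1 x hx
    rw [hrfix x hx hfix] at h2
    exact not_mem_of_mem_frontier hΩ h2 hx
  have hrr : ∀ z ∈ Ω, r (r z) = r z := by
    intro z hz
    by_contra hne
    obtain ⟨V, hV, hVc, hVn⟩ : ∃ V ∈ 𝓝 (r z), IsClosed V ∧ r (r z) ∉ V :=
      ⟨closedBall (r z) (dist (r (r z)) (r z) / 2), closedBall_mem_nhds _ (half_pos (dist_pos.mpr hne)),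
        isClosed_closedBall, fun h => by
          rw [mem_closedBall] at h
          linarith [dist_pos.mpr hne]⟩
    refine hVn (hVc.mem_of_tendsto (hlim _ (hrm hz)) ?_)
    filter_upwards [hU _ ((hlim z hz).eventually_mem hV)] with m hmk
    have h1 : Tendsto (fun k : ℕ+ => F^[(m : ℕ)] (F^[(k : ℕ)] z)) U (𝓝 (F^[(m : ℕ)] (r z))) :=
      ((hdi m).continuousOn.continuousAt (hΩ.mem_nhds (hrm hz))).tendsto.comp (hlim z hz)
    refine hVc.mem_of_tendsto h1 ?_
    filter_upwards [hmk] with k hk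
    rw [iterate_add_apply', ← PNat.add_coe]
    exact hk
  have hFr : ∀ z ∈ Ω, F (r z) = r (F z) := by
    intro z hz
    have h1 : Tendsto (fun m : ℕ+ => F (F^[(m : ℕ)] z)) U (𝓝 (F (r z))) :=
      (hF.continuousOn.continuousAt (hΩ.mem_nhds (hrm hz))).tendsto.comp (hlim z hz)
    refine tendsto_nhds_unique h1 ((hlim _ (hm hz)).congr fun m => ?_)
    rw [← iterate_succ_apply, iterate_succ_apply']
  have hrx : r x = x := hrfix x hx hfix
  set L := fderiv ℂ F x with hL
  set R := fderiv ℂ r x with hR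
  have hRd : HasFDerivAt r R x := (hrd.differentiableAt (hΩ.mem_nhds hx)).hasFDerivAt
  have hRt : Tendsto (fun m : ℕ+ => L ^ (m : ℕ)) U (𝓝 R) :=
    hRlim.congr fun m => (hasFDerivAt_iterate hΩ hF hx hfix m).fderiv
  have hRR : R * R = R := by
    have h1 : HasFDerivAt (r ∘ r) (R.comp R) x := HasFDerivAt.comp x (by rw [hrx]; exact hRd) hRd
    have h2 : r ∘ r =ᶠ[𝓝 x] r := by
      filter_upwards [hΩ.mem_nhds hx] with z hz using hrr z hz
    exact h1.unique (hRd.congr_of_eventuallyEq h2)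
  obtain ⟨C, hC⟩ := exists_norm_fderiv_pow_le hΩ hbd hF hm hx hfix
  have hLR : L * R = R := mul_limit_eq_of_no_eigen hRt hRR hC hμ
  -- averages of the iterates
  let V : Ultrafilter ℕ := hyperfilter ℕ
  have hV : (V : Filter ℕ) ≤ atTop := Nat.hyperfilter_le_atTop
  let g : ℕ → En n → En n := fun N z => mean (fun m => F^[m] z) N
  have hgd : ∀ N, DifferentiableOn ℂ (g N) Ω := fun N =>
    (DifferentiableOn.fun_sum fun m _ => hdi m).fun_const_smul _
  have hgB : ∀ N, ∀ z ∈ Ω, ‖g N z‖ ≤ B := fun N z hz =>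
    norm_mean_le (fun m => hB _ (hm.iterate m hz)) N
  set Q := ulim V g with hQ
  have hQd : DifferentiableOn ℂ Q Ω := differentiableOn_ulim hΩ hgd hgB
  have hQlim : ∀ z ∈ Ω, Tendsto (mean fun m => F^[m] z) V (𝓝 (Q z)) := fun z hz =>
    tendsto_ulim (Eventually.of_forall fun m => hgB m z hz)
  have hPlim := tendsto_fderiv_ulim (U := V) hΩ hgd hgB hx
  rw [← hQ] at hPlim
  clear_value Q
  have hQB : ∀ z ∈ Ω, ‖Q z‖ ≤ B := fun z hz => le_of_tendsto (hQlim z hz).norm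
    (Eventually.of_forall fun N => hgB N z hz)
  have hQF : ∀ z ∈ Ω, Q (F z) = Q z := fun z hz => tendsto_nhds_unique (hQlim _ (hm hz))
    (tendsto_mean_shift_one (fun m => hB _ (hm.iterate m hz)) hV (hQlim z hz))
  have hPR : (fderiv ℂ Q x).comp R = R := by
    have h1 : Tendsto (mean fun m => ((1 : ℂ)⁻¹) ^ m • L ^ m) V (𝓝 (fderiv ℂ Q x)) := by
      refine hPlim.congr fun N => ?_
      simp only [inv_one, one_pow, one_smul]
      exact HasFDerivAt.fderiv (HasFDerivAt.fun_const_smul (HasFDerivAt.fun_sum fun m _ =>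
        hasFDerivAt_iterate hΩ hF hx hfix m) _)
    refine ContinuousLinearMap.ext fun u => mean_limit_apply_eigen hV norm_one h1 ?_
    rw [one_smul]
    exact DFunLike.congr_fun hLR u
  set T : En n → En n := fun z => z - r z + Q (r z) with hT
  have hQr : DifferentiableOn ℂ (fun z => Q (r z)) Ω := hQd.comp hrd hrm
  have hTd : DifferentiableOn ℂ T Ω := (differentiableOn_id.sub hrd).add hQr
  have hTB : ∀ z ∈ Ω, ‖T z‖ ≤ B + B + B := fun z hz =>
    (norm_add_le _ _).trans (add_le_add ((norm_sub_le _ _).trans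
      (add_le_add (hB z hz) (hB _ (hrm hz)))) (hQB _ (hrm hz)))
  have hTx : fderiv ℂ T x = ContinuousLinearEquiv.refl ℂ (En n) := by
    have h1 : HasFDerivAt Q (fderiv ℂ Q x) (r x) := by
      rw [hrx]; exact (hQd.differentiableAt (hΩ.mem_nhds hx)).hasFDerivAt
    have h2 : HasFDerivAt T (ContinuousLinearMap.id ℂ (En n) - R + (fderiv ℂ Q x).comp R) x :=
      ((hasFDerivAt_id x).sub hRd).add (h1.comp x hRd)
    rw [h2.fderiv, hPR, sub_add_cancel]
    rfl
  have hTs : HasStrictFDerivAt T (ContinuousLinearEquiv.refl ℂ (En n) : En n →L[ℂ] En n) x := by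
    rw [← hTx]
    refine hasStrictFDerivAt_of_hasFDerivAt_of_continuousAt (f' := fderiv ℂ T) ?_ ?_
    · filter_upwards [hΩ.mem_nhds hx] with z hz
      exact (hTd.differentiableAt (hΩ.mem_nhds hz)).hasFDerivAt
    · refine ContinuousOn.continuousAt (s := Ω) ?_ (hΩ.mem_nhds hx)
      rw [continuousOn_clm_apply]
      exact fun a => (differentiableOn_fderiv_apply hΩ hTd hTB a).continuousOn
  have hsrc := hTs.toOpenPartialHomeomorph T |>.open_source.mem_nhds
    hTs.mem_toOpenPartialHomeomorph_source
  have hinj := (hTs.toOpenPartialHomeomorph T).injOn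
  rw [hTs.toOpenPartialHomeomorph_coe] at hinj
  have hrc : Tendsto r (𝓝 x) (𝓝 x) := by
    have := hRd.continuousAt.tendsto
    rwa [hrx] at this
  have hFc : Tendsto F (𝓝 x) (𝓝 x) := by
    have := (hF.differentiableAt (hΩ.mem_nhds hx)).continuousAt.tendsto
    rwa [hfix] at this
  have hFrd : DifferentiableOn ℂ (fun z => F (r z)) Ω := hF.comp hrd hrm
  have hev : (fun z => F (r z)) =ᶠ[𝓝 x] r := by
    filter_upwards [hΩ.mem_nhds hx, hrc.eventually_mem hsrc,
      (hFc.comp hrc).eventually_mem hsrc] with z hz h1 h2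
    refine hinj h2 h1 ?_
    simp only [hT, Function.comp_apply]
    rw [hrr z hz, hFr z hz, hrr _ (hm hz), sub_self, sub_self, zero_add, zero_add, ← hFr z hz,
      hQF _ (hrm hz)]
  exact ⟨r, hrd, hrm, hrr, eqOn_of_eventuallyEq_holo hΩ hΩc hFrd hrd hx hev, hrfix⟩

end Retraction

namespace LocalModel

variable {n : ℕ} {Ω : Set (En n)} {p : En n} {M : LocalModel Ω p} {K : ℝ} {F : En n → En n}

/-- An orbit staying away from the boundary point is bounded in the half-plane coordinate. -/
theorem Julia.norm_w_iterate_le (hK : M.Julia K) (hF : TangentMap Ω p F) {d : ℝ} (hd : 0 < d)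
    (hgap : ∀ m, d ≤ ‖F^[m] (M.ray K 1) - p‖) (m : ℕ) :
    ‖M.w (F^[m] (M.ray K 1))‖ ≤ (M.c * d ^ 2)⁻¹ := by
  have h1 : (1 : ℂ) ∈ rightHP := by simp [rightHP]
  have hmem : F^[m] (M.ray K 1) ∈ Ω := (hF.iterate m).maps (hK.ray_mem h1)
  have h2 := M.lower' (subset_closure hmem) (hK.near (hF.iterate m) h1)
  have h3 : M.c * d ^ 2 ≤ ‖M.h (F^[m] (M.ray K 1) - p)‖ := by
    refine le_trans ?_ (h2.trans (re_le_norm _))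
    have := M.c_pos
    have := hgap m
    gcongr
  rw [w, norm_inv]
  have := M.c_pos
  exact inv_anti₀ (by positivity) h3

/-- If the orbit of the base point stays away from the boundary point, then there is a nonconstant
retraction onto the fixed points. -/
theorem Julia.exists_nonconstant_retraction {ρ : En n → ℝ} (hρ : IsPcxCinfBoundary Ω ρ)
    (hΩ : IsOpen Ω) (hΩc : IsPreconnected Ω) (hbd : Bornology.IsBounded Ω) (hK : M.Julia K)
    (hp : p ∉ Ω) (hF : TangentMap Ω p F) {M₀ : ℝ}
    (hM₀ : ∀ m, ‖M.w (F^[m] (M.ray K 1))‖ ≤ M₀) :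
    ∃ r : En n → En n, DifferentiableOn ℂ r Ω ∧ MapsTo r Ω Ω ∧ (∀ z ∈ Ω, r (r z) = r z) ∧
      (¬ ∃ c, ∀ z ∈ Ω, r z = c) ∧ ∀ w ∈ r '' Ω, F w = w := by
  obtain ⟨X, hX, e, hec, he, helim⟩ := hK.exists_fixed_curve hΩ hbd hp hF hM₀
  have hX' : X ∈ Ici X := self_mem_Ici
  have he' : ∀ᶠ s in atTop, e s ∈ Ω ∧ F (e s) = e s := (eventually_ge_atTop X).mono he
  obtain ⟨r, hrd, hrm, hrr, hFr, hfix⟩ := exists_retraction hρ hΩ hΩc hbd hF.diff hF.maps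
    (he X hX').1 (he X hX').2 fun μ hμ hμ1 =>
      no_eigen_of_eventually_no_eigen hΩ hbd hF.diff hF.maps hec he hμ
        (hK.eventually_no_eigen hΩ hp hF hM₀ he' helim hμ1) X hX'
  refine ⟨r, hrd, hrm, hrr, ?_, by rintro _ ⟨z, hz, rfl⟩; exact hFr z hz⟩
  rintro ⟨c, hc⟩
  have hce : ∀ s ∈ Ici X, e s = c := fun s hs => by
    rw [← hfix _ (he s hs).1 (he s hs).2]; exact hc _ (he s hs).1
  have hep : Tendsto e atTop (𝓝 p) := by
    rw [tendsto_iff_norm_sub_tendsto_zero]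
    have h1 : Tendsto (fun s : ℝ => s⁻¹ * ((‖M.ℓ‖ * ‖M.v₀‖ + ‖M.tang‖) *
        ‖M.dil s⁻¹ (e s - p)‖)) atTop (𝓝 (0 * ((‖M.ℓ‖ * ‖M.v₀‖ + ‖M.tang‖) * ‖M.v₀‖))) :=
      tendsto_inv_atTop_zero.mul (helim.norm.const_mul _)
    rw [zero_mul] at h1
    refine squeeze_zero' (Eventually.of_forall fun _ => norm_nonneg _) ?_ h1
    filter_upwards [eventually_ge_atTop 1] with s hs
    have h2 := M.norm_dil_le hs (M.dil s⁻¹ (e s - p))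
    rwa [M.dil_dil_inv (by linarith)] at h2
  have hcp : c = p := tendsto_nhds_unique (tendsto_const_nhds.congr' (by
    filter_upwards [eventually_ge_atTop X] with s hs using (hce s hs).symm)) hep
  exact hp (hcp ▸ hce X hX' ▸ (he X hX').1)

end LocalModel

theorem main_theorem_case_k_eq_one
    {n : ℕ} (hn : 2 ≤ n) (Ω : Set (En n)) (ρ : En n → ℝ)
    (hΩ : IsDomain' Ω) (hbd : Bornology.IsBounded Ω)
    (hρ : IsPcxCinfBoundary Ω ρ)
    (p : En n) (hp : p ∈ frontier Ω) (hspc : StronglyPcxAt ρ p)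
    (F : En n → En n) (hF : DifferentiableOn ℂ F Ω) (hFself : MapsTo F Ω Ω)
    (ho : LittleOh Ω F p 1)
    (hne : ¬ ∀ z ∈ Ω, F z = z) :
    (∀ K ⊆ Ω, IsCompact K →
      TendstoUniformlyOn (fun m => F^[m]) (fun _ => p) atTop K) ∨
    (∃ r : En n → En n, DifferentiableOn ℂ r Ω ∧ MapsTo r Ω Ω ∧
      (∀ z ∈ Ω, r (r z) = r z) ∧ (¬ ∃ c : En n, ∀ z ∈ Ω, r z = c) ∧
      ∀ w ∈ r '' Ω, F w = w) := by
  obtain ⟨M⟩ := exists_localModel hρ hp hspc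
  have hp' : p ∉ Ω := not_mem_of_mem_frontier hΩ.1 hp
  obtain ⟨K, hK0, hJ⟩ := M.exists_julia hbd hp'
  have hK : M.Julia K := ⟨hK0, hJ⟩
  have hT : TangentMap Ω p F := TangentMap.of_littleOh hF hFself hp' ho
  have ha : M.ray K 1 ∈ Ω := hK.ray_mem (by simp [rightHP])
  by_cases hlim : Tendsto (fun m => F^[m] (M.ray K 1)) atTop (𝓝 p)
  · exact Or.inl fun Q hQ hQc =>
      tendstoUniformlyOn_of_tendsto_orbit hΩ.1 hΩ.2.isPreconnected hbd M hT ha hlim hQ hQc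
  · right
    rw [tendsto_iff_ultrafilter] at hlim
    push Not at hlim
    obtain ⟨U, hU, hUp⟩ := hlim
    obtain ⟨B, hB⟩ := hbd.exists_norm_le
    obtain ⟨b, hb⟩ := exists_tendsto_ultrafilter U (f := fun m => F^[m] (M.ray K 1))
      (Eventually.of_forall fun m => hB _ (hFself.iterate m ha))
    have hbp : b ≠ p := by rintro rfl; exact hUp hb
    have hbΩ := mem_of_tendsto_orbit hρ hΩ.1 hΩ.2.isPreconnected hbd hK hT hb hbp
    obtain ⟨d, hd, hgap⟩ := exists_gap hΩ.1 hbd hp' hF hFself ha hbΩ hU hb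
    exact hK.exists_nonconstant_retraction hρ hΩ.1 hΩ.2.isPreconnected hbd hp' hT
      (hK.norm_w_iterate_le hT hd hgap)
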